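/- Let δ > −1 and let Λ_n^δ := sup_{x∈S^d} a_κ ∫_{S^d} |K_n^δ(h_κ²;x,y)| h_κ²(y) dω(y), which is the operator norm of the Cesàro (C,δ) mean S_n^δ(h_κ²) on L^∞(h_κ²;S^d) (and on L¹(h_κ²;S^d)). Then there exist constants c₁, c₂ > 0, depending only on d, κ and δ, such that for all integers n ≥ 2: if δ > σ_κ then c₁ ≤ Λ_n^δ ≤ c₂; if δ = σ_κ then c₁ log n ≤ Λ_n^δ ≤ c₂ log n; and if −1 < δ < σ_κ then c₁ n^{σ_κ−δ} ≤ Λ_n^δ ≤ c₂ n^{σ_κ−δ}. -/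

import Mathlib

open MeasureTheory Finset Real

/-- Generalized binomial coefficient `C(x, k) = x (x-1) ⋯ (x-k+1) / k!`. -/
noncomputable def genBinom (x : ℝ) (k : ℕ) : ℝ :=
  (∏ i ∈ Finset.range k, (x - i)) / (Nat.factorial k)

/-- Jacobi polynomial `P_n^{(a,b)}(t)`. -/
noncomputable def jacobiP (n : ℕ) (a b t : ℝ) : ℝ :=
  ∑ m ∈ Finset.range (n + 1),
    genBinom (n + a) (n - m) * genBinom (n + b) m * ((t - 1) / 2) ^ m * ((t + 1) / 2) ^ (n - m)

/-- Pochhammer symbol `(a)_n`. -/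
noncomputable def poch (a : ℝ) (n : ℕ) : ℝ := ∏ i ∈ Finset.range n, (a + i)

/-- Gegenbauer polynomial `C_n^λ(t)`. -/
noncomputable def gegenC (n : ℕ) (l t : ℝ) : ℝ :=
  (poch (2 * l) n / poch (l + 1 / 2) n) * jacobiP n (l - 1 / 2) (l - 1 / 2) t

/-- Cesàro coefficient `A_m^δ = C(m+δ, m)`. -/
noncomputable def cesA (δ : ℝ) (m : ℕ) : ℝ := genBinom (m + δ) m

/-- The cube `[-1,1]^m`. -/
def cube (m : ℕ) : Set (Fin m → ℝ) := Set.univ.pi fun _ => Set.Icc (-1) 1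

/-- The weight `∏ (1+t_i)(1-t_i²)^{κ_i-1}` on the cube. -/
noncomputable def wprod {m : ℕ} (κ : Fin m → ℝ) (t : Fin m → ℝ) : ℝ :=
  ∏ i, (1 + t i) * (1 - t i ^ 2) ^ (κ i - 1)

/-- `λ_κ = |κ| + (d-1)/2`. -/
noncomputable def lamK (d : ℕ) (κ : Fin (d + 1) → ℝ) : ℝ := (∑ i, κ i) + ((d : ℝ) - 1) / 2

/-- The reproducing kernel `P_n(h_κ²; x, y)` on the sphere. -/
noncomputable def hP (d : ℕ) (κ : Fin (d + 1) → ℝ) (n : ℕ)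
    (x y : EuclideanSpace ℝ (Fin (d + 1))) : ℝ :=
  (∫ t in cube (d + 1), wprod κ t)⁻¹ * ((n + lamK d κ) / lamK d κ) *
    ∫ t in cube (d + 1), gegenC n (lamK d κ) (∑ i, x i * y i * t i) * wprod κ t

/-- The Cesàro `(C,δ)` kernel `K_n^δ(h_κ²; x, y)` on the sphere. -/
noncomputable def hK (d : ℕ) (κ : Fin (d + 1) → ℝ) (δ : ℝ) (n : ℕ)
    (x y : EuclideanSpace ℝ (Fin (d + 1))) : ℝ :=
  (cesA δ n)⁻¹ * ∑ k ∈ Finset.range (n + 1), cesA δ (n - k) * hP d κ k x y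

/-- `z̄ = (|z_1|, …, |z_{d+1}|)`. -/
noncomputable def ebar {m : ℕ} (z : EuclideanSpace ℝ (Fin m)) : EuclideanSpace ℝ (Fin m) :=
  (EuclideanSpace.equiv (Fin m) ℝ).symm fun i => |z i|

/-- `h_κ²(y) = ∏ |y_i|^{2κ_i}`. -/
noncomputable def hsq {m : ℕ} (κ : Fin m → ℝ) (y : EuclideanSpace ℝ (Fin m)) : ℝ :=
  ∏ i, |y i| ^ (2 * κ i)

/-- `σ_κ = (d-1)/2 + |κ| - min_i κ_i`. -/
noncomputable def sigmaK (d : ℕ) (κ : Fin (d + 1) → ℝ) : ℝ :=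
  ((d : ℝ) - 1) / 2 + (∑ i, κ i) - Finset.univ.inf' (Finset.univ_nonempty) κ

/-- The surface measure `dω` on the unit sphere `S^d`. -/
noncomputable def sphereMeas (d : ℕ) :
    Measure (Metric.sphere (0 : EuclideanSpace ℝ (Fin (d + 1))) 1) :=
  (volume : Measure (EuclideanSpace ℝ (Fin (d + 1)))).toSphere

/-- The operator norm `Λ_n^δ = sup_x a_κ ∫ |K_n^δ(h_κ²;x,y)| h_κ²(y) dω(y)`. -/
noncomputable def cesaroNormS (d : ℕ) (κ : Fin (d + 1) → ℝ) (δ : ℝ) (n : ℕ) : ℝ :=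
  ⨆ x : Metric.sphere (0 : EuclideanSpace ℝ (Fin (d + 1))) 1,
    (∫ y, hsq κ y ∂(sphereMeas d))⁻¹ * ∫ y, |hK d κ δ n x y| * hsq κ y ∂(sphereMeas d)

theorem poch_succ (a : ℝ) (n : ℕ) : poch a (n + 1) = poch a n * (a + n) := by
  simp [poch, Finset.prod_range_succ]

theorem poch_pos {a : ℝ} (ha : 0 < a) (n : ℕ) : 0 < poch a n :=
  Finset.prod_pos fun i _ => by positivity

/-- Falling factorials as quotients of Pochhammer symbols. -/
theorem prod_falling_eq_poch (γ : ℝ) (m k : ℕ) :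
    (∏ i ∈ Finset.range k, ((((m + k : ℕ) : ℝ) + (γ - 1)) - i)) * poch γ m = poch γ (m + k) := by
  induction k with
  | zero => simp
  | succ k ih =>
    rw [Finset.prod_range_succ', ← add_assoc, poch_succ, ← ih]
    have : ∀ i ∈ Finset.range k, (((m + k + 1 : ℕ) : ℝ) + (γ - 1)) - ((i + 1 : ℕ) : ℝ) =
        (((m + k : ℕ) : ℝ) + (γ - 1)) - i := fun i _ => by push_cast; ring
    rw [Finset.prod_congr rfl this]
    push_cast
    ring

/-- Coefficients of Gegenbauer polynomials in the homogeneous variables `(t-1)/2, (t+1)/2`. -/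
noncomputable def gegenCoeff (l : ℝ) (i j : ℕ) : ℝ :=
  poch (2 * l) (i + j) * poch (l + 1 / 2) (i + j) /
    (poch (l + 1 / 2) i * poch (l + 1 / 2) j * i.factorial * j.factorial)

theorem gegenC_eq_sum {l : ℝ} (hl : 0 < l) (n : ℕ) (t : ℝ) :
    gegenC n l t = ∑ q ∈ HasAntidiagonal.antidiagonal n,
      gegenCoeff l q.1 q.2 * ((t - 1) / 2) ^ q.1 * ((t + 1) / 2) ^ q.2 := by
  have hγ : 0 < l + 1 / 2 := by positivity
  rw [Finset.Nat.sum_antidiagonal_eq_sum_range_succ_mk, gegenC, jacobiP, Finset.mul_sum]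
  refine Finset.sum_congr rfl fun m hm => ?_
  obtain ⟨k, rfl⟩ := Nat.exists_eq_add_of_le (Nat.lt_succ_iff.mp (Finset.mem_range.mp hm))
  have h1 := prod_falling_eq_poch (l + 1 / 2) m k
  have h2 := prod_falling_eq_poch (l + 1 / 2) k m
  have e : l + 1 / 2 - 1 = l - 1 / 2 := by ring
  rw [e] at h1 h2
  rw [add_comm k m] at h2
  have p1 := (poch_pos hγ m).ne'
  have p2 := (poch_pos hγ k).ne'
  have p3 := (poch_pos hγ (m + k)).ne'
  rw [← eq_div_iff p1] at h1
  rw [← eq_div_iff p2] at h2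
  simp only [genBinom, gegenCoeff, Nat.add_sub_cancel_left, h1, h2]
  field_simp

theorem gegenC_zero {l : ℝ} (hl : 0 < l) (t : ℝ) : gegenC 0 l t = 1 := by
  rw [gegenC_eq_sum hl]; simp [gegenCoeff, poch]

theorem gegenC_one {l : ℝ} (hl : 0 < l) (t : ℝ) : gegenC 1 l t = 2 * l * t := by
  have hγ : l + 1 / 2 ≠ 0 := by positivity
  rw [gegenC_eq_sum hl]
  simp [gegenCoeff, poch, Finset.Nat.antidiagonal_succ]
  field_simp
  ring

/-- Shift in the first index. -/
def shiftFst (c : ℕ → ℕ → ℝ) (i j : ℕ) : ℝ := if i = 0 then 0 else c (i - 1) j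

/-- Shift in the second index. -/
def shiftSnd (c : ℕ → ℕ → ℝ) (i j : ℕ) : ℝ := if j = 0 then 0 else c i (j - 1)

theorem sum_shiftFst (c : ℕ → ℕ → ℝ) (a b : ℝ) (n : ℕ) :
    ∑ q ∈ HasAntidiagonal.antidiagonal (n + 1), shiftFst c q.1 q.2 * b ^ q.1 * a ^ q.2 =
      b * ∑ q ∈ HasAntidiagonal.antidiagonal n, c q.1 q.2 * b ^ q.1 * a ^ q.2 := by
  rw [Finset.Nat.sum_antidiagonal_succ, Finset.mul_sum]
  simp only [shiftFst, if_true, zero_mul, zero_add, Nat.add_eq_zero_iff, one_ne_zero, and_false,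
    if_false, Nat.add_sub_cancel]
  exact Finset.sum_congr rfl fun q _ => by ring

theorem sum_shiftSnd (c : ℕ → ℕ → ℝ) (a b : ℝ) (n : ℕ) :
    ∑ q ∈ HasAntidiagonal.antidiagonal (n + 1), shiftSnd c q.1 q.2 * b ^ q.1 * a ^ q.2 =
      a * ∑ q ∈ HasAntidiagonal.antidiagonal n, c q.1 q.2 * b ^ q.1 * a ^ q.2 := by
  rw [Finset.Nat.sum_antidiagonal_succ', Finset.mul_sum]
  simp only [shiftSnd, if_true, zero_mul, zero_add, Nat.add_eq_zero_iff, one_ne_zero, and_false,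
    if_false, Nat.add_sub_cancel]
  exact Finset.sum_congr rfl fun q _ => by ring

theorem gegenCoeff_succ_fst {l : ℝ} (hl : 0 < l) (i j : ℕ) :
    gegenCoeff l i j * ((2 * l + (i + j)) * (l + 1 / 2 + (i + j))) =
      gegenCoeff l (i + 1) j * ((i + 1) * (l + 1 / 2 + i)) := by
  have hγ : 0 < l + 1 / 2 := by positivity
  have p1 := (poch_pos hγ i).ne'
  have p2 := (poch_pos hγ j).ne'
  have h1 : l + 1 / 2 + i ≠ 0 := by positivity
  have e : i + 1 + j = i + j + 1 := by ring
  simp only [gegenCoeff, e, poch_succ, Nat.factorial_succ]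
  push_cast
  field_simp

theorem gegenCoeff_comm (l : ℝ) (i j : ℕ) : gegenCoeff l i j = gegenCoeff l j i := by
  simp only [gegenCoeff, add_comm i j]; ring

theorem shiftFst_gegenCoeff {l : ℝ} (hl : 0 < l) (i j : ℕ) :
    shiftFst (gegenCoeff l) i j * ((2 * l + ((i:ℝ) + j - 1)) * (l + 1 / 2 + ((i:ℝ) + j - 1))) =
      gegenCoeff l i j * (i * (l + 1 / 2 + i - 1)) := by
  cases i with
  | zero => simp [shiftFst]
  | succ i =>
    have := gegenCoeff_succ_fst hl i j
    simp only [shiftFst, Nat.add_eq_zero_iff, one_ne_zero, and_false, if_false, Nat.add_sub_cancel]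
    push_cast
    linear_combination this

theorem shiftSnd_gegenCoeff {l : ℝ} (hl : 0 < l) (i j : ℕ) :
    shiftSnd (gegenCoeff l) i j * ((2 * l + ((i:ℝ) + j - 1)) * (l + 1 / 2 + ((i:ℝ) + j - 1))) =
      gegenCoeff l i j * (j * (l + 1 / 2 + j - 1)) := by
  have := shiftFst_gegenCoeff hl j i
  have e : shiftFst (gegenCoeff l) j i = shiftSnd (gegenCoeff l) i j := by
    simp only [shiftFst, shiftSnd, gegenCoeff_comm l i]
  rw [e, gegenCoeff_comm l j i] at this
  linear_combination this

theorem gegenC_rec {l : ℝ} (hl : 0 < l) (n : ℕ) (t : ℝ) :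
    (n + 2) * gegenC (n + 2) l t =
      2 * (n + 1 + l) * t * gegenC (n + 1) l t - (n + 2 * l) * gegenC n l t := by
  set a := (t + 1) / 2 with ha
  set b := (t - 1) / 2 with hb
  set c := gegenCoeff l
  have ht : t = a + b := by rw [ha, hb]; ring
  have hab : a - b = 1 := by rw [ha, hb]; ring
  have key : ∀ q ∈ HasAntidiagonal.antidiagonal (n + 2),
      ((n:ℝ) + 2) * c q.1 q.2 = 2 * (n + 1 + l) * (shiftFst c q.1 q.2 + shiftSnd c q.1 q.2) -
        (n + 2 * l) * (shiftFst (shiftFst c) q.1 q.2 - 2 * shiftFst (shiftSnd c) q.1 q.2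
          + shiftSnd (shiftSnd c) q.1 q.2) := by
    rintro ⟨i, j⟩ hq
    rw [HasAntidiagonal.mem_antidiagonal] at hq
    simp only at hq ⊢
    have hN : (i:ℝ) + j = n + 2 := by exact_mod_cast hq
    have h1 := shiftFst_gegenCoeff hl i j
    have h2 := shiftSnd_gegenCoeff hl i j
    have h11 : shiftFst (shiftFst c) i j * ((2 * l + n) * (l + 1 / 2 + n)) =
        shiftFst c i j * (((i:ℝ) - 1) * (l + 1 / 2 + i - 2)) := by
      cases i with
      | zero => simp [shiftFst]
      | succ i =>
        have := shiftFst_gegenCoeff hl i j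
        push_cast at hN
        have e : (i:ℝ) + j - 1 = n := by linarith
        rw [e] at this
        simp only [shiftFst, Nat.add_eq_zero_iff, one_ne_zero, and_false, if_false,
          Nat.add_sub_cancel] at this ⊢
        push_cast
        linear_combination this
    have h22 : shiftSnd (shiftSnd c) i j * ((2 * l + n) * (l + 1 / 2 + n)) =
        shiftSnd c i j * (((j:ℝ) - 1) * (l + 1 / 2 + j - 2)) := by
      cases j with
      | zero => simp [shiftSnd]
      | succ j =>
        have := shiftSnd_gegenCoeff hl i j
        push_cast at hN
        have e : (i:ℝ) + j - 1 = n := by linarith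
        rw [e] at this
        simp only [shiftSnd, Nat.add_eq_zero_iff, one_ne_zero, and_false, if_false,
          Nat.add_sub_cancel] at this ⊢
        push_cast
        linear_combination this
    have h12 : shiftFst (shiftSnd c) i j * ((2 * l + n) * (l + 1 / 2 + n)) =
        shiftFst c i j * ((j:ℝ) * (l + 1 / 2 + j - 1)) := by
      cases i with
      | zero => simp [shiftFst]
      | succ i =>
        have := shiftSnd_gegenCoeff hl i j
        push_cast at hN
        have e : (i:ℝ) + j - 1 = n := by linarith
        rw [e] at this
        simp only [shiftFst, Nat.add_eq_zero_iff, one_ne_zero, and_false, if_false,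
          Nat.add_sub_cancel] at this ⊢
        linear_combination this
    have e : (i:ℝ) + j - 1 = n + 1 := by linarith
    rw [e] at h1 h2
    have q1 : 2 * l + ((n:ℝ) + 1) ≠ 0 := by positivity
    have q2 : l + 1 / 2 + ((n:ℝ) + 1) ≠ 0 := by positivity
    have q3 : 2 * l + (n:ℝ) ≠ 0 := by positivity
    have q4 : l + 1 / 2 + (n:ℝ) ≠ 0 := by positivity
    rw [← eq_div_iff (mul_ne_zero q3 q4)] at h11 h12 h22
    rw [← eq_div_iff (mul_ne_zero q1 q2)] at h1 h2
    rw [h11, h12, h22, h1, h2]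
    have hj : (j:ℝ) = n + 2 - i := by linarith
    rw [hj]
    field_simp
    ring
  have s1 := sum_shiftFst c a b (n + 1)
  have s2 := sum_shiftSnd c a b (n + 1)
  have s11 := sum_shiftFst (shiftFst c) a b (n + 1)
  have s12 := sum_shiftFst (shiftSnd c) a b (n + 1)
  have s22 := sum_shiftSnd (shiftSnd c) a b (n + 1)
  rw [sum_shiftFst c a b n] at s11
  rw [sum_shiftSnd c a b n] at s12 s22
  rw [gegenC_eq_sum hl, gegenC_eq_sum hl, gegenC_eq_sum hl]
  have : ((n:ℝ) + 2) * ∑ q ∈ HasAntidiagonal.antidiagonal (n + 2), c q.1 q.2 * b ^ q.1 * a ^ q.2 =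
      ∑ q ∈ HasAntidiagonal.antidiagonal (n + 2),
      (2 * (n + 1 + l) * (shiftFst c q.1 q.2 + shiftSnd c q.1 q.2) -
        (n + 2 * l) * (shiftFst (shiftFst c) q.1 q.2 - 2 * shiftFst (shiftSnd c) q.1 q.2
          + shiftSnd (shiftSnd c) q.1 q.2)) * b ^ q.1 * a ^ q.2 := by
    rw [Finset.mul_sum]
    refine Finset.sum_congr rfl fun q hq => ?_
    rw [← key q hq]; ring
  rw [this]
  have split : ∀ q ∈ HasAntidiagonal.antidiagonal (n + 2),
      (2 * (n + 1 + l) * (shiftFst c q.1 q.2 + shiftSnd c q.1 q.2) -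
        (n + 2 * l) * (shiftFst (shiftFst c) q.1 q.2 - 2 * shiftFst (shiftSnd c) q.1 q.2
          + shiftSnd (shiftSnd c) q.1 q.2)) * b ^ q.1 * a ^ q.2 =
      2 * (n + 1 + l) * (shiftFst c q.1 q.2 * b ^ q.1 * a ^ q.2) +
      2 * (n + 1 + l) * (shiftSnd c q.1 q.2 * b ^ q.1 * a ^ q.2) -
      (n + 2 * l) * (shiftFst (shiftFst c) q.1 q.2 * b ^ q.1 * a ^ q.2) +
      2 * (n + 2 * l) * (shiftFst (shiftSnd c) q.1 q.2 * b ^ q.1 * a ^ q.2) -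
      (n + 2 * l) * (shiftSnd (shiftSnd c) q.1 q.2 * b ^ q.1 * a ^ q.2) := fun q _ => by ring
  rw [Finset.sum_congr rfl split]
  simp only [Finset.sum_sub_distrib, Finset.sum_add_distrib, ← Finset.mul_sum]
  rw [s1, s2, s11, s12, s22]
  set S := ∑ q ∈ HasAntidiagonal.antidiagonal n, c q.1 q.2 * b ^ q.1 * a ^ q.2
  set T := ∑ q ∈ HasAntidiagonal.antidiagonal (n + 1), c q.1 q.2 * b ^ q.1 * a ^ q.2
  linear_combination (-2 * (n + 1 + l) * T) * ht - (n + 2 * l) * S * (a - b + 1) * hab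

/-- Taylor series at the origin as a formal power series. -/
noncomputable def tcoef (f : ℂ → ℂ) : PowerSeries ℂ :=
  PowerSeries.mk fun n => iteratedDeriv n f 0 / (n.factorial : ℂ)

theorem tcoef_mul {f g : ℂ → ℂ} (hf : AnalyticAt ℂ f 0) (hg : AnalyticAt ℂ g 0) :
    tcoef (f * g) = tcoef f * tcoef g := by
  ext n
  rw [PowerSeries.coeff_mul, Finset.Nat.sum_antidiagonal_eq_sum_range_succ_mk]
  simp only [tcoef, PowerSeries.coeff_mk]
  rw [iteratedDeriv_mul hf.contDiffAt hg.contDiffAt, Finset.sum_div]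
  refine Finset.sum_congr rfl fun i hi => ?_
  have hi' : i ≤ n := Nat.lt_succ_iff.mp (Finset.mem_range.mp hi)
  have := Nat.choose_mul_factorial_mul_factorial hi'
  have h2 : ((n.choose i : ℂ)) * (i.factorial : ℂ) * ((n - i).factorial : ℂ) = n.factorial := by
    exact_mod_cast this
  have a1 : (i.factorial : ℂ) ≠ 0 := by exact_mod_cast i.factorial_ne_zero
  have a2 : ((n - i).factorial : ℂ) ≠ 0 := by exact_mod_cast (n - i).factorial_ne_zero
  have a3 : (n.factorial : ℂ) ≠ 0 := by exact_mod_cast n.factorial_ne_zero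
  field_simp
  rw [← h2]
  ring

theorem tcoef_deriv (f : ℂ → ℂ) (n : ℕ) :
    PowerSeries.coeff n (tcoef (deriv f)) = (n + 1) * PowerSeries.coeff (n + 1) (tcoef f) := by
  simp only [tcoef, PowerSeries.coeff_mk, Nat.factorial_succ]
  rw [iteratedDeriv_succ']
  have a1 : (n.factorial : ℂ) ≠ 0 := by exact_mod_cast n.factorial_ne_zero
  have a2 : ((n : ℂ) + 1) ≠ 0 := by exact_mod_cast Nat.succ_ne_zero n
  push_cast
  field_simp

theorem tcoef_congr {f g : ℂ → ℂ} (h : f =ᶠ[nhds 0] g) : tcoef f = tcoef g := by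
  ext n
  simp only [tcoef, PowerSeries.coeff_mk, h.iteratedDeriv_eq n]

theorem tcoef_monomial (k : ℕ) : tcoef (fun z => z ^ k) = PowerSeries.X ^ k := by
  ext n
  simp only [tcoef, PowerSeries.coeff_mk, PowerSeries.coeff_X_pow, iteratedDeriv_fun_pow_zero]
  split_ifs with h1
  · subst h1
    have a1 : (n.factorial : ℂ) ≠ 0 := by exact_mod_cast n.factorial_ne_zero
    simp [a1]
  · simp

theorem tcoef_add {f g : ℂ → ℂ} (hf : AnalyticAt ℂ f 0) (hg : AnalyticAt ℂ g 0) :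
    tcoef (f + g) = tcoef f + tcoef g := by
  ext n
  simp only [tcoef, PowerSeries.coeff_mk, map_add]
  rw [iteratedDeriv_add hf.contDiffAt hg.contDiffAt, add_div]

theorem tcoef_smul (c : ℂ) (f : ℂ → ℂ) : tcoef (fun z => c * f z) = PowerSeries.C c * tcoef f := by
  ext n
  simp only [tcoef, PowerSeries.coeff_mk, PowerSeries.coeff_C_mul]
  rw [iteratedDeriv_const_mul_field, mul_div_assoc]

theorem tcoef_const (c : ℂ) : tcoef (fun _ => c) = PowerSeries.C c := by
  have := tcoef_smul c (fun z => z ^ 0)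
  rw [tcoef_monomial] at this
  simpa using this

theorem tcoef_eq_integral {f : ℂ → ℂ} (hf : DifferentiableOn ℂ f (Metric.ball 0 1)) {ρ : ℝ}
    (h0 : 0 < ρ) (h1 : ρ < 1) (n : ℕ) :
    PowerSeries.coeff n (tcoef f) =
      (2 * π : ℂ)⁻¹ * ∫ φ in (-π)..π, ((circleMap 0 ρ φ) ^ n)⁻¹ * f (circleMap 0 ρ φ) := by
  lift ρ to NNReal using h0.le
  have hd : DifferentiableOn ℂ f (Metric.closedBall 0 ρ) :=
    hf.mono (Metric.closedBall_subset_ball h1)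
  have hp := hd.hasFPowerSeriesOnBall (R := ρ) (by exact_mod_cast h0)
  have h2 := hp.factorial_smul 1 n
  rw [cauchyPowerSeries_apply, ← iteratedDeriv_eq_iteratedFDeriv] at h2
  simp only [tcoef, PowerSeries.coeff_mk]
  have a1 : (n.factorial : ℂ) ≠ 0 := by exact_mod_cast n.factorial_ne_zero
  rw [← h2, nsmul_eq_mul, mul_div_cancel_left₀ _ a1]
  rw [circleIntegral]
  have hper : Function.Periodic
      (fun φ => ((circleMap 0 (ρ:ℝ) φ) ^ n)⁻¹ * f (circleMap 0 ρ φ)) (2 * π) := by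
    intro x
    simp only [periodic_circleMap 0 (ρ:ℝ) x]
  have e := hper.intervalIntegral_add_eq (-π) 0
  rw [show -π + 2 * π = π by ring, zero_add] at e
  rw [e, smul_eq_mul]
  have : ∀ φ : ℝ, deriv (circleMap 0 (ρ:ℝ)) φ • (1 / (circleMap 0 (ρ:ℝ) φ - 0)) ^ n •
      (circleMap 0 (ρ:ℝ) φ - 0)⁻¹ • f (circleMap 0 ρ φ) =
      Complex.I * (((circleMap 0 (ρ:ℝ) φ) ^ n)⁻¹ * f (circleMap 0 ρ φ)) := by
    intro φ
    have hne : circleMap 0 (ρ:ℝ) φ ≠ 0 := by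
      simp [circleMap, h0.ne']
    simp only [deriv_circleMap, smul_eq_mul, sub_zero, one_div, inv_pow]
    field_simp
  simp only [this, intervalIntegral.integral_const_mul]
  rw [← mul_assoc]
  congr 1
  have := Complex.I_ne_zero
  field_simp

/-- The base `1 - 2uz + z²`. -/
noncomputable def qf (u : ℝ) (z : ℂ) : ℂ := 1 - 2 * u * z + z ^ 2

theorem qf_mem_slitPlane {u : ℝ} (hu : |u| ≤ 1) {z : ℂ} (hz : ‖z‖ < 1) :
    qf u z ∈ Complex.slitPlane := by
  rw [Complex.mem_slitPlane_iff]
  by_contra! h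
  obtain ⟨h1, h2⟩ := h
  have hz2 : z.re ^ 2 + z.im ^ 2 < 1 := by
    have := Complex.sq_norm z
    rw [Complex.normSq_apply] at this
    nlinarith [norm_nonneg z]
  have hu2 : u ^ 2 ≤ 1 := by rw [abs_le] at hu; nlinarith
  simp [qf, pow_two] at h1 h2
  have h3 : (z.re - u) * z.im = 0 := by linarith
  rcases mul_eq_zero.mp h3 with h4 | h4
  · have : z.re = u := by linarith
    rw [this] at h1 hz2
    nlinarith
  · rw [h4] at h1 hz2
    nlinarith [sq_nonneg (z.re - u), sq_nonneg (z.re + u)]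

theorem hasDerivAt_qf (u : ℝ) (z : ℂ) : HasDerivAt (qf u) (2 * (z - u)) z := by
  have h := ((hasDerivAt_const z (1:ℂ)).sub ((hasDerivAt_id z).const_mul (2 * (u:ℂ)))).add
    ((hasDerivAt_id z).pow 2)
  refine h.congr_deriv ?_
  simp; ring

theorem hasDerivAt_qf_cpow {u : ℝ} (hu : |u| ≤ 1) (a : ℂ) {z : ℂ} (hz : ‖z‖ < 1) :
    HasDerivAt (fun z => qf u z ^ a) (a * qf u z ^ (a - 1) * (2 * (z - u))) z :=
  (hasDerivAt_qf u z).cpow_const (qf_mem_slitPlane hu hz)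

theorem differentiableOn_qf_cpow {u : ℝ} (hu : |u| ≤ 1) (a : ℂ) :
    DifferentiableOn ℂ (fun z => qf u z ^ a) (Metric.ball 0 1) := fun z hz =>
  (hasDerivAt_qf_cpow hu a (by simpa using hz)).differentiableAt.differentiableWithinAt

theorem analyticAt_of_ball {f : ℂ → ℂ} (hf : DifferentiableOn ℂ f (Metric.ball 0 1)) :
    AnalyticAt ℂ f 0 :=
  hf.analyticAt (Metric.ball_mem_nhds 0 one_pos)

theorem eventually_norm_lt : ∀ᶠ z : ℂ in nhds 0, ‖z‖ < 1 := by
  filter_upwards [Metric.ball_mem_nhds (0:ℂ) one_pos] with z hz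
  simpa using hz

theorem qf_ne_zero {u : ℝ} (hu : |u| ≤ 1) {z : ℂ} (hz : ‖z‖ < 1) : qf u z ≠ 0 :=
  Complex.slitPlane_ne_zero (qf_mem_slitPlane hu hz)

theorem tcoef_linear (a b : ℂ) : tcoef (fun z => a + b * z) =
    PowerSeries.C a + PowerSeries.C b * PowerSeries.X := by
  have h1 : tcoef (fun z => a + b * z) = tcoef ((fun _ => a) + fun z => b * z ^ 1) := by
    congr 1; ext z; simp
  rw [h1, tcoef_add (by fun_prop) (by fun_prop), tcoef_const, tcoef_smul, tcoef_monomial, pow_one]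

theorem tcoef_quad (a b c : ℂ) : tcoef (fun z => a + b * z + c * z ^ 2) =
    PowerSeries.C a + PowerSeries.C b * PowerSeries.X +
      PowerSeries.C c * PowerSeries.X ^ 2 := by
  have h1 : tcoef (fun z => a + b * z + c * z ^ 2) =
    tcoef ((fun z => a + b * z) + fun z => c * z ^ 2) := by congr 1
  rw [h1, tcoef_add (by fun_prop) (by fun_prop), tcoef_linear, tcoef_smul, tcoef_monomial]

section
variable {l u : ℝ}

theorem tcoef_qf_deriv (hu : |u| ≤ 1) (l : ℝ) :
    tcoef (deriv fun z => qf u z ^ (-(l:ℂ))) =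
      (PowerSeries.C (2 * l * u : ℂ) + PowerSeries.C (-2 * l : ℂ) * PowerSeries.X) *
        tcoef (fun z => qf u z ^ (-(l:ℂ) - 1)) := by
  rw [← tcoef_linear, ← tcoef_mul (by fun_prop) (analyticAt_of_ball (differentiableOn_qf_cpow hu _))]
  apply tcoef_congr
  filter_upwards [eventually_norm_lt] with z hz
  rw [(hasDerivAt_qf_cpow hu _ hz).deriv]
  simp only [Pi.mul_apply]
  ring

theorem tcoef_qf_mul (hu : |u| ≤ 1) (l : ℝ) :
    tcoef (fun z => qf u z ^ (-(l:ℂ))) =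
      (PowerSeries.C 1 + PowerSeries.C (-2 * u : ℂ) * PowerSeries.X +
      PowerSeries.C 1 * PowerSeries.X ^ 2) * tcoef (fun z => qf u z ^ (-(l:ℂ) - 1)) := by
  rw [← tcoef_quad, ← tcoef_mul (by fun_prop) (analyticAt_of_ball (differentiableOn_qf_cpow hu _))]
  apply tcoef_congr
  filter_upwards [eventually_norm_lt] with z hz
  have hne := qf_ne_zero hu hz
  simp only [Pi.mul_apply]
  rw [show (-(l:ℂ)) = (-(l:ℂ) - 1) + 1 by ring, Complex.cpow_add _ _ hne, Complex.cpow_one]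
  simp only [qf]
  ring_nf

theorem tcoef_qf_eq_gegenC (hl : 0 < l) (hu : |u| ≤ 1) (n : ℕ) :
    PowerSeries.coeff n (tcoef fun z => qf u z ^ (-(l:ℂ))) = (gegenC n l u : ℂ) := by
  set F := tcoef fun z => qf u z ^ (-(l:ℂ)) with hF
  set D := tcoef (deriv fun z => qf u z ^ (-(l:ℂ))) with hD
  have hode : (PowerSeries.C 1 + PowerSeries.C (-2 * u : ℂ) * PowerSeries.X +
      PowerSeries.C 1 * PowerSeries.X ^ 2) * D =
      (PowerSeries.C (2 * l * u : ℂ) + PowerSeries.C (-2 * l : ℂ) * PowerSeries.X) * F := by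
    rw [hF, hD, tcoef_qf_deriv hu, tcoef_qf_mul hu]; ring
  have hc : ∀ n, PowerSeries.coeff n D = (n + 1) * PowerSeries.coeff (n + 1) F :=
    fun n => tcoef_deriv _ n
  have h0 : PowerSeries.coeff 0 F = 1 := by simp [hF, tcoef, qf]
  have h1 : PowerSeries.coeff 1 F = 2 * l * u := by
    have := congrArg (PowerSeries.coeff 0) hode
    have hc0 := hc 0
    rw [PowerSeries.coeff_zero_eq_constantCoeff_apply] at this hc0 h0
    simp at this hc0
    rw [h0, hc0] at this
    simpa using this
  have hrec : ∀ n : ℕ, ((n:ℂ) + 2) * PowerSeries.coeff (n + 2) F =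
      2 * (n + 1 + l) * u * PowerSeries.coeff (n + 1) F - (n + 2 * l) * PowerSeries.coeff n F := by
    intro n
    have := congrArg (PowerSeries.coeff (n + 1)) hode
    simp only [add_mul, mul_assoc, map_add, PowerSeries.coeff_C_mul, map_one, one_mul] at this
    rw [PowerSeries.coeff_succ_X_mul, PowerSeries.coeff_succ_X_mul] at this
    cases n with
    | zero =>
      have e : PowerSeries.coeff (0 + 1) (PowerSeries.X ^ 2 * D) = 0 := by
        rw [PowerSeries.coeff_X_pow_mul']; simp
      rw [e, hc, hc] at this
      push_cast at this ⊢
      linear_combination this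
    | succ n =>
      have e : PowerSeries.coeff (n + 1 + 1) (PowerSeries.X ^ 2 * D) = PowerSeries.coeff n D := by
        rw [PowerSeries.coeff_X_pow_mul']; simp
      rw [e, hc, hc, hc] at this
      push_cast at this ⊢
      linear_combination this
  have main : ∀ n, PowerSeries.coeff n F = (gegenC n l u : ℂ) ∧
      PowerSeries.coeff (n + 1) F = (gegenC (n + 1) l u : ℂ) := by
    intro n
    induction n with
    | zero =>
      refine ⟨?_, ?_⟩
      · rw [h0, gegenC_zero hl]; simp
      · rw [zero_add, h1, gegenC_one hl]; push_cast; ring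
    | succ n ih =>
      refine ⟨ih.2, ?_⟩
      have a := hrec n
      have b := gegenC_rec hl n u
      have b' : ((n:ℂ) + 2) * (gegenC (n + 2) l u : ℂ) =
        2 * (n + 1 + l) * u * (gegenC (n + 1) l u : ℂ) - (n + 2 * l) * (gegenC n l u : ℂ) := by
        exact_mod_cast b
      rw [ih.1, ih.2, ← b'] at a
      have hne : (n:ℂ) + 2 ≠ 0 := by exact_mod_cast (Nat.succ_ne_zero (n + 1))
      exact mul_left_cancel₀ hne a
  exact (main n).1

theorem tcoef_poisson (hl : 0 < l) (hu : |u| ≤ 1) (n : ℕ) :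
    PowerSeries.coeff n (tcoef fun z => (1 - z ^ 2) * qf u z ^ (-((l + 1 : ℝ):ℂ))) =
      (((n + l) / l * gegenC n l u : ℝ) : ℂ) := by
  have e1 : tcoef (fun z => (1 - z ^ 2) * qf u z ^ (-((l + 1 : ℝ):ℂ))) =
      (PowerSeries.C 1 + PowerSeries.C 0 * PowerSeries.X +
      PowerSeries.C (-1) * PowerSeries.X ^ 2) * tcoef (fun z => qf u z ^ (-(l:ℂ) - 1)) := by
    rw [← tcoef_quad,
      ← tcoef_mul (by fun_prop) (analyticAt_of_ball (differentiableOn_qf_cpow hu _))]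
    congr 1
    ext z
    simp only [Pi.mul_apply]
    push_cast
    rw [show (-((l:ℂ) + 1)) = -(l:ℂ) - 1 by ring]
    ring
  have hl' : (l:ℂ) ≠ 0 := by exact_mod_cast hl.ne'
  have hll : (PowerSeries.C (l:ℂ)⁻¹ : PowerSeries ℂ) * PowerSeries.C (l:ℂ) = 1 := by
    rw [← map_mul, inv_mul_cancel₀ hl', map_one]
  have e2 : (PowerSeries.C 1 + PowerSeries.C 0 * PowerSeries.X +
      PowerSeries.C (-1) * PowerSeries.X ^ 2) * tcoef (fun z => qf u z ^ (-(l:ℂ) - 1)) =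
      tcoef (fun z => qf u z ^ (-(l:ℂ))) +
        PowerSeries.C (l:ℂ)⁻¹ * (PowerSeries.X * tcoef (deriv fun z => qf u z ^ (-(l:ℂ)))) := by
    rw [tcoef_qf_deriv hu, tcoef_qf_mul hu]
    simp only [map_mul, map_neg, map_zero, map_one]
    linear_combination (-(PowerSeries.C 2 * PowerSeries.C (u:ℂ) - PowerSeries.C 2 * PowerSeries.X) *
      PowerSeries.X * tcoef (fun z => qf u z ^ (-(l:ℂ) - 1))) * hll +
      ((PowerSeries.X ^ 2) * tcoef (fun z => qf u z ^ (-(l:ℂ) - 1))) * (map_ofNat (PowerSeries.C (R := ℂ)) 2)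
  rw [e1, e2, map_add, tcoef_qf_eq_gegenC hl hu, PowerSeries.coeff_C_mul]
  cases n with
  | zero => simp [hl']
  | succ n =>
    rw [PowerSeries.coeff_succ_X_mul, tcoef_deriv, tcoef_qf_eq_gegenC hl hu]
    push_cast
    field_simp
    ring

end

theorem cesA_zero (δ : ℝ) : cesA δ 0 = 1 := by simp [cesA, genBinom]

theorem cesA_succ (δ : ℝ) (n : ℕ) : ((n:ℝ) + 1) * cesA δ (n + 1) = (n + δ + 1) * cesA δ n := by
  simp only [cesA, genBinom, Finset.prod_range_succ', Nat.factorial_succ]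
  have : ∀ i ∈ Finset.range n, (((n + 1 : ℕ) : ℝ) + δ) - ((i + 1 : ℕ) : ℝ) =
      (n : ℝ) + δ - i := fun i _ => by push_cast; ring
  rw [Finset.prod_congr rfl this]
  have a1 : (n.factorial : ℝ) ≠ 0 := by exact_mod_cast n.factorial_ne_zero
  have a2 : ((n : ℝ) + 1) ≠ 0 := by positivity
  push_cast
  field_simp
  ring

theorem cesA_pos {δ : ℝ} (hδ : -1 < δ) (n : ℕ) : 0 < cesA δ n := by
  induction n with
  | zero => simp [cesA_zero]
  | succ n ih =>
    have h := cesA_succ δ n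
    have h1 : 0 < (n : ℝ) + δ + 1 := by have : (0:ℝ) ≤ n := n.cast_nonneg; linarith
    have h2 : 0 < ((n:ℝ) + 1) * cesA δ (n + 1) := h ▸ mul_pos h1 ih
    exact pos_of_mul_pos_right h2 (by positivity)

theorem one_sub_mem_slitPlane {z : ℂ} (hz : ‖z‖ < 1) : 1 - z ∈ Complex.slitPlane := by
  rw [sub_eq_add_neg]
  exact Complex.mem_slitPlane_of_norm_lt_one (by simpa using hz)

theorem hasDerivAt_one_sub_cpow (a : ℂ) {z : ℂ} (hz : ‖z‖ < 1) :
    HasDerivAt (fun z : ℂ => (1 - z) ^ a) (a * (1 - z) ^ (a - 1) * (-1)) z :=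
  ((hasDerivAt_id z).const_sub 1).cpow_const (one_sub_mem_slitPlane hz)

theorem differentiableOn_one_sub_cpow (a : ℂ) :
    DifferentiableOn ℂ (fun z : ℂ => (1 - z) ^ a) (Metric.ball 0 1) := fun z hz =>
  (hasDerivAt_one_sub_cpow a (by simpa using hz)).differentiableAt.differentiableWithinAt

theorem tcoef_one_sub_cpow (δ : ℝ) (n : ℕ) :
    PowerSeries.coeff n (tcoef fun z => (1 - z) ^ (-((δ + 1 : ℝ) : ℂ))) = (cesA δ n : ℂ) := by
  set F := tcoef fun z => (1 - z) ^ (-((δ + 1 : ℝ) : ℂ)) with hF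
  set D := tcoef (deriv fun z => (1 - z) ^ (-((δ + 1 : ℝ) : ℂ))) with hD
  have hode : (PowerSeries.C 1 + PowerSeries.C (-1) * PowerSeries.X) * D =
      PowerSeries.C (δ + 1 : ℂ) * F := by
    have han : AnalyticAt ℂ (deriv fun z : ℂ => (1 - z) ^ (-((δ + 1 : ℝ) : ℂ))) 0 :=
      (analyticAt_of_ball (differentiableOn_one_sub_cpow _)).deriv
    rw [hF, hD, ← tcoef_linear, ← tcoef_mul (by fun_prop) han, ← tcoef_smul]
    apply tcoef_congr
    filter_upwards [eventually_norm_lt] with z hz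
    have hne := Complex.slitPlane_ne_zero (one_sub_mem_slitPlane hz)
    simp only [Pi.mul_apply]
    rw [(hasDerivAt_one_sub_cpow _ hz).deriv, Complex.cpow_sub _ _ hne, Complex.cpow_one]
    push_cast
    field_simp
    ring
  have hc : ∀ n, PowerSeries.coeff n D = (n + 1) * PowerSeries.coeff (n + 1) F :=
    fun n => tcoef_deriv _ n
  have hrec : ∀ n : ℕ, ((n:ℂ) + 1) * PowerSeries.coeff (n + 1) F =
      (n + δ + 1) * PowerSeries.coeff n F := by
    intro n
    have := congrArg (PowerSeries.coeff n) hode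
    simp only [add_mul, mul_assoc, map_add, PowerSeries.coeff_C_mul, map_one, one_mul] at this
    cases n with
    | zero =>
      rw [hc] at this
      simp only [PowerSeries.coeff_zero_X_mul] at this
      simp only [Nat.cast_zero] at this ⊢
      linear_combination this
    | succ n =>
      rw [PowerSeries.coeff_succ_X_mul, hc, hc] at this
      push_cast at this ⊢
      linear_combination this
  induction n with
  | zero => simp [hF, tcoef, cesA_zero]
  | succ n ih =>
    have a := hrec n
    have b : ((n:ℂ) + 1) * (cesA δ (n + 1) : ℂ) = (n + δ + 1) * (cesA δ n : ℂ) := by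
      exact_mod_cast cesA_succ δ n
    rw [ih, ← b] at a
    have hne : (n:ℂ) + 1 ≠ 0 := by exact_mod_cast Nat.succ_ne_zero n
    exact mul_left_cancel₀ hne a

theorem differentiableOn_poisson {u : ℝ} (hu : |u| ≤ 1) (a : ℂ) :
    DifferentiableOn ℂ (fun z => (1 - z ^ 2) * qf u z ^ a) (Metric.ball 0 1) :=
  DifferentiableOn.mul (by fun_prop) (differentiableOn_qf_cpow hu a)

theorem poisson_eq_integral {l u ρ : ℝ} (hl : 0 < l) (hu : |u| ≤ 1) (h0 : 0 < ρ) (h1 : ρ < 1)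
    (n : ℕ) : (((n + l) / l * gegenC n l u : ℝ) : ℂ) =
      (2 * π : ℂ)⁻¹ * ∫ φ in (-π)..π, ((circleMap 0 ρ φ) ^ n)⁻¹ *
        ((1 - circleMap 0 ρ φ ^ 2) * qf u (circleMap 0 ρ φ) ^ (-((l + 1 : ℝ):ℂ))) := by
  rw [← tcoef_poisson hl hu, tcoef_eq_integral (differentiableOn_poisson hu _) h0 h1]

theorem cesaro_poisson_eq_integral {l u ρ : ℝ} (δ : ℝ) (hl : 0 < l) (hu : |u| ≤ 1) (h0 : 0 < ρ)
    (h1 : ρ < 1) (n : ℕ) :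
    ((∑ k ∈ Finset.range (n + 1), cesA δ (n - k) * ((k + l) / l * gegenC k l u) : ℝ) : ℂ) =
      (2 * π : ℂ)⁻¹ * ∫ φ in (-π)..π, ((circleMap 0 ρ φ) ^ n)⁻¹ *
        ((1 - circleMap 0 ρ φ) ^ (-((δ + 1 : ℝ) : ℂ)) *
        ((1 - circleMap 0 ρ φ ^ 2) * qf u (circleMap 0 ρ φ) ^ (-((l + 1 : ℝ):ℂ)))) := by
  have h := tcoef_eq_integral ((differentiableOn_one_sub_cpow (-((δ + 1 : ℝ) : ℂ))).mul
    (differentiableOn_poisson hu (-((l + 1 : ℝ):ℂ)))) h0 h1 n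
  simp only [Pi.mul_apply] at h
  rw [← h, tcoef_mul (analyticAt_of_ball (differentiableOn_one_sub_cpow _))
    (analyticAt_of_ball (differentiableOn_poisson hu _)), mul_comm, PowerSeries.coeff_mul,
    Finset.Nat.sum_antidiagonal_eq_sum_range_succ_mk, Complex.ofReal_sum]
  refine Finset.sum_congr rfl fun k _ => ?_
  rw [tcoef_poisson hl hu, tcoef_one_sub_cpow]
  push_cast
  ring

theorem rpow_le_of_mem_Icc {a b x s : ℝ} (ha : 0 < a) (hb : 1 ≤ b) (h1 : a ≤ x) (h2 : x ≤ b * a) :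
    x ^ s ≤ b ^ |s| * a ^ s := by
  have hx : 0 < x := ha.trans_le h1
  rcases le_total 0 s with hs | hs
  · rw [abs_of_nonneg hs, ← Real.mul_rpow (by linarith) ha.le]
    exact Real.rpow_le_rpow hx.le h2 hs
  · have : x ^ s ≤ a ^ s := Real.rpow_le_rpow_of_nonpos ha h1 hs
    have h3 : 1 ≤ b ^ |s| := Real.one_le_rpow hb (abs_nonneg s)
    nlinarith [Real.rpow_pos_of_pos ha s]

/-- A slanted segment from the vertex `e` of `[-1,1]`. -/
noncomputable def slant (e θ τ : ℝ) : ℂ := (e : ℂ) * (1 - τ) + Complex.I * θ * τ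

theorem slant_re (e θ τ : ℝ) : (slant e θ τ).re = e * (1 - τ) := by simp [slant]

theorem slant_im (e θ τ : ℝ) : (slant e θ τ).im = θ * τ := by simp [slant]

theorem norm_le_iff_sq {z : ℂ} {a : ℝ} (ha : 0 ≤ a) : ‖z‖ ≤ a ↔ z.re ^ 2 + z.im ^ 2 ≤ a ^ 2 := by
  rw [← sq_le_sq₀ (norm_nonneg z) ha, Complex.sq_norm, Complex.normSq_apply, pow_two z.re,
    pow_two z.im]

theorem le_norm_iff_sq {z : ℂ} {a : ℝ} (ha : 0 ≤ a) : a ≤ ‖z‖ ↔ a ^ 2 ≤ z.re ^ 2 + z.im ^ 2 := by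
  rw [← sq_le_sq₀ ha (norm_nonneg z), Complex.sq_norm, Complex.normSq_apply, pow_two z.re,
    pow_two z.im]

/-- The open disc through `1` and `-1` centred at `iR`. -/
def lensBall (R : ℝ) : Set ℂ := Metric.ball (Complex.I * R) (√(1 + R ^ 2))

theorem mem_lensBall {R : ℝ} {t : ℂ} : t ∈ lensBall R ↔ t.re ^ 2 + t.im ^ 2 < 1 + 2 * R * t.im := by
  have h : 0 < 1 + R ^ 2 := by positivity
  rw [lensBall, Metric.mem_ball, dist_eq_norm, ← not_le, le_norm_iff_sq (by positivity),
    Real.sq_sqrt h.le, not_le]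
  simp
  constructor <;> intro h <;> nlinarith

theorem slant_mem_lensBall {R e θ τ : ℝ} (hR : 0 ≤ R) (he : e ^ 2 = 1) (h0 : 0 ≤ θ) (h1 : θ ≤ 1 / 2)
    (ht0 : 0 < τ) (ht1 : τ ≤ 1) : slant e θ τ ∈ lensBall R := by
  rw [mem_lensBall, slant_re, slant_im, mul_pow, he]
  have : 0 ≤ R * (θ * τ) := by positivity
  have : θ ^ 2 ≤ 1 / 4 := by nlinarith
  have : (θ * τ) ^ 2 ≤ 1 / 4 * τ ^ 2 := by rw [mul_pow]; gcongr
  nlinarith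

theorem norm_sub_slant {e θ τ : ℝ} (he : e = 1 ∨ e = -1) (h0 : 0 ≤ θ) (h1 : θ ≤ 1 / 2)
    (ht0 : 0 < τ) (ht1 : τ ≤ 1) :
    τ ≤ ‖(e : ℂ) - slant e θ τ‖ ∧ ‖(e : ℂ) - slant e θ τ‖ ≤ 3 * τ ∧
    1 ≤ ‖(e : ℂ) + slant e θ τ‖ ∧ ‖(e : ℂ) + slant e θ τ‖ ≤ 3 := by
  have he2 : e ^ 2 = 1 := by rcases he with rfl | rfl <;> norm_num
  have hθ : θ ^ 2 ≤ 1 / 4 := by nlinarith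
  have hq : (θ * τ) ^ 2 ≤ 1 / 4 * τ ^ 2 := by rw [mul_pow]; gcongr
  have hq0 : 0 ≤ (θ * τ) ^ 2 := sq_nonneg _
  rw [le_norm_iff_sq ht0.le, norm_le_iff_sq (by positivity), le_norm_iff_sq zero_le_one,
    norm_le_iff_sq (by norm_num)]
  simp only [Complex.sub_re, Complex.sub_im, Complex.add_re, Complex.add_im, slant_re, slant_im,
    Complex.ofReal_re, Complex.ofReal_im]
  have e1 : (e - e * (1 - τ)) ^ 2 = τ ^ 2 := by
    rw [show e - e * (1 - τ) = e * τ by ring, mul_pow, he2, one_mul]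
  have e2 : (e + e * (1 - τ)) ^ 2 = (2 - τ) ^ 2 := by
    rw [show e + e * (1 - τ) = e * (2 - τ) by ring, mul_pow, he2, one_mul]
  rw [e1, e2]
  refine ⟨?_, ?_, ?_, ?_⟩ <;> nlinarith

theorem norm_weight_slant_le {e θ τ : ℝ} (s : ℝ) (he : e = 1 ∨ e = -1) (h0 : 0 ≤ θ)
    (h1 : θ ≤ 1 / 2) (ht0 : 0 < τ) (ht1 : τ ≤ 1) :
    ‖1 - slant e θ τ‖ ^ s * ‖1 + slant e θ τ‖ ^ s ≤ (3 ^ |s|) ^ 2 * τ ^ s := by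
  obtain ⟨a1, a2, a3, a4⟩ := norm_sub_slant he h0 h1 ht0 ht1
  have b1 := rpow_le_of_mem_Icc (s := s) ht0 (by norm_num : (1:ℝ) ≤ 3) a1 a2
  have b2 := rpow_le_of_mem_Icc (s := s) one_pos (by norm_num : (1:ℝ) ≤ 3) a3 (by linarith)
  rw [Real.one_rpow, mul_one] at b2
  have key : ‖(e : ℂ) - slant e θ τ‖ ^ s * ‖(e : ℂ) + slant e θ τ‖ ^ s ≤
      (3 ^ |s| * τ ^ s) * 3 ^ |s| := by gcongr
  have : ‖1 - slant e θ τ‖ ^ s * ‖1 + slant e θ τ‖ ^ s =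
      ‖(e : ℂ) - slant e θ τ‖ ^ s * ‖(e : ℂ) + slant e θ τ‖ ^ s := by
    rcases he with rfl | rfl
    · simp
    · rw [mul_comm]
      congr 2
      · rw [← norm_neg]; congr 1; push_cast; ring
      · rw [← norm_neg]; congr 1; push_cast; ring
  rw [this]
  linarith

theorem hasDerivAt_slant (e θ τ : ℝ) :
    HasDerivAt (slant e θ) (-(e:ℂ) + Complex.I * θ) τ := by
  have h := (hasDerivAt_id τ).ofReal_comp
  have := ((h.const_sub 1).const_mul (e:ℂ)).add (h.const_mul (Complex.I * θ))
  refine this.congr_deriv ?_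
  simp

theorem hasDerivAt_slant_angle (e θ τ : ℝ) :
    HasDerivAt (fun θ => slant e θ τ) (Complex.I * τ) θ := by
  have h := (hasDerivAt_id θ).ofReal_comp
  have := (((h.const_mul Complex.I).mul_const (τ:ℂ))).const_add ((e:ℂ) * (1 - τ))
  refine this.congr_deriv ?_
  simp

theorem continuous_slant (e θ : ℝ) : Continuous (slant e θ) := by unfold slant; fun_prop

section
variable {f : ℂ → ℂ} {R s M : ℝ}

theorem norm_slant_le
    (hM : 0 ≤ M) (hR : 0 ≤ R) (hb : ∀ t ∈ lensBall R, ‖f t‖ ≤ M * (‖1 - t‖ ^ s * ‖1 + t‖ ^ s))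
    {e θ τ : ℝ} (he : e = 1 ∨ e = -1) (h0 : 0 ≤ θ) (h1 : θ ≤ 1 / 2) (ht0 : 0 < τ) (ht1 : τ ≤ 1) :
    ‖f (slant e θ τ)‖ ≤ M * (3 ^ |s|) ^ 2 * τ ^ s := by
  have he2 : e ^ 2 = 1 := by rcases he with rfl | rfl <;> norm_num
  have := hb _ (slant_mem_lensBall hR he2 h0 h1 ht0 ht1)
  have h2 := norm_weight_slant_le s he h0 h1 ht0 ht1
  calc _ ≤ _ := this
    _ ≤ M * ((3 ^ |s|) ^ 2 * τ ^ s) := by gcongr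
    _ = _ := by ring

theorem continuousOn_slant (hf : ContinuousOn f (lensBall R)) (hR : 0 ≤ R)
    {e θ : ℝ} (he : e = 1 ∨ e = -1) (h0 : 0 ≤ θ) (h1 : θ ≤ 1 / 2) :
    ContinuousOn (fun τ => f (slant e θ τ)) (Set.Ioc 0 1) := by
  have he2 : e ^ 2 = 1 := by rcases he with rfl | rfl <;> norm_num
  exact hf.comp (continuous_slant e θ).continuousOn
    fun τ hτ => slant_mem_lensBall hR he2 h0 h1 hτ.1 hτ.2

theorem intervalIntegrable_slant (hf : ContinuousOn f (lensBall R)) (hM : 0 ≤ M) (hR : 0 ≤ R)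
    (hs : -1 < s) (hb : ∀ t ∈ lensBall R, ‖f t‖ ≤ M * (‖1 - t‖ ^ s * ‖1 + t‖ ^ s))
    {e θ : ℝ} (he : e = 1 ∨ e = -1) (h0 : 0 ≤ θ) (h1 : θ ≤ 1 / 2) :
    IntervalIntegrable (fun τ => f (slant e θ τ)) volume 0 1 := by
  have hdom : IntervalIntegrable (fun τ : ℝ => M * (3 ^ |s|) ^ 2 * τ ^ s) volume 0 1 :=
    (intervalIntegral.intervalIntegrable_rpow' hs).const_mul _
  refine hdom.mono_fun ?_ ?_
  · rw [Set.uIoc_of_le zero_le_one]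
    exact (continuousOn_slant hf hR he h0 h1).aestronglyMeasurable measurableSet_Ioc
  · rw [Set.uIoc_of_le zero_le_one]
    refine (ae_restrict_iff' measurableSet_Ioc).mpr (Filter.Eventually.of_forall fun τ hτ => ?_)
    exact (norm_slant_le hM hR hb he h0 h1 hτ.1 hτ.2).trans (le_abs_self _)

/-- Shifting the segment `[-1,1]` to a tent-shaped path with the same endpoints. -/
theorem integral_tent_eq (hf : DifferentiableOn ℂ f (lensBall R)) (hM : 0 ≤ M) (hR : 0 ≤ R)
    (hs : -1 < s) (hb : ∀ t ∈ lensBall R, ‖f t‖ ≤ M * (‖1 - t‖ ^ s * ‖1 + t‖ ^ s)) :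
    (∫ τ in (0:ℝ)..1, f (slant 1 0 τ)) + ∫ τ in (0:ℝ)..1, f (slant (-1) 0 τ) =
    (1 - Complex.I / 2) * (∫ τ in (0:ℝ)..1, f (slant 1 (1 / 2) τ)) +
    (1 + Complex.I / 2) * ∫ τ in (0:ℝ)..1, f (slant (-1) (1 / 2) τ) := by
  obtain ⟨F, hF⟩ : Complex.IsExactOn f (lensBall R) := hf.isExactOn_ball
  have hpath : ∀ {e θ η : ℝ}, (e = 1 ∨ e = -1) → 0 ≤ θ → θ ≤ 1 / 2 → 0 < η → η ≤ 1 →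
      (-(e:ℂ) + Complex.I * θ) * ∫ τ in η..1, f (slant e θ τ) =
        F (slant e θ 1) - F (slant e θ η) := by
    intro e θ η he h0 h1 hη hη1
    have he2 : e ^ 2 = 1 := by rcases he with rfl | rfl <;> norm_num
    rw [← intervalIntegral.integral_const_mul]
    refine intervalIntegral.integral_eq_sub_of_hasDerivAt (f := fun τ => F (slant e θ τ))
      (fun τ hτ => ?_) ?_
    · rw [Set.uIcc_of_le hη1] at hτ
      have := (hF _ (slant_mem_lensBall hR he2 h0 h1 (hη.trans_le hτ.1) hτ.2)).comp_of_eq τ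
        (hasDerivAt_slant e θ τ) rfl
      refine this.congr_deriv (by ring)
    · refine (((continuousOn_slant hf.continuousOn hR he h0 h1).mono ?_).intervalIntegrable).const_mul _
      rw [Set.uIcc_of_le hη1]
      exact fun τ hτ => ⟨hη.trans_le hτ.1, hτ.2⟩
  set K := M * (3 ^ |s|) ^ 2 with hK
  have hK0 : 0 ≤ K := by positivity
  have hdiff : ∀ {e η : ℝ}, (e = 1 ∨ e = -1) → 0 < η → η ≤ 1 →
      ‖F (slant e (1 / 2) η) - F (slant e 0 η)‖ ≤ K * η ^ (s + 1) := by
    intro e η he hη hη1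
    have he2 : e ^ 2 = 1 := by rcases he with rfl | rfl <;> norm_num
    have := Convex.norm_image_sub_le_of_norm_hasDerivWithin_le (𝕜 := ℝ) (s := Set.Icc (0:ℝ) (1 / 2))
      (f := fun θ => F (slant e θ η)) (f' := fun θ => f (slant e θ η) * (Complex.I * η))
      (C := K * η ^ s * η) (x := 0) (y := 1 / 2) (fun θ hθ => ?_) (fun θ hθ => ?_)
      (convex_Icc _ _) (by norm_num) (by norm_num)
    · refine this.trans ?_
      rw [Real.rpow_add_one hη.ne']
      have : 0 ≤ K * η ^ s * η := by positivity
      norm_num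
      nlinarith
    · exact ((hF _ (slant_mem_lensBall hR he2 hθ.1 hθ.2 hη hη1)).comp_of_eq θ
        (hasDerivAt_slant_angle e θ η) rfl).hasDerivWithinAt
    · rw [norm_mul]
      have := norm_slant_le hM hR hb he hθ.1 hθ.2 hη hη1
      have h3 : ‖Complex.I * (η:ℂ)‖ = η := by simp [abs_of_pos hη]
      rw [h3]
      gcongr
  have hlim : ∀ {e θ : ℝ}, (e = 1 ∨ e = -1) → 0 ≤ θ → θ ≤ 1 / 2 →
      Filter.Tendsto (fun η => ∫ τ in η..1, f (slant e θ τ)) (nhdsWithin 0 (Set.Ioc 0 1))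
        (nhds (∫ τ in (0:ℝ)..1, f (slant e θ τ))) := by
    intro e θ he h0 h1
    have hi := intervalIntegrable_slant hf.continuousOn hM hR hs hb he h0 h1
    have hi' : IntegrableOn (fun τ => f (slant e θ τ)) (Set.uIcc 0 1) := by
      rw [Set.uIcc_of_le zero_le_one]
      exact (intervalIntegrable_iff_integrableOn_Icc_of_le zero_le_one).mp hi
    have := intervalIntegral.continuousOn_primitive_interval_left hi' 0 (by simp)
    refine this.mono_left (nhdsWithin_mono _ ?_)
    rw [Set.uIcc_of_le zero_le_one]
    exact Set.Ioc_subset_Icc_self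
  have h1l := hlim (e := 1) (θ := 0) (Or.inl rfl) le_rfl (by norm_num)
  have h2l := hlim (e := -1) (θ := 0) (Or.inr rfl) le_rfl (by norm_num)
  have h3l := hlim (e := 1) (θ := 1 / 2) (Or.inl rfl) (by norm_num) le_rfl
  have h4l := hlim (e := -1) (θ := 1 / 2) (Or.inr rfl) (by norm_num) le_rfl
  have htot := (h1l.add h2l).sub ((h3l.const_mul (1 - Complex.I / 2)).add
    (h4l.const_mul (1 + Complex.I / 2)))
  have hzero : Filter.Tendsto (fun η : ℝ => 2 * (K * η ^ (s + 1)))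
      (nhdsWithin 0 (Set.Ioc 0 1)) (nhds 0) := by
    have : Filter.Tendsto (fun η : ℝ => 2 * (K * η ^ (s + 1))) (nhds 0)
        (nhds (2 * (K * 0 ^ (s + 1)))) :=
      ((Real.continuousAt_rpow_const 0 (s + 1) (Or.inr (by linarith))).const_mul K).const_mul 2
    rw [Real.zero_rpow (by linarith), mul_zero, mul_zero] at this
    exact this.mono_left nhdsWithin_le_nhds
  have hne : (nhdsWithin (0:ℝ) (Set.Ioc 0 1)).NeBot := by
    rw [nhdsWithin_Ioc_eq_nhdsGT one_pos]; infer_instance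
  have hbd : ∀ᶠ η in nhdsWithin (0:ℝ) (Set.Ioc 0 1),
      ‖((∫ τ in η..1, f (slant 1 0 τ)) + ∫ τ in η..1, f (slant (-1) 0 τ)) -
      ((1 - Complex.I / 2) * (∫ τ in η..1, f (slant 1 (1 / 2) τ)) +
      (1 + Complex.I / 2) * ∫ τ in η..1, f (slant (-1) (1 / 2) τ))‖ ≤ 2 * (K * η ^ (s + 1)) := by
    filter_upwards [self_mem_nhdsWithin] with η hη
    have p1 := hpath (e := 1) (θ := 0) (Or.inl rfl) le_rfl (by norm_num) hη.1 hη.2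
    have p2 := hpath (e := -1) (θ := 0) (Or.inr rfl) le_rfl (by norm_num) hη.1 hη.2
    have p3 := hpath (e := 1) (θ := 1 / 2) (Or.inl rfl) (by norm_num) le_rfl hη.1 hη.2
    have p4 := hpath (e := -1) (θ := 1 / 2) (Or.inr rfl) (by norm_num) le_rfl hη.1 hη.2
    have d1 := hdiff (e := 1) (Or.inl rfl) hη.1 hη.2
    have d2 := hdiff (e := -1) (Or.inr rfl) hη.1 hη.2
    have q1 : slant 1 0 1 = slant (-1) 0 1 := by simp [slant]
    have q2 : slant 1 (1 / 2) 1 = slant (-1) (1 / 2) 1 := by simp [slant]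
    rw [q1] at p1
    rw [q2] at p3
    push_cast at p1 p2 p3 p4
    have : ((∫ τ in η..1, f (slant 1 0 τ)) + ∫ τ in η..1, f (slant (-1) 0 τ)) -
      ((1 - Complex.I / 2) * (∫ τ in η..1, f (slant 1 (1 / 2) τ)) +
      (1 + Complex.I / 2) * ∫ τ in η..1, f (slant (-1) (1 / 2) τ)) =
      -(F (slant 1 (1 / 2) η) - F (slant 1 0 η)) +
        (F (slant (-1) (1 / 2) η) - F (slant (-1) 0 η)) := by
      linear_combination -p1 + p2 + p3 - p4
    rw [this]
    calc _ ≤ _ := norm_add_le _ _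
      _ ≤ _ := by rw [norm_neg]; linarith
  have := le_of_tendsto_of_tendsto htot.norm hzero hbd
  exact sub_eq_zero.mp (norm_le_zero_iff.mp this)

end

/-- The right half-plane. -/
def rhp : Set ℂ := {z | 0 < z.re}

theorem isOpen_rhp : IsOpen rhp := isOpen_lt continuous_const Complex.continuous_re

theorem one_sub_slitPlane_of_lens {R : ℝ} {t : ℂ} (ht : t ∈ lensBall R) :
    1 - t ∈ Complex.slitPlane ∧ 1 + t ∈ Complex.slitPlane := by
  rw [mem_lensBall] at ht
  rw [Complex.mem_slitPlane_iff, Complex.mem_slitPlane_iff]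
  simp only [Complex.sub_re, Complex.sub_im, Complex.add_re, Complex.add_im, Complex.one_re,
    Complex.one_im]
  constructor
  · by_contra! h
    have : t.im = 0 := by linarith [h.2]
    rw [this] at ht
    nlinarith [h.1]
  · by_contra! h
    have : t.im = 0 := by linarith [h.2]
    rw [this] at ht
    nlinarith [h.1]

theorem re_pos_of_mem_closure_lens {z t : ℂ} {b : ℝ} (hz : 0 < z.re) (hb : 0 ≤ b)
    (ht : t ∈ Metric.closedBall (Complex.I * ((b + 1) / z.re : ℝ)) (√(1 + ((b + 1) / z.re) ^ 2))) :
    z - Complex.I * b * t ∈ rhp := by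
  set R := (b + 1) / z.re with hR
  have hR0 : 0 < R := by positivity
  have h : 0 < 1 + R ^ 2 := by positivity
  rw [Metric.mem_closedBall, dist_eq_norm, norm_le_iff_sq (by positivity),
    Real.sq_sqrt h.le] at ht
  simp at ht
  have e : (z - Complex.I * b * t).re = z.re + b * t.im := by simp
  show 0 < (z - Complex.I * b * t).re
  rw [e]
  have hzR : z.re * R = b + 1 := by rw [hR]; field_simp
  by_contra! h1
  have h2 : 0 ≤ t.re ^ 2 := sq_nonneg _
  have h3 : 0 ≤ 1 + 2 * R * t.im - t.im ^ 2 := by nlinarith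
  have h4 : (b + 1) + b * (R * t.im) ≤ 0 := by nlinarith
  have h5 : -1 / 2 ≤ R * t.im := by nlinarith [sq_nonneg t.im]
  nlinarith

theorem kernel_one_variable_aux {κ : ℝ} (hκ : 0 < κ) {g : ℂ → ℂ} (hg : DifferentiableOn ℂ g rhp)
    {z : ℂ} (hz : 0 < z.re) {b η : ℝ} (hb : 0 ≤ b) (hη : η = 1 ∨ η = -1) :
    ‖∫ t in (-1:ℝ)..1, g (z - Complex.I * b * t) * (((1 + η * t) * (1 - t ^ 2) ^ (κ - 1) : ℝ) : ℂ)‖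
      ≤ 6 * (3 ^ |κ - 1|) ^ 2 *
      ((∫ τ in (0:ℝ)..1, ‖g (z - Complex.I * b * slant 1 (1 / 2) τ)‖ * τ ^ (κ - 1)) +
        ∫ τ in (0:ℝ)..1, ‖g (z - Complex.I * b * slant (-1) (1 / 2) τ)‖ * τ ^ (κ - 1)) := by
  set R := (b + 1) / z.re with hR
  have hR0 : 0 < R := by positivity
  set s := κ - 1 with hs
  have hs1 : -1 < s := by linarith
  set f : ℂ → ℂ := fun t => g (z - Complex.I * b * t) * (1 + η * t) *
    ((1 - t) ^ (s : ℂ) * (1 + t) ^ (s : ℂ)) with hf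
  have hcb : ContinuousOn (fun t : ℂ => g (z - Complex.I * b * t) * (1 + η * t))
      (Metric.closedBall (Complex.I * (R : ℝ)) (√(1 + R ^ 2))) := by
    refine ContinuousOn.mul (hg.continuousOn.comp (by fun_prop) fun t ht => ?_) (by fun_prop)
    exact re_pos_of_mem_closure_lens hz hb ht
  obtain ⟨M, hM⟩ := (isCompact_closedBall _ _).exists_bound_of_continuousOn hcb
  have hmem : Complex.I * (R : ℝ) ∈ Metric.closedBall (Complex.I * (R : ℝ)) (√(1 + R ^ 2)) :=
    Metric.mem_closedBall_self (by positivity)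
  have hM0 : 0 ≤ M := (norm_nonneg _).trans (hM _ hmem)
  have hsub : lensBall R ⊆ Metric.closedBall (Complex.I * (R : ℝ)) (√(1 + R ^ 2)) :=
    Metric.ball_subset_closedBall
  have hbd : ∀ t ∈ lensBall R, ‖f t‖ ≤ M * (‖1 - t‖ ^ s * ‖1 + t‖ ^ s) := by
    intro t ht
    simp only [hf]
    rw [norm_mul, norm_mul (_ ^ _), Complex.norm_cpow_real, Complex.norm_cpow_real]
    have := hM t (hsub ht)
    gcongr
  have hdf : DifferentiableOn ℂ f (lensBall R) := by
    intro t ht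
    refine DifferentiableAt.differentiableWithinAt ?_
    have h1 := one_sub_slitPlane_of_lens ht
    have h2 : DifferentiableAt ℂ g (z - Complex.I * b * t) :=
      hg.differentiableAt (isOpen_rhp.mem_nhds (re_pos_of_mem_closure_lens hz hb (hsub ht)))
    refine DifferentiableAt.mul (DifferentiableAt.mul ?_ (by fun_prop)) (DifferentiableAt.mul ?_ ?_)
    · exact h2.comp t (by fun_prop)
    · exact DifferentiableAt.cpow_const (by fun_prop) h1.1
    · exact DifferentiableAt.cpow_const (by fun_prop) h1.2
  have htent := integral_tent_eq hdf hM0 hR0.le hs1 hbd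
  set h : ℝ → ℂ := fun t => g (z - Complex.I * b * t) *
    (((1 + η * t) * (1 - t ^ 2) ^ s : ℝ) : ℂ) with hh
  have hfh : ∀ t : ℝ, t ∈ Set.Icc (-1:ℝ) 1 → f t = h t := by
    intro t ht
    have a1 : 0 ≤ 1 - t := by linarith [ht.2]
    have a2 : 0 ≤ 1 + t := by linarith [ht.1]
    simp only [hf, hh]
    rw [show (1 - t ^ 2 : ℝ) = (1 - t) * (1 + t) by ring, Real.mul_rpow a1 a2]
    push_cast
    rw [Complex.ofReal_cpow a1, Complex.ofReal_cpow a2]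
    push_cast
    ring
  have hsl1 : ∀ τ : ℝ, slant 1 0 τ = ((1 - τ : ℝ) : ℂ) := fun τ => by simp [slant]
  have hsl2 : ∀ τ : ℝ, slant (-1) 0 τ = ((-1 + τ : ℝ) : ℂ) := fun τ => by simp [slant]; ring
  have i1 := intervalIntegrable_slant hdf.continuousOn hM0 hR0.le hs1 hbd (e := 1) (θ := 0)
    (Or.inl rfl) le_rfl (by norm_num)
  have i2 := intervalIntegrable_slant hdf.continuousOn hM0 hR0.le hs1 hbd (e := -1) (θ := 0)
    (Or.inr rfl) le_rfl (by norm_num)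
  have c1 : ∀ τ ∈ Set.uIcc (0:ℝ) 1, f (slant 1 0 τ) = h (1 - τ) := by
    intro τ hτ
    rw [Set.uIcc_of_le zero_le_one] at hτ
    rw [hsl1]
    exact hfh _ ⟨by linarith [hτ.2], by linarith [hτ.1]⟩
  have c2 : ∀ τ ∈ Set.uIcc (0:ℝ) 1, f (slant (-1) 0 τ) = h (-1 + τ) := by
    intro τ hτ
    rw [Set.uIcc_of_le zero_le_one] at hτ
    rw [hsl2]
    exact hfh _ ⟨by linarith [hτ.1], by linarith [hτ.2]⟩
  have j1 : IntervalIntegrable h volume 0 1 := by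
    have := (i1.congr fun τ hτ => c1 τ (Set.uIoc_subset_uIcc hτ)).comp_sub_left 1
    simpa using this.symm
  have j2 : IntervalIntegrable h volume (-1) 0 := by
    have := (i2.congr fun τ hτ => c2 τ (Set.uIoc_subset_uIcc hτ)).comp_add_left 1
    simpa using this
  have hsplit : (∫ t in (-1:ℝ)..1, h t) =
      (∫ τ in (0:ℝ)..1, f (slant 1 0 τ)) + ∫ τ in (0:ℝ)..1, f (slant (-1) 0 τ) := by
    rw [← intervalIntegral.integral_add_adjacent_intervals j2 j1, add_comm,
      intervalIntegral.integral_congr c1, intervalIntegral.integral_congr c2]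
    congr 1
    · simp
    · simp
  rw [hsplit, htent]
  have hpt : ∀ e : ℝ, (e = 1 ∨ e = -1) → ‖∫ τ in (0:ℝ)..1, f (slant e (1 / 2) τ)‖ ≤
      3 * (3 ^ |s|) ^ 2 * ∫ τ in (0:ℝ)..1, ‖g (z - Complex.I * b * slant e (1 / 2) τ)‖ * τ ^ s := by
    intro e he
    rw [← intervalIntegral.integral_const_mul]
    refine intervalIntegral.norm_integral_le_of_norm_le zero_le_one ?_ ?_
    · refine Filter.Eventually.of_forall fun τ hτ => ?_
      have h1 := norm_weight_slant_le s he (by norm_num : (0:ℝ) ≤ 1 / 2) le_rfl hτ.1 hτ.2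
      have h2 : ‖1 + (η:ℂ) * slant e (1 / 2) τ‖ ≤ 3 := by
        have h3 : ‖slant e (1 / 2) τ‖ ≤ 2 := by
          rw [norm_le_iff_sq (by norm_num), slant_re, slant_im]
          have he2 : e ^ 2 = 1 := by rcases he with rfl | rfl <;> norm_num
          rw [mul_pow, he2]
          nlinarith [hτ.1, hτ.2]
        calc _ ≤ ‖(1:ℂ)‖ + ‖(η:ℂ) * slant e (1 / 2) τ‖ := norm_add_le _ _
          _ ≤ 1 + 1 * 2 := by
            rw [norm_mul, norm_one]
            have : ‖(η:ℂ)‖ = 1 := by rcases hη with rfl | rfl <;> simp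
            rw [this]
            gcongr
          _ = 3 := by norm_num
      simp only [hf]
      rw [norm_mul, norm_mul (_ ^ _), Complex.norm_cpow_real, Complex.norm_cpow_real, norm_mul]
      calc _ ≤ ‖g (z - Complex.I * b * slant e (1 / 2) τ)‖ * 3 * ((3 ^ |s|) ^ 2 * τ ^ s) := by
            gcongr
        _ = _ := by ring
    · refine IntervalIntegrable.const_mul ?_ _
      refine IntervalIntegrable.continuousOn_mul
        (intervalIntegral.intervalIntegrable_rpow' hs1) ?_
      refine (hg.continuousOn.comp ?_ fun τ hτ => ?_).norm
      · exact ((continuous_const.sub (continuous_const.mul (continuous_slant e _)))).continuousOn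
      · rw [Set.uIcc_of_le zero_le_one] at hτ
        show 0 < (z - Complex.I * b * slant e (1 / 2) τ).re
        have : (z - Complex.I * b * slant e (1 / 2) τ).re = z.re + b * (1 / 2 * τ) := by
          simp [slant]
        rw [this]
        have := mul_nonneg hb hτ.1
        nlinarith
  have k1 := hpt 1 (Or.inl rfl)
  have k2 := hpt (-1) (Or.inr rfl)
  have n1 : ‖1 - Complex.I / 2‖ ≤ 2 := by
    rw [norm_le_iff_sq (by norm_num)]; norm_num
  have n2 : ‖1 + Complex.I / 2‖ ≤ 2 := by
    rw [norm_le_iff_sq (by norm_num)]; norm_num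
  calc _ ≤ ‖1 - Complex.I / 2‖ * ‖∫ τ in (0:ℝ)..1, f (slant 1 (1 / 2) τ)‖ +
        ‖1 + Complex.I / 2‖ * ‖∫ τ in (0:ℝ)..1, f (slant (-1) (1 / 2) τ)‖ := by
          refine (norm_add_le _ _).trans ?_
          rw [norm_mul, norm_mul]
    _ ≤ _ := by
      have m1 := mul_le_mul n1 k1 (norm_nonneg _) (by norm_num)
      have m2 := mul_le_mul n2 k2 (norm_nonneg _) (by norm_num)
      linarith

/-- Bound of a weighted one-variable integral of a function holomorphic on the right half-plane
by integrals over paths inside it. -/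
theorem kernel_one_variable {κ : ℝ} (hκ : 0 < κ) {g : ℂ → ℂ} (hg : DifferentiableOn ℂ g rhp)
    {z : ℂ} (hz : 0 < z.re) (b : ℝ) :
    ‖∫ t in (-1:ℝ)..1, g (z - Complex.I * b * t) * (((1 + t) * (1 - t ^ 2) ^ (κ - 1) : ℝ) : ℂ)‖
      ≤ 6 * (3 ^ |κ - 1|) ^ 2 *
      ((∫ τ in (0:ℝ)..1, ‖g (z - Complex.I * b * (1 - τ) + |b| * τ / 2)‖ * τ ^ (κ - 1)) +
        ∫ τ in (0:ℝ)..1, ‖g (z + Complex.I * b * (1 - τ) + |b| * τ / 2)‖ * τ ^ (κ - 1)) := by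
  have e1 : ∀ (b τ : ℝ), z - Complex.I * b * slant 1 (1 / 2) τ =
      z - Complex.I * b * (1 - τ) + b * τ / 2 := by
    intro b τ
    simp only [slant]
    push_cast
    linear_combination (-(b:ℂ) * τ / 2) * Complex.I_mul_I
  have e2 : ∀ (b τ : ℝ), z - Complex.I * b * slant (-1) (1 / 2) τ =
      z + Complex.I * b * (1 - τ) + b * τ / 2 := by
    intro b τ
    simp only [slant]
    push_cast
    linear_combination (-(b:ℂ) * τ / 2) * Complex.I_mul_I
  rcases le_total 0 b with hb | hb
  · have h := kernel_one_variable_aux hκ hg hz hb (Or.inl rfl)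
    simp only [e1, e2, one_mul] at h
    rwa [abs_of_nonneg hb]
  · have h := kernel_one_variable_aux hκ hg hz (neg_nonneg.mpr hb) (Or.inr rfl)
    simp only [e1, e2] at h
    rw [abs_of_nonpos hb]
    have hneg := intervalIntegral.integral_comp_neg (a := -1) (b := 1)
      (f := fun t : ℝ => g (z - Complex.I * b * t) *
        (((1 + t) * (1 - t ^ 2) ^ (κ - 1) : ℝ) : ℂ))
    rw [neg_neg] at hneg
    rw [← hneg, add_comm (intervalIntegral _ _ _ _)]
    push_cast at h ⊢
    simp only [mul_neg, neg_mul, sub_neg_eq_add, even_two, Even.neg_pow, ← sub_eq_add_neg,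
      one_mul] at h ⊢
    exact h

/-- The one-variable factor of the weight on the cube. -/
noncomputable def wone (κ t : ℝ) : ℝ := (1 + t) * (1 - t ^ 2) ^ (κ - 1)

theorem wone_nonneg {κ t : ℝ} (ht : t ∈ Set.Icc (-1 : ℝ) 1) : 0 ≤ wone κ t := by
  have h1 : 0 ≤ 1 + t := by linarith [ht.1]
  have h2 : 0 ≤ 1 - t ^ 2 := by nlinarith [ht.1, ht.2]
  unfold wone
  positivity

theorem intervalIntegrable_one_sub_sq_rpow {s : ℝ} (hs : -1 < s) :
    IntervalIntegrable (fun t : ℝ => (1 - t ^ 2) ^ s) volume (-1) 1 := by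
  have hpos : IntervalIntegrable (fun t : ℝ => (1 - t ^ 2) ^ s) volume 0 1 := by
    have h1 : IntervalIntegrable (fun t : ℝ => (1 - t) ^ s) volume 0 1 := by
      have := (intervalIntegral.intervalIntegrable_rpow' (a := 1) (b := 0) hs).comp_sub_left 1
      simpa using this
    have h2 := h1.continuousOn_mul (g := fun t : ℝ => (1 + t) ^ s) (by
      rw [Set.uIcc_of_le zero_le_one]
      refine ContinuousOn.rpow_const (by fun_prop) fun x hx => Or.inl ?_
      linarith [hx.1])
    refine h2.congr fun t ht => ?_
    rw [Set.uIoc_of_le zero_le_one] at ht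
    show (1 + t) ^ s * (1 - t) ^ s = _
    rw [← Real.mul_rpow (by linarith [ht.1]) (by linarith [ht.2])]
    congr 1; ring
  have hneg := hpos.comp_sub_left 0
  simp only [zero_sub, neg_zero, even_two, Even.neg_pow] at hneg
  exact hneg.symm.trans hpos

theorem integrableOn_wone {κ : ℝ} (hκ : 0 < κ) : IntegrableOn (wone κ) (Set.Icc (-1) 1) := by
  rw [integrableOn_Icc_iff_integrableOn_Ioc,
    ← intervalIntegrable_iff_integrableOn_Ioc_of_le (by norm_num)]
  exact (intervalIntegrable_one_sub_sq_rpow (by linarith)).continuousOn_mul (by fun_prop)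

theorem restrict_cube (m : ℕ) : (volume : Measure (Fin m → ℝ)).restrict (cube m) =
    Measure.pi fun _ => volume.restrict (Set.Icc (-1 : ℝ) 1) := by
  rw [cube, volume_pi, Measure.restrict_pi_pi]

theorem integrableOn_wprod {m : ℕ} {κ : Fin m → ℝ} (hκ : ∀ i, 0 < κ i) :
    IntegrableOn (wprod κ) (cube m) := by
  rw [IntegrableOn, restrict_cube]
  exact Integrable.fintype_prod fun i => integrableOn_wone (hκ i)

theorem measurableSet_cube (m : ℕ) : MeasurableSet (cube m) :=
  MeasurableSet.univ_pi fun _ => measurableSet_Icc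

theorem measurable_wprod {m : ℕ} (κ : Fin m → ℝ) : Measurable (wprod κ) := by
  unfold wprod; fun_prop

/-- A weighted average over the cube of a power of a linear form. -/
noncomputable def cubeJ {m : ℕ} (κ b : Fin m → ℝ) (p : ℝ) (z : ℂ) : ℂ :=
  ∫ t in cube m, (z - Complex.I * ((∑ i, b i * t i : ℝ) : ℂ)) ^ (-(p : ℂ)) * (wprod κ t : ℂ)

theorem sub_I_mul_re (z : ℂ) (u : ℝ) : (z - Complex.I * u).re = z.re := by simp

theorem rhp_subset_slitPlane {z : ℂ} (hz : 0 < z.re) : z ∈ Complex.slitPlane :=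
  Or.inl hz

theorem norm_cpow_neg_le {z : ℂ} {a p : ℝ} (ha : 0 < a) (hz : a ≤ z.re) (hp : 0 ≤ p) :
    ‖z ^ (-(p : ℂ))‖ ≤ a ^ (-p) := by
  rw [← Complex.ofReal_neg, Complex.norm_cpow_real]
  exact Real.rpow_le_rpow_of_nonpos ha (hz.trans (Complex.re_le_norm z)) (by linarith)

theorem measurable_cubeJ_integrand {m : ℕ} (κ b : Fin m → ℝ) (p : ℝ) (z : ℂ) :
    Measurable fun t : Fin m → ℝ =>
      (z - Complex.I * ((∑ i, b i * t i : ℝ) : ℂ)) ^ (-(p : ℂ)) * (wprod κ t : ℂ) := by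
  have := measurable_wprod κ
  fun_prop

theorem integrableOn_cubeJ_integrand {m : ℕ} {κ : Fin m → ℝ} (hκ : ∀ i, 0 < κ i)
    (b : Fin m → ℝ) {p : ℝ} (hp : 0 ≤ p) {z : ℂ} (hz : 0 < z.re) :
    IntegrableOn (fun t : Fin m → ℝ =>
      (z - Complex.I * ((∑ i, b i * t i : ℝ) : ℂ)) ^ (-(p : ℂ)) * (wprod κ t : ℂ)) (cube m) := by
  refine Integrable.mono' ((integrableOn_wprod hκ).norm.const_mul (z.re ^ (-p)))
    (measurable_cubeJ_integrand κ b p z).aestronglyMeasurable (ae_of_all _ fun t => ?_)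
  rw [norm_mul, Complex.norm_real]
  gcongr
  exact norm_cpow_neg_le hz (sub_I_mul_re _ _).ge hp

theorem differentiableOn_cubeJ {m : ℕ} {κ : Fin m → ℝ} (hκ : ∀ i, 0 < κ i) (b : Fin m → ℝ)
    {p : ℝ} (hp : 0 < p) : DifferentiableOn ℂ (cubeJ κ b p) rhp := by
  intro z hz
  refine DifferentiableAt.differentiableWithinAt ?_
  have hz : 0 < z.re := hz
  have hre : ∀ w ∈ Metric.ball z (z.re / 2), z.re / 2 ≤ w.re := fun w hw => by
    have h1 : |(w - z).re| ≤ ‖w - z‖ := Complex.abs_re_le_norm _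
    have h2 : ‖w - z‖ < z.re / 2 := by simpa [dist_eq_norm] using hw
    rw [Complex.sub_re] at h1
    have := (abs_le.mp (h1.trans h2.le)).1
    linarith
  refine (hasDerivAt_integral_of_dominated_loc_of_deriv_le
    (F := fun w (t : Fin m → ℝ) =>
      (w - Complex.I * ((∑ i, b i * t i : ℝ) : ℂ)) ^ (-(p : ℂ)) * (wprod κ t : ℂ))
    (F' := fun w (t : Fin m → ℝ) => (-(p : ℂ) *
      (w - Complex.I * ((∑ i, b i * t i : ℝ) : ℂ)) ^ (-(p : ℂ) - 1)) * (wprod κ t : ℂ))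
    (bound := fun t => (p * (z.re / 2) ^ (-(p + 1))) * ‖wprod κ t‖)
    (Metric.ball_mem_nhds z (half_pos hz)) ?_ ?_ ?_ ?_ ?_ ?_).2.differentiableAt
  · exact Filter.Eventually.of_forall fun w =>
      (measurable_cubeJ_integrand κ b p w).aestronglyMeasurable
  · exact integrableOn_cubeJ_integrand hκ b hp.le hz
  · have := measurable_wprod κ
    refine Measurable.aestronglyMeasurable ?_
    fun_prop
  · refine ae_of_all _ fun t w hw => ?_
    rw [norm_mul, norm_mul, norm_neg, Complex.norm_real, Complex.norm_real,
      Real.norm_of_nonneg hp.le]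
    gcongr
    have e : -(p : ℂ) - 1 = -((p + 1 : ℝ) : ℂ) := by push_cast; ring
    rw [e]
    exact norm_cpow_neg_le (half_pos hz) ((hre w hw).trans (sub_I_mul_re _ _).ge) (by linarith)
  · exact (integrableOn_wprod hκ).norm.const_mul _
  · refine ae_of_all _ fun t w hw => ?_
    have hs : w - Complex.I * ((∑ i, b i * t i : ℝ) : ℂ) ∈ Complex.slitPlane :=
      rhp_subset_slitPlane (by rw [sub_I_mul_re]; linarith [hre w hw])
    have := (((hasDerivAt_id w).sub_const
      (Complex.I * ((∑ i, b i * t i : ℝ) : ℂ))).cpow_const (c := -(p : ℂ)) hs).mul_const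
        (wprod κ t : ℂ)
    refine this.congr_deriv ?_
    simp

theorem cubeJ_succ {m : ℕ} {κ : Fin (m + 1) → ℝ} (hκ : ∀ i, 0 < κ i) (b : Fin (m + 1) → ℝ)
    {p : ℝ} (hp : 0 ≤ p) {z : ℂ} (hz : 0 < z.re) :
    cubeJ κ b p z = ∫ t in (-1:ℝ)..1,
      cubeJ (fun i => κ i.succ) (fun i => b i.succ) p (z - Complex.I * b 0 * t) *
        (((1 + t) * (1 - t ^ 2) ^ (κ 0 - 1) : ℝ) : ℂ) := by
  have hInt := integrableOn_cubeJ_integrand hκ b hp hz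
  have hmp := measurePreserving_piFinSuccAbove
    (fun _ : Fin (m + 1) => volume.restrict (Set.Icc (-1 : ℝ) 1)) 0
  rw [cubeJ]
  rw [IntegrableOn, restrict_cube] at hInt
  rw [restrict_cube, ← hmp.symm.integral_comp', integral_prod]
  · rw [intervalIntegral.integral_of_le (by norm_num), ← integral_Icc_eq_integral_Ioc]
    refine integral_congr_ae (ae_of_all _ fun t => ?_)
    simp only
    rw [cubeJ, restrict_cube, ← integral_mul_const]
    refine integral_congr_ae (ae_of_all _ fun s => ?_)
    simp only [MeasurableEquiv.piFinSuccAbove_symm_apply, Fin.insertNthEquiv_zero,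
      Fin.consEquiv_apply, Fin.sum_univ_succ, wprod, Fin.prod_univ_succ, Fin.cons_zero,
      Fin.cons_succ]
    push_cast
    rw [show z - Complex.I * (b 0 * t + ∑ i : Fin m, (b i.succ : ℂ) * s i : ℂ) =
      z - Complex.I * b 0 * t - Complex.I * ∑ i : Fin m, (b i.succ : ℂ) * s i by ring]
    ring
  · exact (hmp.symm.integrable_comp_emb (MeasurableEquiv.measurableEmbedding _)).mpr hInt

theorem intervalIntegrable_add_mul_rpow {κ D b : ℝ} (hκ : 0 < κ) (hD : 0 < D) (hb : 0 ≤ b)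
    (q : ℝ) : IntervalIntegrable (fun τ : ℝ => (D + b * τ) ^ (-q) * τ ^ (κ - 1)) volume 0 1 := by
  refine IntervalIntegrable.continuousOn_mul
    (intervalIntegral.intervalIntegrable_rpow' (by linarith)) ?_
  rw [Set.uIcc_of_le zero_le_one]
  refine ContinuousOn.rpow_const (by fun_prop) fun x hx => Or.inl ?_
  have := mul_nonneg hb hx.1
  positivity

theorem integral_add_mul_rpow_eq {κ D b : ℝ} (hκ : 0 < κ) (hD : 0 < D) (hb : 0 ≤ b) :
    ∫ τ in (0:ℝ)..1, (D + b * τ) ^ (-(κ + 1)) * τ ^ (κ - 1) = κ⁻¹ * D⁻¹ * (D + b) ^ (-κ) := by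
  have hpos : ∀ τ : ℝ, 0 ≤ τ → 0 < D + b * τ := fun τ hτ => by positivity
  have h := intervalIntegral.integral_eq_sub_of_hasDerivAt_of_le (a := 0) (b := 1)
    (f := fun τ : ℝ => (κ⁻¹ * D⁻¹) * (τ ^ κ * (D + b * τ) ^ (-κ)))
    (f' := fun τ : ℝ => (D + b * τ) ^ (-(κ + 1)) * τ ^ (κ - 1)) zero_le_one ?_ ?_
    (intervalIntegrable_add_mul_rpow hκ hD hb _)
  · rw [h]
    simp [Real.zero_rpow hκ.ne']
  · refine continuousOn_const.mul (ContinuousOn.mul ?_ ?_)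
    · exact ContinuousOn.rpow_const continuousOn_id fun x _ => Or.inr hκ.le
    · exact ContinuousOn.rpow_const (by fun_prop) fun x hx => Or.inl (hpos x hx.1).ne'
  · intro τ hτ
    have h1 := Real.hasDerivAt_rpow_const (x := τ) (p := κ) (Or.inl hτ.1.ne')
    have h2 := (((hasDerivAt_id τ).const_mul b).const_add D).rpow_const (p := -κ)
      (Or.inl (hpos τ hτ.1.le).ne')
    refine ((h1.mul h2).const_mul (κ⁻¹ * D⁻¹)).congr_deriv ?_
    have e1 : τ ^ κ = τ ^ (κ - 1) * τ := by
      rw [← Real.rpow_add_one hτ.1.ne']; congr 1; ring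
    have e2 : (D + b * τ) ^ (-κ) = (D + b * τ) ^ (-(κ + 1)) * (D + b * τ) := by
      rw [← Real.rpow_add_one (hpos τ hτ.1.le).ne']; congr 1; ring
    simp only [id, mul_one]
    rw [e1, e2, show -κ - 1 = -(κ + 1) by ring]
    field_simp
    ring

theorem integral_add_mul_rpow_le {κ D b q : ℝ} (hκ : 0 < κ) (hD : 0 < D) (hb : 0 ≤ b)
    (hq : κ + 1 ≤ q) :
    ∫ τ in (0:ℝ)..1, (D + b * τ) ^ (-q) * τ ^ (κ - 1) ≤
      κ⁻¹ * (D ^ (-(q - κ)) * (D + b) ^ (-κ)) := by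
  have e : D ^ (-(q - κ)) = D ^ (-(q - κ - 1)) * D⁻¹ := by
    rw [← Real.rpow_neg_one, ← Real.rpow_add hD]; congr 1; ring
  calc _ ≤ ∫ τ in (0:ℝ)..1, D ^ (-(q - κ - 1)) * ((D + b * τ) ^ (-(κ + 1)) * τ ^ (κ - 1)) := by
        refine intervalIntegral.integral_mono_on zero_le_one
          (intervalIntegrable_add_mul_rpow hκ hD hb _)
          ((intervalIntegrable_add_mul_rpow hκ hD hb _).const_mul _) fun τ hτ => ?_
        have hbt := mul_nonneg hb hτ.1
        have h1 : 0 < D + b * τ := by linarith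
        rw [← mul_assoc, show -q = -(q - κ - 1) + -(κ + 1) by ring, Real.rpow_add h1]
        refine mul_le_mul_of_nonneg_right (mul_le_mul_of_nonneg_right ?_ (by positivity))
          (Real.rpow_nonneg hτ.1 _)
        exact Real.rpow_le_rpow_of_nonpos hD (by linarith) (by linarith)
    _ = _ := by
      rw [intervalIntegral.integral_const_mul, integral_add_mul_rpow_eq hκ hD hb, e]
      ring

theorem add_abs_div_le_norm {v : ℂ} (hv : 0 ≤ v.re) (b τ : ℝ) (hτ : 0 ≤ τ) (s : ℝ)
    (hs : s ^ 2 = 1) :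
    (‖v‖ + |b| * τ) / 6 ≤ ‖v + Complex.I * (s * b) * τ + |b| * τ / 2‖ := by
  set w := v + Complex.I * (s * b) * τ + |b| * τ / 2 with hw
  have hre : w.re = v.re + |b| * τ / 2 := by simp [hw]
  have him : w.im = v.im + s * b * τ := by simp [hw]
  have h1 := Complex.re_le_norm w
  have h2 := Complex.abs_im_le_norm w
  have h3 := Complex.norm_le_abs_re_add_abs_im v
  rw [abs_of_nonneg hv] at h3
  have h4 : |s * b * τ| = |b| * τ := by
    have : |s| = 1 := by rwa [← sq_eq_sq₀ (abs_nonneg s) zero_le_one, sq_abs, one_pow]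
    rw [abs_mul, abs_mul, this, one_mul, abs_of_nonneg hτ]
  have h5 : |v.im| ≤ |w.im| + |s * b * τ| := by
    have : v.im = w.im - s * b * τ := by rw [him]; ring
    rw [this]
    exact abs_sub _ _
  have h6 : 0 ≤ |b| * τ := by positivity
  linarith

/-- The sign attached to a boolean. -/
noncomputable def sg (e : Bool) : ℝ := cond e 1 (-1)

theorem sg_sq (e : Bool) : sg e ^ 2 = 1 := by cases e <;> simp [sg]

theorem abs_sg (e : Bool) : |sg e| = 1 := by cases e <;> simp [sg]

/-- The linear form with coefficients `b` evaluated at a sign vector. -/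
noncomputable def sgForm {m : ℕ} (e : Fin m → Bool) (b : Fin m → ℝ) : ℝ := ∑ i, sg (e i) * b i

theorem sgForm_cons {m : ℕ} (s : Bool) (e : Fin m → Bool) (b : Fin (m + 1) → ℝ) :
    sgForm (Fin.cons s e : Fin (m + 1) → Bool) b = sg s * b 0 + sgForm e fun i => b i.succ := by
  simp [sgForm, Fin.sum_univ_succ]

/-- A vertex term of the kernel bound, at distance `D` from the vertex. -/
noncomputable def vertexTerm {m : ℕ} (κ b : Fin m → ℝ) (p D : ℝ) : ℝ :=
  D ^ (-(p - ∑ i, κ i)) * ∏ i, (D + |b i|) ^ (-κ i)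

theorem sum_cons_bool {m : ℕ} (f : (Fin (m + 1) → Bool) → ℝ) :
    ∑ e, f e = (∑ e : Fin m → Bool, f (Fin.cons true e)) +
      ∑ e : Fin m → Bool, f (Fin.cons false e) := by
  rw [← (Fin.consEquiv fun _ : Fin (m + 1) => Bool).sum_comp, Fintype.sum_prod_type]
  simp [Fin.consEquiv]

theorem integral_norm_cubeJ_le {m : ℕ} {κ : Fin (m + 1) → ℝ} (hκ : ∀ i, 0 < κ i) {p C : ℝ}
    (hp : (∑ i, κ i) + 1 ≤ p) (hC : 0 < C)
    (ih : ∀ (b : Fin m → ℝ) (z : ℂ), 0 < z.re → ‖cubeJ (fun i => κ i.succ) b p z‖ ≤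
      C * ∑ e : Fin m → Bool,
        vertexTerm (fun i => κ i.succ) b p ‖z - Complex.I * (sgForm e b : ℂ)‖)
    (b : Fin (m + 1) → ℝ) {z : ℂ} (hz : 0 < z.re) (s : Bool) :
    ∫ τ in (0:ℝ)..1, ‖cubeJ (fun i => κ i.succ) (fun i => b i.succ) p
        (z - Complex.I * (sg s * b 0) * (1 - τ) + |b 0| * τ / 2)‖ * τ ^ (κ 0 - 1) ≤
      C * 6 ^ p * (κ 0)⁻¹ * ∑ e : Fin m → Bool,
        vertexTerm κ b p ‖z - Complex.I * (sgForm (Fin.cons s e : Fin (m + 1) → Bool) b : ℂ)‖ := by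
  set κ' : Fin m → ℝ := fun i => κ i.succ with hκ'
  set b' : Fin m → ℝ := fun i => b i.succ with hb'
  have hsum : ∑ i, κ i = κ 0 + ∑ i, κ' i := Fin.sum_univ_succ _
  have hκ'pos : 0 ≤ ∑ i, κ' i := Finset.sum_nonneg fun i _ => (hκ _).le
  have hk0 := hκ 0
  set v : (Fin m → Bool) → ℂ := fun e =>
    z - Complex.I * (sgForm (Fin.cons s e : Fin (m + 1) → Bool) b : ℂ) with hv
  have hvre : ∀ e, (v e).re = z.re := fun e => by simp [hv]
  have hv0 : ∀ e, 0 < ‖v e‖ := fun e =>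
    (hz.trans_eq (hvre e).symm).trans_le (Complex.re_le_norm _)
  have hwre : ∀ τ : ℝ, 0 ≤ τ →
      0 < (z - Complex.I * (sg s * b 0) * (1 - τ) + |b 0| * τ / 2).re := fun τ hτ => by
    have e : (z - Complex.I * (sg s * b 0) * (1 - τ) + |b 0| * τ / 2).re =
        z.re + |b 0| * τ / 2 := by simp
    rw [e]; positivity
  have hInt : ∀ e, IntervalIntegrable (fun τ : ℝ => (‖v e‖ + |b 0| * τ) ^ (-(p - ∑ i, κ' i)) *
      τ ^ (κ 0 - 1)) volume 0 1 := fun e =>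
    intervalIntegrable_add_mul_rpow hk0 (hv0 e) (abs_nonneg _) _
  have hpt : ∀ τ ∈ Set.Icc (0:ℝ) 1, ‖cubeJ κ' b' p
      (z - Complex.I * (sg s * b 0) * (1 - τ) + |b 0| * τ / 2)‖ * τ ^ (κ 0 - 1) ≤
      C * 6 ^ p * ∑ e : Fin m → Bool, (∏ i, (‖v e‖ + |b' i|) ^ (-κ' i)) *
        ((‖v e‖ + |b 0| * τ) ^ (-(p - ∑ i, κ' i)) * τ ^ (κ 0 - 1)) := by
    intro τ hτ
    have hτ0 : 0 ≤ τ ^ (κ 0 - 1) := Real.rpow_nonneg hτ.1 _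
    refine (mul_le_mul_of_nonneg_right (ih b' _ (hwre τ hτ.1)) hτ0).trans ?_
    rw [mul_assoc C, mul_assoc C (6 ^ p), Finset.sum_mul, Finset.mul_sum _ _ ((6:ℝ) ^ p)]
    refine mul_le_mul_of_nonneg_left (Finset.sum_le_sum fun e _ => ?_) hC.le
    rw [← mul_assoc ((6:ℝ) ^ p), ← mul_assoc ((6:ℝ) ^ p * _)]
    refine mul_le_mul_of_nonneg_right ?_ hτ0
    have e1 : z - Complex.I * (sg s * b 0) * (1 - τ) + |b 0| * τ / 2 -
        Complex.I * (sgForm e b' : ℂ) =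
        v e + Complex.I * ((sg s : ℝ) * (b 0 : ℝ)) * τ + |b 0| * τ / 2 := by
      simp only [hv, sgForm_cons, hb']
      push_cast
      ring
    rw [e1]
    have hlow := add_abs_div_le_norm (v := v e) (by rw [hvre]; exact hz.le) (b 0) τ hτ.1
      (sg s) (sg_sq s)
    set E := ‖v e + Complex.I * ((sg s : ℝ) * (b 0 : ℝ)) * τ + |b 0| * τ / 2‖
    have hbt : 0 ≤ |b 0| * τ := mul_nonneg (abs_nonneg _) hτ.1
    have hve := hv0 e
    have h1 : E ^ (-(p - ∑ i, κ' i)) ≤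
        6 ^ (p - ∑ i, κ' i) * (‖v e‖ + |b 0| * τ) ^ (-(p - ∑ i, κ' i)) := by
      calc _ ≤ ((‖v e‖ + |b 0| * τ) / 6) ^ (-(p - ∑ i, κ' i)) :=
            Real.rpow_le_rpow_of_nonpos (by positivity) hlow (by linarith)
        _ = _ := by
          rw [Real.div_rpow (by positivity) (by norm_num), Real.rpow_neg (by norm_num : (0:ℝ) ≤ 6)]
          field_simp
    have h2 : ∏ i, (E + |b' i|) ^ (-κ' i) ≤
        6 ^ (∑ i, κ' i) * ∏ i, (‖v e‖ + |b' i|) ^ (-κ' i) := by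
      rw [Real.rpow_sum_of_pos (by norm_num), ← Finset.prod_mul_distrib]
      refine Finset.prod_le_prod (fun i _ => by positivity) fun i _ => ?_
      have hki : 0 < κ' i := hκ _
      calc _ ≤ ((‖v e‖ + |b' i|) / 6) ^ (-κ' i) :=
            Real.rpow_le_rpow_of_nonpos (by positivity) (by
              have := abs_nonneg (b' i)
              linarith) (by linarith)
        _ = _ := by
          rw [Real.div_rpow (by positivity) (by norm_num), Real.rpow_neg (by norm_num : (0:ℝ) ≤ 6)]
          field_simp
    calc vertexTerm κ' b' p E ≤ (6 ^ (p - ∑ i, κ' i) *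
          (‖v e‖ + |b 0| * τ) ^ (-(p - ∑ i, κ' i))) *
          (6 ^ (∑ i, κ' i) * ∏ i, (‖v e‖ + |b' i|) ^ (-κ' i)) :=
          mul_le_mul h1 h2 (Finset.prod_nonneg fun i _ => by positivity) (by positivity)
      _ = _ := by
        have : (6:ℝ) ^ p = 6 ^ (p - ∑ i, κ' i) * 6 ^ (∑ i, κ' i) := by
          rw [← Real.rpow_add (by norm_num)]; congr 1; ring
        rw [this]; ring
  have hdom : IntervalIntegrable (fun τ : ℝ => C * 6 ^ p * ∑ e : Fin m → Bool,
      (∏ i, (‖v e‖ + |b' i|) ^ (-κ' i)) *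
        ((‖v e‖ + |b 0| * τ) ^ (-(p - ∑ i, κ' i)) * τ ^ (κ 0 - 1))) volume 0 1 := by
    refine IntervalIntegrable.const_mul ?_ _
    have := IntervalIntegrable.sum (μ := volume) (a := 0) (b := 1) Finset.univ
      (f := fun e τ => (∏ i, (‖v e‖ + |b' i|) ^ (-κ' i)) *
        ((‖v e‖ + |b 0| * τ) ^ (-(p - ∑ i, κ' i)) * τ ^ (κ 0 - 1)))
      fun e _ => (hInt e).const_mul _
    simpa [Finset.sum_fn] using this
  have hLint : IntervalIntegrable (fun τ : ℝ => ‖cubeJ κ' b' p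
      (z - Complex.I * (sg s * b 0) * (1 - τ) + |b 0| * τ / 2)‖ * τ ^ (κ 0 - 1)) volume 0 1 := by
    refine IntervalIntegrable.continuousOn_mul
      (intervalIntegral.intervalIntegrable_rpow' (by linarith)) ?_
    refine ((differentiableOn_cubeJ (fun i => hκ _) b' (by linarith)).continuousOn.comp
      (Continuous.continuousOn (by fun_prop)) fun τ hτ => ?_).norm
    rw [Set.uIcc_of_le zero_le_one] at hτ
    exact hwre τ hτ.1
  refine (intervalIntegral.integral_mono_on zero_le_one hLint hdom hpt).trans ?_
  rw [intervalIntegral.integral_const_mul, intervalIntegral.integral_finsetSum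
    fun e _ => (hInt e).const_mul _, mul_assoc (C * 6 ^ p), Finset.mul_sum _ _ (κ 0)⁻¹]
  refine mul_le_mul_of_nonneg_left (Finset.sum_le_sum fun e _ => ?_) (by positivity)
  rw [intervalIntegral.integral_const_mul]
  have := integral_add_mul_rpow_le (q := p - ∑ i, κ' i) hk0 (hv0 e) (abs_nonneg (b 0))
    (by linarith)
  have hve := hv0 e
  refine (mul_le_mul_of_nonneg_left this
    (Finset.prod_nonneg fun i _ => by positivity)).trans_eq ?_
  rw [vertexTerm, Fin.prod_univ_succ, hsum,
    show p - (κ 0 + ∑ i, κ' i) = p - ∑ i, κ' i - κ 0 by ring]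
  ring

/-- Bound of `cubeJ` by its behaviour at the vertices of the cube. -/
theorem exists_norm_cubeJ_le : ∀ {m : ℕ} {κ : Fin m → ℝ} (_ : ∀ i, 0 < κ i) {p : ℝ}
    (_ : (∑ i, κ i) + 1 ≤ p), ∃ C : ℝ, 0 < C ∧ ∀ (b : Fin m → ℝ) (z : ℂ), 0 < z.re →
      ‖cubeJ κ b p z‖ ≤ C * ∑ e : Fin m → Bool,
        vertexTerm κ b p ‖z - Complex.I * (sgForm e b : ℂ)‖ := by
  intro m
  induction m with
  | zero =>
    intro κ _ p _
    refine ⟨1, one_pos, fun b z hz => ?_⟩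
    have hz0 : z ≠ 0 := by rintro rfl; simp at hz
    have : cubeJ κ b p z = z ^ (-(p : ℂ)) := by
      simp [cubeJ, restrict_cube, wprod, Measure.real]
    rw [this, ← Complex.ofReal_neg, Complex.norm_cpow_real]
    simp [vertexTerm, sgForm]
  | succ m ih =>
    intro κ hκ p hp
    have hk0 := hκ 0
    have hsum : ∑ i, κ i = κ 0 + ∑ i : Fin m, κ i.succ := Fin.sum_univ_succ _
    obtain ⟨C, hC, ih⟩ := ih (κ := fun i => κ i.succ) (fun i => hκ _) (p := p) (by linarith)
    have hp0 : 0 < p := by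
      have : 0 ≤ ∑ i, κ i := Finset.sum_nonneg fun i _ => (hκ i).le
      linarith
    refine ⟨6 * (3 ^ |κ 0 - 1|) ^ 2 * (C * 6 ^ p * (κ 0)⁻¹), by positivity, fun b z hz => ?_⟩
    rw [cubeJ_succ hκ b hp0.le hz]
    refine (kernel_one_variable hk0
      (differentiableOn_cubeJ (fun i => hκ _) _ hp0) hz (b 0)).trans ?_
    rw [mul_assoc (6 * (3 ^ |κ 0 - 1|) ^ 2)]
    refine mul_le_mul_of_nonneg_left ?_ (by positivity)
    have h1 := integral_norm_cubeJ_le hκ hp hC ih b hz true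
    have h2 := integral_norm_cubeJ_le hκ hp hC ih b hz false
    rw [sum_cons_bool, mul_add]
    refine add_le_add ?_ ?_
    · simpa [sg] using h1
    · simpa [sg] using h2

theorem mul_cpow_of_re_pos {a b : ℂ} (ha : 0 < a.re) (hb : 0 < b.re) (c : ℂ) :
    (a * b) ^ c = a ^ c * b ^ c := by
  have ha0 : a ≠ 0 := by rintro rfl; simp at ha
  have hb0 : b ≠ 0 := by rintro rfl; simp at hb
  have h1 := Complex.abs_arg_lt_pi_div_two_iff.mpr (Or.inl ha)
  have h2 := Complex.abs_arg_lt_pi_div_two_iff.mpr (Or.inl hb)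
  rw [abs_lt] at h1 h2
  rw [Complex.cpow_def_of_ne_zero (mul_ne_zero ha0 hb0), Complex.cpow_def_of_ne_zero ha0,
    Complex.cpow_def_of_ne_zero hb0, Complex.log_mul ha0 hb0 ⟨by linarith, by linarith⟩, add_mul,
    Complex.exp_add]

/-- The weighted average over the cube of a power of the quadratic form `qf`. -/
noncomputable def cubeG {m : ℕ} (κ b : Fin m → ℝ) (p : ℝ) (r : ℂ) : ℂ :=
  ∫ t in cube m, qf (∑ i, b i * t i) r ^ (-(p : ℂ)) * (wprod κ t : ℂ)

theorem abs_sum_mul_le_of_mem_cube {m : ℕ} {b t : Fin m → ℝ} (ht : t ∈ cube m) :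
    |∑ i, b i * t i| ≤ ∑ i, |b i| := by
  refine (Finset.abs_sum_le_sum_abs _ _).trans (Finset.sum_le_sum fun i _ => ?_)
  rw [abs_mul]
  have : |t i| ≤ 1 := abs_le.mpr (ht i (Set.mem_univ i))
  exact mul_le_of_le_one_right (abs_nonneg _) this

theorem abs_sgForm_le {m : ℕ} (e : Fin m → Bool) (b : Fin m → ℝ) :
    |sgForm e b| ≤ ∑ i, |b i| := by
  refine (Finset.abs_sum_le_sum_abs _ _).trans_eq (Finset.sum_congr rfl fun i _ => ?_)
  rw [abs_mul, abs_sg, one_mul]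

theorem qf_conj (u : ℝ) (r : ℂ) : qf u (starRingEnd ℂ r) = starRingEnd ℂ (qf u r) := by
  simp only [qf, map_add, map_sub, map_mul, map_pow, map_one, map_ofNat, Complex.conj_ofReal]

theorem cubeG_conj {m : ℕ} (κ : Fin m → ℝ) {b : Fin m → ℝ} (hb : ∑ i, |b i| ≤ 1) (p : ℝ) {r : ℂ}
    (hr : ‖r‖ < 1) : cubeG κ b p (starRingEnd ℂ r) = starRingEnd ℂ (cubeG κ b p r) := by
  rw [cubeG, cubeG, ← integral_conj]
  refine setIntegral_congr_fun (measurableSet_cube m) fun t ht => ?_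
  have h := Complex.mem_slitPlane_iff_arg.mp
    (qf_mem_slitPlane ((abs_sum_mul_le_of_mem_cube ht).trans hb) hr)
  simp only [map_mul, Complex.conj_ofReal, qf_conj]
  rw [Complex.conj_cpow _ _ h.1]
  simp

theorem qf_eq_mul {r : ℂ} (hr : r ≠ 0) (u : ℝ) :
    qf u r = (-2 * Complex.I * r) * (Complex.I * ((r + r⁻¹) / 2) - Complex.I * u) := by
  rw [qf]
  field_simp
  linear_combination (1 + r ^ 2 - 2 * r * u) * Complex.I_sq

theorem cubeG_eq_cubeJ {m : ℕ} (κ b : Fin m → ℝ) (p : ℝ) {r : ℂ} (hr : ‖r‖ < 1) (him : 0 < r.im) :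
    0 < (Complex.I * ((r + r⁻¹) / 2)).re ∧
    cubeG κ b p r = (-2 * Complex.I * r) ^ (-(p : ℂ)) *
      cubeJ κ b p (Complex.I * ((r + r⁻¹) / 2)) := by
  have hr0 : r ≠ 0 := by rintro rfl; simp at him
  have h1 : 0 < (-2 * Complex.I * r).re := by simp; exact him
  have h2 : 0 < (Complex.I * ((r + r⁻¹) / 2)).re := by
    have hn : 0 < Complex.normSq r := Complex.normSq_pos.mpr hr0
    have hn1 : Complex.normSq r < 1 := by
      rw [Complex.normSq_eq_norm_sq]
      nlinarith [norm_nonneg r]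
    have : (Complex.I * ((r + r⁻¹) / 2)).re = (r.im / Complex.normSq r - r.im) / 2 := by
      simp [Complex.inv_im]
      ring
    rw [this]
    have : r.im < r.im / Complex.normSq r := by
      rw [lt_div_iff₀ hn]; nlinarith
    linarith
  refine ⟨h2, ?_⟩
  rw [cubeG, cubeJ, ← integral_const_mul]
  congr 1
  ext t
  rw [qf_eq_mul hr0, mul_cpow_of_re_pos h1 (by rw [sub_I_mul_re]; exact h2), mul_assoc]

theorem vertexTerm_div_le {m : ℕ} {κ : Fin m → ℝ} (hκ : ∀ i, 0 < κ i) (b : Fin m → ℝ) (p : ℝ)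
    {D a : ℝ} (hD : 0 < D) (ha : 1 ≤ a) :
    vertexTerm κ b p (D / a) ≤ a ^ p * vertexTerm κ b p D := by
  have ha0 : 0 < a := by linarith
  have h1 : (D / a) ^ (-(p - ∑ i, κ i)) = a ^ (p - ∑ i, κ i) * D ^ (-(p - ∑ i, κ i)) := by
    rw [Real.div_rpow hD.le ha0.le, Real.rpow_neg ha0.le]
    field_simp
  have h2 : ∏ i, (D / a + |b i|) ^ (-κ i) ≤ a ^ (∑ i, κ i) * ∏ i, (D + |b i|) ^ (-κ i) := by
    rw [Real.rpow_sum_of_pos ha0, ← Finset.prod_mul_distrib]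
    refine Finset.prod_le_prod (fun i _ => by positivity) fun i _ => ?_
    have hb := abs_nonneg (b i)
    calc _ ≤ ((D + |b i|) / a) ^ (-κ i) :=
          Real.rpow_le_rpow_of_nonpos (by positivity) (by
            rw [add_div]
            have : |b i| / a ≤ |b i| := div_le_self hb ha
            linarith) (by linarith [hκ i])
      _ = _ := by
        rw [Real.div_rpow (by positivity) ha0.le, Real.rpow_neg ha0.le]
        field_simp
  have h3 : a ^ p = a ^ (p - ∑ i, κ i) * a ^ (∑ i, κ i) := by
    rw [← Real.rpow_add ha0]; congr 1; ring
  rw [vertexTerm, h1, h3, vertexTerm]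
  calc _ ≤ a ^ (p - ∑ i, κ i) * D ^ (-(p - ∑ i, κ i)) *
        (a ^ (∑ i, κ i) * ∏ i, (D + |b i|) ^ (-κ i)) := by gcongr
    _ = _ := by ring

theorem exists_norm_cubeG_le {m : ℕ} {κ : Fin m → ℝ} (hκ : ∀ i, 0 < κ i) {p : ℝ}
    (hp : (∑ i, κ i) + 1 ≤ p) : ∃ C : ℝ, 0 < C ∧ ∀ b : Fin m → ℝ, ∑ i, |b i| ≤ 1 → ∀ r : ℂ,
      1 / 2 ≤ ‖r‖ → ‖r‖ < 1 → r.im ≠ 0 →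
      ‖cubeG κ b p r‖ ≤ C * ∑ e : Fin m → Bool, vertexTerm κ b p ‖qf (sgForm e b) r‖ := by
  obtain ⟨C, hC, h⟩ := exists_norm_cubeJ_le hκ hp
  have key : ∀ b : Fin m → ℝ, ∑ i, |b i| ≤ 1 → ∀ r : ℂ, 1 / 2 ≤ ‖r‖ → ‖r‖ < 1 → 0 < r.im →
      ‖cubeG κ b p r‖ ≤ C * ∑ e : Fin m → Bool, vertexTerm κ b p ‖qf (sgForm e b) r‖ := by
    intro b hb r hr1 hr2 him
    have hr0 : r ≠ 0 := by rintro rfl; simp at him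
    obtain ⟨hz, he⟩ := cubeG_eq_cubeJ κ b p hr2 him
    set a := ‖-2 * Complex.I * r‖ with ha
    have ha1 : 1 ≤ a := by
      have : a = 2 * ‖r‖ := by simp [ha]
      linarith
    have ha0 : 0 < a := by linarith
    rw [he, norm_mul, ← Complex.ofReal_neg, Complex.norm_cpow_real]
    calc _ ≤ a ^ (-p) * (C * ∑ e : Fin m → Bool, a ^ p *
          vertexTerm κ b p ‖qf (sgForm e b) r‖) := by
          refine mul_le_mul_of_nonneg_left ((h b _ hz).trans
            (mul_le_mul_of_nonneg_left (Finset.sum_le_sum fun e _ => ?_) hC.le)) (by positivity)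
          have hq : qf (sgForm e b) r ≠ 0 := Complex.slitPlane_ne_zero
            (qf_mem_slitPlane ((abs_sgForm_le e b).trans hb) hr2)
          have hd : ‖Complex.I * ((r + r⁻¹) / 2) - Complex.I * (sgForm e b : ℂ)‖ =
              ‖qf (sgForm e b) r‖ / a := by
            rw [qf_eq_mul hr0, norm_mul, ← ha]
            field_simp
          rw [hd]
          exact vertexTerm_div_le hκ b p (norm_pos_iff.mpr hq) ha1
      _ = _ := by
        rw [← Finset.mul_sum, Real.rpow_neg ha0.le]
        field_simp
  refine ⟨C, hC, fun b hb r hr1 hr2 him => ?_⟩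
  rcases lt_or_gt_of_ne him with him | him
  · have := key b hb (starRingEnd ℂ r) (by simpa using hr1) (by simpa using hr2) (by simpa using him)
    rw [cubeG_conj κ hb p hr2] at this
    simpa only [qf_conj, RCLike.norm_conj] using this
  · exact key b hb r hr1 hr2 him

theorem qf_cos (θ : ℝ) (r : ℂ) : qf (Real.cos θ) r =
    (1 - r * Complex.exp (θ * Complex.I)) * (1 - r * Complex.exp (-θ * Complex.I)) := by
  have h : Complex.exp (θ * Complex.I) * Complex.exp (-θ * Complex.I) = 1 := by
    rw [← Complex.exp_add]; simp
  rw [qf, Complex.ofReal_cos, Complex.cos]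
  linear_combination (-r ^ 2) * h

theorem sq_one_sub_norm_le_norm_qf {u : ℝ} (hu : |u| ≤ 1) {r : ℂ} (hr : ‖r‖ < 1) :
    (1 - ‖r‖) ^ 2 ≤ ‖qf u r‖ := by
  have hu' := abs_le.mp hu
  rw [← Real.cos_arccos hu'.1 hu'.2, qf_cos, norm_mul, pow_two]
  have key : ∀ θ : ℝ, 1 - ‖r‖ ≤ ‖1 - r * Complex.exp (θ * Complex.I)‖ := fun θ => by
    have := norm_sub_norm_le 1 (r * Complex.exp (θ * Complex.I))
    rwa [norm_mul, Complex.norm_exp_ofReal_mul_I, mul_one, norm_one] at this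
  have h2 := key (-Real.arccos u)
  rw [Complex.ofReal_neg] at h2
  exact mul_le_mul (key _) h2 (by linarith) (norm_nonneg _)

theorem norm_qf_cpow_le {u p : ℝ} (hp : 0 ≤ p) (hu : |u| ≤ 1) {r : ℂ} (hr : ‖r‖ < 1) :
    ‖qf u r ^ (-(p : ℂ))‖ ≤ ((1 - ‖r‖) ^ 2) ^ (-p) := by
  rw [← Complex.ofReal_neg, Complex.norm_cpow_real]
  have : 0 < 1 - ‖r‖ := by linarith
  exact Real.rpow_le_rpow_of_nonpos (by positivity) (sq_one_sub_norm_le_norm_qf hu hr)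
    (by linarith)

theorem norm_circleMap_zero' {ρ : ℝ} (h : 0 < ρ) (φ : ℝ) : ‖circleMap 0 ρ φ‖ = ρ := by
  rw [norm_circleMap_zero, abs_of_pos h]

theorem measurable_qf_cpow {m : ℕ} (b : Fin m → ℝ) (p ρ : ℝ) :
    Measurable fun q : (Fin m → ℝ) × ℝ =>
      qf (∑ i, b i * q.1 i) (circleMap 0 ρ q.2) ^ (-(p : ℂ)) := by
  have : Measurable fun q : (Fin m → ℝ) × ℝ => circleMap 0 ρ q.2 :=
    (continuous_circleMap 0 ρ).measurable.comp measurable_snd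
  unfold qf
  fun_prop

theorem integral_cube_integral_circle {m : ℕ} {κ : Fin m → ℝ} (hκ : ∀ i, 0 < κ i)
    {b : Fin m → ℝ} (hb : ∑ i, |b i| ≤ 1) {p ρ : ℝ} (hp : 0 ≤ p) (h0 : 0 < ρ) (h1 : ρ < 1)
    {H : ℝ → ℂ} (hH : Continuous H) :
    ∫ t in cube m, (∫ φ in (-π)..π, H φ * qf (∑ i, b i * t i) (circleMap 0 ρ φ) ^ (-(p : ℂ))) *
      (wprod κ t : ℂ) =
    ∫ φ in (-π)..π, H φ * cubeG κ b p (circleMap 0 ρ φ) := by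
  have hpi : -π ≤ π := by linarith [Real.pi_pos]
  have hw := measurable_wprod κ
  have hq := measurable_qf_cpow b p ρ
  have hHi : Integrable H (volume.restrict (Set.Ioc (-π) π)) :=
    (hH.integrableOn_Icc).mono_set Set.Ioc_subset_Icc_self
  have hdom := (((integrableOn_wprod hκ).norm.const_mul (((1 - ρ) ^ 2) ^ (-p)))).mul_prod hHi.norm
  have hF : Integrable (fun q : (Fin m → ℝ) × ℝ => H q.2 *
      qf (∑ i, b i * q.1 i) (circleMap 0 ρ q.2) ^ (-(p : ℂ)) * (wprod κ q.1 : ℂ))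
      ((volume.restrict (cube m)).prod (volume.restrict (Set.Ioc (-π) π))) := by
    refine hdom.mono' ?_ ?_
    · have hH' := hH.measurable
      refine Measurable.aestronglyMeasurable ?_
      fun_prop
    · rw [Measure.prod_restrict]
      refine (ae_restrict_iff' ((measurableSet_cube m).prod measurableSet_Ioc)).mpr
        (ae_of_all _ fun q hq => ?_)
      rw [norm_mul, norm_mul, Complex.norm_real]
      have := norm_qf_cpow_le hp ((abs_sum_mul_le_of_mem_cube hq.1).trans hb)
        ((norm_circleMap_zero' h0 q.2).trans_lt h1)
      rw [norm_circleMap_zero' h0] at this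
      calc _ ≤ ‖H q.2‖ * ((1 - ρ) ^ 2) ^ (-p) * ‖wprod κ q.1‖ := by gcongr
        _ = _ := by ring
  have hsw := integral_integral_swap (f := fun (t : Fin m → ℝ) (φ : ℝ) => H φ *
      qf (∑ i, b i * t i) (circleMap 0 ρ φ) ^ (-(p : ℂ)) * (wprod κ t : ℂ)) hF
  simp only [intervalIntegral.integral_of_le hpi, cubeG]
  simp only [← integral_mul_const, ← integral_const_mul, ← mul_assoc]
  exact hsw

theorem continuous_gegenC (n : ℕ) (l : ℝ) : Continuous (gegenC n l) := by
  unfold gegenC jacobiP; fun_prop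

theorem isCompact_cube (m : ℕ) : IsCompact (cube m) :=
  isCompact_univ_pi fun _ => isCompact_Icc

theorem sum_abs_mul_le_one {m : ℕ} {x y : EuclideanSpace ℝ (Fin m)} (hx : ‖x‖ = 1)
    (hy : ‖y‖ = 1) : ∑ i, |x i * y i| ≤ 1 := by
  have h1 := EuclideanSpace.real_norm_sq_eq x
  have h2 := EuclideanSpace.real_norm_sq_eq y
  rw [hx] at h1
  rw [hy] at h2
  calc _ ≤ ∑ i, (x i ^ 2 + y i ^ 2) / 2 := Finset.sum_le_sum fun i _ => by
        rw [abs_mul, ← sq_abs (x i), ← sq_abs (y i)]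
        nlinarith [sq_nonneg (|x i| - |y i|)]
    _ = 1 := by
        rw [← Finset.sum_div, Finset.sum_add_distrib, ← h1, ← h2]; norm_num

theorem lamK_pos {d : ℕ} (hd : 1 ≤ d) {κ : Fin (d + 1) → ℝ} (hκ : ∀ i, 0 < κ i) :
    0 < lamK d κ := by
  have h1 : 0 < ∑ i, κ i := Finset.sum_pos (fun i _ => hκ i) Finset.univ_nonempty
  have h2 : (1 : ℝ) ≤ d := by exact_mod_cast hd
  unfold lamK
  linarith

theorem lamK_add_one (d : ℕ) (κ : Fin (d + 1) → ℝ) :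
    lamK d κ + 1 = (∑ i, κ i) + ((d : ℝ) + 1) / 2 := by
  unfold lamK; ring

theorem integrableOn_continuous_mul_wprod {m : ℕ} {κ : Fin m → ℝ} (hκ : ∀ i, 0 < κ i)
    {f : (Fin m → ℝ) → ℝ} (hf : Continuous f) :
    IntegrableOn (fun t => f t * wprod κ t) (cube m) :=
  (integrableOn_wprod hκ).continuousOn_mul hf.continuousOn (isCompact_cube m)

theorem sum_hP_eq_integral {d : ℕ} {κ : Fin (d + 1) → ℝ} (hκ : ∀ i, 0 < κ i)
    (hl : 0 < lamK d κ) {x y : EuclideanSpace ℝ (Fin (d + 1))} (hx : ‖x‖ = 1) (hy : ‖y‖ = 1)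
    {ρ : ℝ} (h0 : 0 < ρ) (h1 : ρ < 1) {H : ℝ → ℂ} (hH : Continuous H) (s : Finset ℕ) (a : ℕ → ℝ)
    (h : ∀ u : ℝ, |u| ≤ 1 →
      ((∑ k ∈ s, a k * ((k + lamK d κ) / lamK d κ * gegenC k (lamK d κ) u) : ℝ) : ℂ) =
      (2 * π : ℂ)⁻¹ * ∫ φ in (-π)..π,
        H φ * qf u (circleMap 0 ρ φ) ^ (-((lamK d κ + 1 : ℝ) : ℂ))) :
    ((∑ k ∈ s, a k * hP d κ k x y : ℝ) : ℂ) =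
      ((∫ t in cube (d + 1), wprod κ t : ℝ) : ℂ)⁻¹ * (2 * π : ℂ)⁻¹ *
        ∫ φ in (-π)..π, H φ * cubeG κ (fun i => x i * y i) (lamK d κ + 1) (circleMap 0 ρ φ) := by
  set l := lamK d κ with hl'
  have hb := sum_abs_mul_le_one hx hy
  have e1 : ∑ k ∈ s, a k * hP d κ k x y = (∫ t in cube (d + 1), wprod κ t)⁻¹ *
      ∫ t in cube (d + 1), (∑ k ∈ s, a k * ((k + l) / l * gegenC k l (∑ i, x i * y i * t i))) *
        wprod κ t := by
    simp only [Finset.sum_mul]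
    rw [integral_finsetSum, Finset.mul_sum]
    · refine Finset.sum_congr rfl fun k _ => ?_
      rw [hP]
      simp only [mul_assoc, integral_const_mul]
      ring
    · intro k _
      have := continuous_gegenC k l
      exact integrableOn_continuous_mul_wprod hκ
        (f := fun t => a k * ((k + l) / l * gegenC k l (∑ i, x i * y i * t i))) (by fun_prop)
  rw [e1, Complex.ofReal_mul, Complex.ofReal_inv, mul_assoc]
  congr 1
  rw [← integral_complex_ofReal, ← integral_cube_integral_circle hκ hb (by linarith) h0 h1 hH,
    ← integral_const_mul]
  refine setIntegral_congr_fun (measurableSet_cube _) fun t ht => ?_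
  simp only [Complex.ofReal_mul]
  have := h _ ((abs_sum_mul_le_of_mem_cube ht).trans hb)
  rw [← mul_assoc, ← this]

theorem circleMap_zero_ne_zero {ρ : ℝ} (h0 : 0 < ρ) (φ : ℝ) : circleMap 0 ρ φ ≠ 0 :=
  circleMap_ne_center (ne_of_gt h0)

/-- Integral representation of the Cesàro kernel. -/
theorem hK_eq_integral {d : ℕ} {κ : Fin (d + 1) → ℝ} (hκ : ∀ i, 0 < κ i)
    (hl : 0 < lamK d κ) (δ : ℝ) {x y : EuclideanSpace ℝ (Fin (d + 1))} (hx : ‖x‖ = 1)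
    (hy : ‖y‖ = 1) {ρ : ℝ} (h0 : 0 < ρ) (h1 : ρ < 1) (n : ℕ) :
    (hK d κ δ n x y : ℂ) = (cesA δ n : ℂ)⁻¹ *
      (((∫ t in cube (d + 1), wprod κ t : ℝ) : ℂ)⁻¹ * (2 * π : ℂ)⁻¹ *
        ∫ φ in (-π)..π, (((circleMap 0 ρ φ) ^ n)⁻¹ *
          ((1 - circleMap 0 ρ φ) ^ (-((δ + 1 : ℝ) : ℂ)) * (1 - circleMap 0 ρ φ ^ 2))) *
          cubeG κ (fun i => x i * y i) (lamK d κ + 1) (circleMap 0 ρ φ)) := by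
  rw [hK, Complex.ofReal_mul, Complex.ofReal_inv]
  congr 1
  have hc := continuous_circleMap 0 ρ
  refine sum_hP_eq_integral hκ hl hx hy h0 h1 ?_ _ _ fun u hu => ?_
  · refine ((hc.pow n).inv₀ fun φ => pow_ne_zero n (circleMap_zero_ne_zero h0 φ)).mul
      (Continuous.mul ?_ (by fun_prop))
    refine (continuous_const.sub hc).cpow continuous_const fun φ => ?_
    exact one_sub_mem_slitPlane (by rw [norm_circleMap_zero' h0]; exact h1)
  · rw [cesaro_poisson_eq_integral δ hl hu h0 h1]
    congr 2
    ext φ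
    ring

/-- Integral representation of a finite combination of reproducing kernels. -/
theorem sum_smul_hP_eq_integral {d : ℕ} {κ : Fin (d + 1) → ℝ} (hκ : ∀ i, 0 < κ i)
    (hl : 0 < lamK d κ) {x y : EuclideanSpace ℝ (Fin (d + 1))} (hx : ‖x‖ = 1)
    (hy : ‖y‖ = 1) {ρ : ℝ} (h0 : 0 < ρ) (h1 : ρ < 1) (s : Finset ℕ) (a : ℕ → ℝ) :
    ((∑ k ∈ s, a k * hP d κ k x y : ℝ) : ℂ) =
      ((∫ t in cube (d + 1), wprod κ t : ℝ) : ℂ)⁻¹ * (2 * π : ℂ)⁻¹ *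
        ∫ φ in (-π)..π, ((∑ k ∈ s, (a k : ℂ) * ((circleMap 0 ρ φ) ^ k)⁻¹) *
          (1 - circleMap 0 ρ φ ^ 2)) *
          cubeG κ (fun i => x i * y i) (lamK d κ + 1) (circleMap 0 ρ φ) := by
  have hc := continuous_circleMap 0 ρ
  have hk : ∀ k : ℕ, Continuous fun φ => ((circleMap 0 ρ φ) ^ k)⁻¹ := fun k =>
    (hc.pow k).inv₀ fun φ => pow_ne_zero k (circleMap_zero_ne_zero h0 φ)
  refine sum_hP_eq_integral hκ hl hx hy h0 h1 (by fun_prop) _ _ fun u hu => ?_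
  have hq : Continuous fun φ => qf u (circleMap 0 ρ φ) ^ (-((lamK d κ + 1 : ℝ) : ℂ)) := by
    refine Continuous.cpow (by unfold qf; fun_prop) continuous_const fun φ => ?_
    exact qf_mem_slitPlane hu (by rw [norm_circleMap_zero' h0]; exact h1)
  push_cast at hq ⊢
  simp only [Finset.sum_mul]
  rw [intervalIntegral.integral_finsetSum, Finset.mul_sum]
  swap
  · exact fun k _ => Continuous.intervalIntegrable
      (((continuous_const.mul (hk k)).mul (by fun_prop)).mul hq) _ _
  refine Finset.sum_congr rfl fun k _ => ?_
  have := poisson_eq_integral hl hu h0 h1 k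
  push_cast at this
  rw [this]
  simp only [mul_assoc, intervalIntegral.integral_const_mul]
  ring

/-- Two-sided comparison of a sequence with a power. -/
def Growth (a : ℕ → ℝ) (q : ℝ) : Prop :=
  ∃ c₁ c₂ : ℝ, 0 < c₁ ∧ 0 < c₂ ∧ ∀ n : ℕ, 1 ≤ n → c₁ * (n : ℝ) ^ q ≤ a n ∧ a n ≤ c₂ * (n : ℝ) ^ q

theorem Growth.mul {a b : ℕ → ℝ} {q s : ℝ} (ha : Growth a q) (hb : Growth b s) :
    Growth (fun n => a n * b n) (q + s) := by
  obtain ⟨c₁, c₂, h1, h2, h⟩ := ha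
  obtain ⟨d₁, d₂, k1, k2, k⟩ := hb
  refine ⟨c₁ * d₁, c₂ * d₂, by positivity, by positivity, fun n hn => ?_⟩
  have hn' : (0 : ℝ) < n := by exact_mod_cast hn
  obtain ⟨u, v⟩ := h n hn
  obtain ⟨u', v'⟩ := k n hn
  have p1 : 0 < (n : ℝ) ^ q := by positivity
  have p2 : 0 < (n : ℝ) ^ s := by positivity
  rw [Real.rpow_add hn']
  have a0 : 0 < a n := lt_of_lt_of_le (by positivity) u
  have b0 : 0 < b n := lt_of_lt_of_le (by positivity) u'
  constructor
  · calc _ = c₁ * (n : ℝ) ^ q * (d₁ * (n : ℝ) ^ s) := by ring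
      _ ≤ a n * b n := by gcongr
  · calc a n * b n ≤ c₂ * (n : ℝ) ^ q * (d₂ * (n : ℝ) ^ s) := by gcongr
      _ = _ := by ring

theorem Growth.inv {a : ℕ → ℝ} {q : ℝ} (ha : Growth a q) : Growth (fun n => (a n)⁻¹) (-q) := by
  obtain ⟨c₁, c₂, h1, h2, h⟩ := ha
  refine ⟨c₂⁻¹, c₁⁻¹, by positivity, by positivity, fun n hn => ?_⟩
  have hn' : (0 : ℝ) < n := by exact_mod_cast hn
  obtain ⟨u, v⟩ := h n hn
  have p1 : 0 < (n : ℝ) ^ q := by positivity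
  have a0 : 0 < a n := lt_of_lt_of_le (by positivity) u
  rw [Real.rpow_neg hn'.le, ← mul_inv, ← mul_inv]
  exact ⟨inv_anti₀ a0 v, inv_anti₀ (by positivity) u⟩

theorem Growth.congr {a b : ℕ → ℝ} {q s : ℝ} (ha : Growth a q) (h : ∀ n, 1 ≤ n → a n = b n)
    (hq : q = s) : Growth b s := by
  obtain ⟨c₁, c₂, h1, h2, hh⟩ := ha
  subst hq
  exact ⟨c₁, c₂, h1, h2, fun n hn => h n hn ▸ hh n hn⟩

theorem growth_of_tendsto {a : ℕ → ℝ} {q L : ℝ} (hL : 0 < L) (ha : ∀ n, 1 ≤ n → 0 < a n)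
    (h : Filter.Tendsto (fun n : ℕ => a n / (n : ℝ) ^ q) Filter.atTop (nhds L)) : Growth a q := by
  have hb : ∀ {b : ℕ → ℝ} {M : ℝ}, Filter.Tendsto b Filter.atTop (nhds M) →
      ∃ c : ℝ, 0 < c ∧ ∀ n, b n ≤ c := fun {b M} hb => by
    obtain ⟨c, hc⟩ := hb.bddAbove_range
    exact ⟨max c 1, by positivity, fun n => (hc ⟨n, rfl⟩).trans (le_max_left _ _)⟩
  obtain ⟨c₂, h2, hc2⟩ := hb h
  obtain ⟨c₁, h1, hc1⟩ := hb (h.inv₀ hL.ne')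
  refine ⟨c₁⁻¹, c₂, by positivity, h2, fun n hn => ?_⟩
  have hn' : (0 : ℝ) < n := by exact_mod_cast hn
  have p1 : 0 < (n : ℝ) ^ q := by positivity
  have a0 := ha n hn
  refine ⟨?_, (div_le_iff₀ p1).mp (hc2 n)⟩
  have := hc1 n
  rw [inv_div, div_le_iff₀ a0] at this
  rw [inv_mul_le_iff₀ h1]
  exact this

theorem growth_add_const {s : ℝ} (hs : 0 ≤ s) : Growth (fun n => n + s) 1 := by
  refine ⟨1, 1 + s, one_pos, by positivity, fun n hn => ?_⟩
  have hn' : (1 : ℝ) ≤ n := by exact_mod_cast hn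
  rw [Real.rpow_one]
  constructor
  · linarith
  · nlinarith

theorem growth_mul_add_const {c s : ℝ} (hc : 0 < c) (hs : 0 ≤ s) :
    Growth (fun n => c * n + s) 1 := by
  refine ⟨c, c + s, hc, by positivity, fun n hn => ?_⟩
  have hn' : (1 : ℝ) ≤ n := by exact_mod_cast hn
  rw [Real.rpow_one]
  constructor
  · linarith
  · nlinarith

theorem growth_poch_div_factorial {s : ℝ} (hs : 0 < s) :
    Growth (fun n => poch s n / Nat.factorial n) (s - 1) := by
  have h1 : Growth (fun n => poch s (n + 1) / Nat.factorial n) s := by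
    have hG := Real.Gamma_pos_of_pos hs
    refine growth_of_tendsto (inv_pos.mpr hG) (fun n _ => by have := poch_pos hs (n + 1); positivity)
      (((Real.GammaSeq_tendsto_Gamma s).inv₀ hG.ne').congr fun n => ?_)
    rw [Real.GammaSeq, poch, inv_div, div_div, mul_comm ((n : ℝ) ^ s)]
  refine (h1.mul (growth_add_const hs.le).inv).congr (fun n _ => ?_) (by ring)
  have : 0 < (n : ℝ) + s := by positivity
  rw [poch, poch, Finset.prod_range_succ]
  field_simp
  ring

theorem cesA_eq_poch (δ : ℝ) (n : ℕ) : cesA δ n = poch (δ + 1) n / Nat.factorial n := by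
  rw [cesA, genBinom, poch, ← Finset.prod_range_reflect]
  congr 1
  refine Finset.prod_congr rfl fun i hi => ?_
  have : i < n := Finset.mem_range.mp hi
  rw [Nat.cast_sub (by omega), Nat.cast_sub (by omega)]
  push_cast
  ring

theorem growth_cesA {δ : ℝ} (hδ : -1 < δ) : Growth (cesA δ) δ :=
  (growth_poch_div_factorial (by linarith : 0 < δ + 1)).congr
    (fun n _ => (cesA_eq_poch δ n).symm) (by ring)

/-- Integration in polar coordinates for nonnegative functions. -/
lemma lintegral_polar {E : Type*} [NormedAddCommGroup E] [NormedSpace ℝ E] [MeasurableSpace E]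
    [BorelSpace E] [FiniteDimensional ℝ E] [Nontrivial E] (μ : Measure E) [μ.IsAddHaarMeasure]
    {F : E → ENNReal} (hF : Measurable F) :
    ∫⁻ x, F x ∂μ = ∫⁻ y, ∫⁻ r in Set.Ioi (0 : ℝ),
      ENNReal.ofReal (r ^ (Module.finrank ℝ E - 1)) * F (r • (y : E)) ∂volume ∂μ.toSphere := by
  have hsm : Measurable fun p : Metric.sphere (0 : E) 1 × Set.Ioi (0 : ℝ) =>
      F ((p.2 : ℝ) • (p.1 : E)) := by fun_prop
  have h1 : ∫⁻ x, F x ∂μ = ∫⁻ x : ({(0 : E)}ᶜ : Set E), F x ∂(μ.comap (↑)) := by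
    rw [lintegral_subtype_comap (measurableSet_singleton _).compl F,
      restrict_compl_singleton]
  have h2 := μ.measurePreserving_homeomorphUnitSphereProd.lintegral_comp hsm
  have h3 : ∀ x : ({(0 : E)}ᶜ : Set E),
      F (((homeomorphUnitSphereProd E x).2 : ℝ) • ((homeomorphUnitSphereProd E x).1 : E)) = F x := by
    intro x
    congr 1
    have hx : ‖(x : E)‖ ≠ 0 := norm_ne_zero_iff.2 x.2
    simp [smul_smul, hx]
  simp only [h3] at h2
  rw [h1, h2, lintegral_prod _ hsm.aemeasurable]
  refine lintegral_congr fun y => ?_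
  rw [Measure.volumeIoiPow, lintegral_withDensity_eq_lintegral_mul _ (by fun_prop) (by fun_prop)]
  simp only [Pi.mul_apply]
  rw [lintegral_subtype_comap measurableSet_Ioi
    (fun r : ℝ => ENNReal.ofReal (r ^ (Module.finrank ℝ E - 1)) * F (r • (y : E)))]

lemma lintegral_fun_norm {E : Type*} [NormedAddCommGroup E] [NormedSpace ℝ E] [MeasurableSpace E]
    [BorelSpace E] [FiniteDimensional ℝ E] [Nontrivial E] (μ : Measure E) [μ.IsAddHaarMeasure]
    {f : ℝ → ENNReal} (hf : Measurable f) :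
    ∫⁻ x, f ‖x‖ ∂μ = μ.toSphere Set.univ * ∫⁻ r in Set.Ioi (0 : ℝ),
      ENNReal.ofReal (r ^ (Module.finrank ℝ E - 1)) * f r := by
  rw [lintegral_polar μ (by fun_prop : Measurable fun x : E => f ‖x‖)]
  have : ∀ y : Metric.sphere (0 : E) 1, ∫⁻ r in Set.Ioi (0 : ℝ),
      ENNReal.ofReal (r ^ (Module.finrank ℝ E - 1)) * f ‖r • (y : E)‖ =
      ∫⁻ r in Set.Ioi (0 : ℝ), ENNReal.ofReal (r ^ (Module.finrank ℝ E - 1)) * f r := by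
    intro y
    refine setLIntegral_congr_fun measurableSet_Ioi fun r hr => ?_
    have hr' : (0 : ℝ) < r := hr
    simp [norm_smul, abs_of_pos hr']
  simp only [this, lintegral_const]
  rw [mul_comm]

/-- A rotation carrying a given unit vector to the first axis of a product space. -/
lemma exists_isometry_to_axis (d : ℕ) {e : EuclideanSpace ℝ (Fin (d + 1))} (he : ‖e‖ = 1) :
    ∃ T : EuclideanSpace ℝ (Fin (d + 1)) ≃ₗᵢ[ℝ] WithLp 2 (ℝ × EuclideanSpace ℝ (Fin d)),
      T e = WithLp.toLp 2 (1, 0) := by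
  have hfr : Module.finrank ℝ (WithLp 2 (ℝ × EuclideanSpace ℝ (Fin d))) = d + 1 := by
    rw [(WithLp.linearEquiv 2 ℝ (ℝ × EuclideanSpace ℝ (Fin d))).finrank_eq]
    simp [add_comm]
  let T₀ := (stdOrthonormalBasis ℝ (EuclideanSpace ℝ (Fin (d + 1)))).equiv
    (stdOrthonormalBasis ℝ (WithLp 2 (ℝ × EuclideanSpace ℝ (Fin d))))
    (finCongr (by rw [hfr]; simp))
  have hn : ‖T₀ e‖ = ‖(WithLp.toLp 2 ((1 : ℝ), (0 : EuclideanSpace ℝ (Fin d))) :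
      WithLp 2 (ℝ × EuclideanSpace ℝ (Fin d)))‖ := by
    rw [LinearIsometryEquiv.norm_map, he]
    simp
  exact ⟨T₀.trans (Submodule.reflection _), Submodule.reflection_sub hn⟩

lemma lintegral_half_plane (f : ℝ × ℝ → ENNReal) (hf : Measurable f) :
    ∫⁻ s : ℝ, ∫⁻ v in Set.Ioi (0 : ℝ), f (s, v) =
      ∫⁻ r in Set.Ioi (0 : ℝ), ∫⁻ θ in Set.Ioo 0 π,
        ENNReal.ofReal r * f (r * cos θ, r * sin θ) := by
  have hI : MeasurableSet {p : ℝ × ℝ | 0 < p.2} := measurableSet_lt measurable_const measurable_snd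
  have h := lintegral_comp_polarCoord_symm ({p : ℝ × ℝ | 0 < p.2}.indicator f)
  have h2 : ∫⁻ p : ℝ × ℝ, {p : ℝ × ℝ | 0 < p.2}.indicator f p =
      ∫⁻ s : ℝ, ∫⁻ v in Set.Ioi (0 : ℝ), f (s, v) := by
    rw [Measure.volume_eq_prod, lintegral_prod _ (hf.indicator hI).aemeasurable]
    refine lintegral_congr fun s => ?_
    rw [← lintegral_indicator measurableSet_Ioi]
    rfl
  rw [← h2, ← h, polarCoord_target, Measure.volume_eq_prod, ← Measure.prod_restrict,
    lintegral_prod]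
  · refine setLIntegral_congr_fun measurableSet_Ioi fun r hr => ?_
    have hr' : (0 : ℝ) < r := hr
    simp only []
    rw [← lintegral_indicator measurableSet_Ioo, ← lintegral_indicator measurableSet_Ioo]
    refine lintegral_congr fun θ => ?_
    simp only [Set.indicator, polarCoord_symm_apply, Set.mem_ofPred_eq, smul_eq_mul, Set.mem_Ioo]
    by_cases h0 : 0 < θ ∧ θ < π
    · have hs : 0 < r * sin θ := mul_pos hr' (sin_pos_of_pos_of_lt_pi h0.1 h0.2)
      have : -π < θ := by linarith [pi_pos, h0.1]
      simp [h0, hs, this]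
    · rw [if_neg h0]
      by_cases h1 : -π < θ ∧ θ < π
      · have : sin θ ≤ 0 := by
          refine sin_nonpos_of_nonpos_of_neg_pi_le ?_ h1.1.le
          by_contra hh
          exact h0 ⟨by linarith, h1.2⟩
        have : ¬ 0 < r * sin θ := by nlinarith
        simp [this]
      · simp [h1]
  · refine Measurable.aemeasurable ?_
    have := hf.indicator hI
    have h3 : Measurable fun p : ℝ × ℝ => polarCoord.symm p := by
      simp only [polarCoord_symm_apply]; fun_prop
    simp only [smul_eq_mul]
    exact (by fun_prop : Measurable fun p : ℝ × ℝ => ENNReal.ofReal p.1).mul (this.comp h3)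

lemma lintegral_pow_mul_exp_neg (d : ℕ) :
    (∫⁻ r in Set.Ioi (0 : ℝ), ENNReal.ofReal (r ^ d) * ENNReal.ofReal (exp (-r ^ 2))) ≠ 0 ∧
    (∫⁻ r in Set.Ioi (0 : ℝ), ENNReal.ofReal (r ^ d) * ENNReal.ofReal (exp (-r ^ 2))) ≠ ⊤ := by
  have h0 : ∫⁻ r in Set.Ioi (0 : ℝ), ENNReal.ofReal (r ^ d) * ENNReal.ofReal (exp (-r ^ 2)) =
      ∫⁻ r in Set.Ioi (0 : ℝ), ENNReal.ofReal (r ^ (d : ℝ) * exp (-1 * r ^ 2)) := by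
    refine setLIntegral_congr_fun measurableSet_Ioi fun r hr => ?_
    have hr' : (0 : ℝ) < r := hr
    rw [← ENNReal.ofReal_mul (by positivity), rpow_natCast]
    ring_nf
  have hi := integrableOn_rpow_mul_exp_neg_mul_sq (b := 1) one_pos (s := d)
    (by linarith [Nat.cast_nonneg (α := ℝ) d])
  rw [h0]
  refine ⟨?_, ?_⟩
  · rw [← pos_iff_ne_zero, lintegral_pos_iff_support (by fun_prop)]
    rw [Measure.restrict_apply' measurableSet_Ioi]
    have : Set.Ioi (0 : ℝ) ⊆ (Function.support fun r : ℝ =>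
        ENNReal.ofReal (r ^ (d : ℝ) * exp (-1 * r ^ 2))) ∩ Set.Ioi 0 := by
      intro r hr
      have hr' : (0 : ℝ) < r := hr
      refine ⟨?_, hr⟩
      simp only [Function.mem_support, ne_eq, ENNReal.ofReal_eq_zero, not_le]
      positivity
    exact lt_of_lt_of_le (by simp) (measure_mono this)
  · exact hi.lintegral_lt_top.ne

/-- Integrals over the sphere of functions depending on one direction only. -/
lemma lintegral_zonal {d : ℕ} (hd : 1 ≤ d) {e : EuclideanSpace ℝ (Fin (d + 1))} (he : ‖e‖ = 1)
    {Φ : ℝ → ENNReal} (hΦ : Measurable Φ) :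
    ∫⁻ y, Φ (inner ℝ e (y : EuclideanSpace ℝ (Fin (d + 1)))) ∂(sphereMeas d) =
      (volume : Measure (EuclideanSpace ℝ (Fin d))).toSphere Set.univ *
        ∫⁻ θ in Set.Ioo 0 π, ENNReal.ofReal (sin θ ^ (d - 1)) * Φ (cos θ) := by
  have : Nontrivial (EuclideanSpace ℝ (Fin d)) := by
    have : Nonempty (Fin d) := ⟨⟨0, hd⟩⟩
    infer_instance
  set g : ℝ → ENNReal := fun r => ENNReal.ofReal (exp (-r ^ 2)) with hg
  have hgm : Measurable g := by fun_prop
  set R := ∫⁻ r in Set.Ioi (0 : ℝ), ENNReal.ofReal (r ^ d) * g r with hR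
  obtain ⟨hR0, hRt⟩ := lintegral_pow_mul_exp_neg d
  have hFm : Measurable fun x : EuclideanSpace ℝ (Fin (d + 1)) =>
      Φ (inner ℝ e x / ‖x‖) * g ‖x‖ := by
    refine (hΦ.comp ?_).mul (by fun_prop)
    have : Measurable fun x : EuclideanSpace ℝ (Fin (d + 1)) => (inner ℝ e x : ℝ) := by fun_prop
    fun_prop
  have hA : ∫⁻ x : EuclideanSpace ℝ (Fin (d + 1)), Φ (inner ℝ e x / ‖x‖) * g ‖x‖ =
      (∫⁻ y, Φ (inner ℝ e (y : EuclideanSpace ℝ (Fin (d + 1)))) ∂(sphereMeas d)) * R := by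
    rw [lintegral_polar volume hFm, sphereMeas, ← lintegral_mul_const']
    · refine lintegral_congr fun y => ?_
      rw [hR, ← lintegral_const_mul _ (by fun_prop)]
      refine setLIntegral_congr_fun measurableSet_Ioi fun r hr => ?_
      have hr' : (0 : ℝ) < r := hr
      have hy : ‖(y : EuclideanSpace ℝ (Fin (d + 1)))‖ = 1 := by simp
      have h1 : ‖r • (y : EuclideanSpace ℝ (Fin (d + 1)))‖ = r := by
        rw [norm_smul, hy, mul_one, norm_of_nonneg hr'.le]
      simp only [h1, inner_smul_right, finrank_euclideanSpace, Fintype.card_fin,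
        Nat.add_sub_cancel]
      rw [mul_div_cancel_left₀ _ hr'.ne']
      ring
    · exact hRt
  have hB : ∫⁻ x : EuclideanSpace ℝ (Fin (d + 1)), Φ (inner ℝ e x / ‖x‖) * g ‖x‖ =
      ((volume : Measure (EuclideanSpace ℝ (Fin d))).toSphere Set.univ *
        ∫⁻ θ in Set.Ioo 0 π, ENNReal.ofReal (sin θ ^ (d - 1)) * Φ (cos θ)) * R := by
    obtain ⟨T, hT⟩ := exists_isometry_to_axis d he
    have h1 : ∀ x : EuclideanSpace ℝ (Fin (d + 1)), Φ (inner ℝ e x / ‖x‖) * g ‖x‖ =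
        Φ ((T x).fst / ‖T x‖) * g ‖T x‖ := by
      intro x
      rw [T.norm_map, ← T.inner_map_map, hT]
      simp [WithLp.prod_inner_apply]
    simp only [h1]
    have hm2 : Measurable fun z : ℝ × EuclideanSpace ℝ (Fin d) =>
        Φ (z.1 / √(z.1 ^ 2 + ‖z.2‖ ^ 2)) * g √(z.1 ^ 2 + ‖z.2‖ ^ 2) := by fun_prop
    have h2 : ∀ z : WithLp 2 (ℝ × EuclideanSpace ℝ (Fin d)), Φ (z.fst / ‖z‖) * g ‖z‖ =
        (fun z : ℝ × EuclideanSpace ℝ (Fin d) =>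
        Φ (z.1 / √(z.1 ^ 2 + ‖z.2‖ ^ 2)) * g √(z.1 ^ 2 + ‖z.2‖ ^ 2)) (WithLp.ofLp z) := by
      intro z
      rw [WithLp.prod_norm_eq_of_L2, norm_eq_abs, sq_abs]
      rfl
    have hm1 : Measurable fun z : WithLp 2 (ℝ × EuclideanSpace ℝ (Fin d)) =>
        Φ (z.fst / ‖z‖) * g ‖z‖ := by
      simp only [h2]
      exact hm2.comp (WithLp.volume_preserving_ofLp ℝ (EuclideanSpace ℝ (Fin d))).measurable
    rw [T.measurePreserving.lintegral_comp hm1]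
    simp only [h2]
    rw [(WithLp.volume_preserving_ofLp ℝ (EuclideanSpace ℝ (Fin d))).lintegral_comp hm2,
      Measure.volume_eq_prod, lintegral_prod _ hm2.aemeasurable]
    have h3 : ∀ s : ℝ, ∫⁻ w : EuclideanSpace ℝ (Fin d),
        Φ (s / √(s ^ 2 + ‖w‖ ^ 2)) * g √(s ^ 2 + ‖w‖ ^ 2) =
        (volume : Measure (EuclideanSpace ℝ (Fin d))).toSphere Set.univ *
          ∫⁻ v in Set.Ioi (0 : ℝ), ENNReal.ofReal (v ^ (d - 1)) *
            (Φ (s / √(s ^ 2 + v ^ 2)) * g √(s ^ 2 + v ^ 2)) := by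
      intro s
      have := lintegral_fun_norm (volume : Measure (EuclideanSpace ℝ (Fin d)))
        (f := fun v => Φ (s / √(s ^ 2 + v ^ 2)) * g √(s ^ 2 + v ^ 2)) (by fun_prop)
      rw [this, finrank_euclideanSpace, Fintype.card_fin]
    simp only [h3]
    rw [lintegral_const_mul' _ _ (measure_ne_top _ _), mul_assoc]
    congr 1
    have h4 := lintegral_half_plane (fun p : ℝ × ℝ => ENNReal.ofReal (p.2 ^ (d - 1)) *
            (Φ (p.1 / √(p.1 ^ 2 + p.2 ^ 2)) * g √(p.1 ^ 2 + p.2 ^ 2))) (by fun_prop)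
    rw [h4, mul_comm _ R, hR, ← lintegral_mul_const _ (by fun_prop)]
    · refine setLIntegral_congr_fun measurableSet_Ioi fun r hr => ?_
      have hr' : (0 : ℝ) < r := hr
      simp only []
      rw [← lintegral_const_mul _ (by fun_prop)]
      refine setLIntegral_congr_fun measurableSet_Ioo fun θ hθ => ?_
      have hs := sin_pos_of_pos_of_lt_pi hθ.1 hθ.2
      have h5 : √((r * cos θ) ^ 2 + (r * sin θ) ^ 2) = r := by
        rw [show (r * cos θ) ^ 2 + (r * sin θ) ^ 2 = r ^ 2 * (sin θ ^ 2 + cos θ ^ 2) by ring,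
          sin_sq_add_cos_sq, mul_one, sqrt_sq hr'.le]
      simp only [h5]
      rw [mul_div_cancel_left₀ _ hr'.ne', mul_pow, ENNReal.ofReal_mul (by positivity),
        show r ^ d = r * r ^ (d - 1) by rw [← pow_succ', Nat.sub_add_cancel hd],
        ENNReal.ofReal_mul hr'.le]
      ring
  rw [hA] at hB
  exact (ENNReal.mul_left_inj hR0 hRt).1 hB

/-- The zonal majorant of the kernel, at height `u` and complex parameter `r`. -/
noncomputable def zmaj (d : ℕ) (τ u : ℝ) (r : ℂ) : ℝ :=
  ‖qf u r‖ ^ (-(((d : ℝ) + 1) / 2)) * (1 + ‖1 - r ^ 2‖ ^ 2 / ‖qf u r‖) ^ τ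

lemma norm_qf_le_four {u : ℝ} {r : ℂ} (hu : |u| ≤ 1) (hr : ‖r‖ < 1) : ‖qf u r‖ ≤ 4 := by
  unfold qf
  have h1 : ‖(1 : ℂ) - 2 * u * r + r ^ 2‖ ≤ ‖(1 : ℂ)‖ + ‖2 * (u : ℂ) * r‖ + ‖r ^ 2‖ :=
    (norm_add_le _ _).trans (by gcongr; exact norm_sub_le _ _)
  simp only [norm_one, norm_mul, norm_pow, Complex.norm_real, norm_eq_abs, Complex.norm_ofNat] at h1
  nlinarith [norm_nonneg r, abs_nonneg u, mul_le_mul hu hr.le (norm_nonneg r) zero_le_one]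

lemma one_sub_sq_le {u : ℝ} {r : ℂ} (hu : |u| ≤ 1) (h1 : 1 / 2 ≤ ‖r‖) (hr : ‖r‖ < 1) :
    1 - u ^ 2 ≤ ‖1 - r ^ 2‖ ^ 2 + 8 * ‖qf u r‖ := by
  have hid : (4 : ℂ) * r ^ 2 * ((1 - u ^ 2 : ℝ) : ℂ) =
      (qf u r) ^ 2 + 4 * u * r * qf u r - (1 - r ^ 2) ^ 2 := by
    unfold qf; push_cast; ring
  have hu2 : 0 ≤ 1 - u ^ 2 := by nlinarith [abs_le.1 hu]
  have h2 := congrArg norm hid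
  have h3 : ‖(qf u r) ^ 2 + 4 * u * r * qf u r - (1 - r ^ 2) ^ 2‖ ≤
      ‖(qf u r) ^ 2‖ + ‖4 * (u : ℂ) * r * qf u r‖ + ‖(1 - r ^ 2) ^ 2‖ :=
    (norm_sub_le _ _).trans (by gcongr; exact norm_add_le _ _)
  rw [← h2] at h3
  simp only [norm_mul, norm_pow, Complex.norm_real, norm_eq_abs, Complex.norm_ofNat,
    abs_of_nonneg hu2] at h3
  have h4 := norm_qf_le_four hu hr
  have h5 : |u| * ‖r‖ ≤ 1 := by nlinarith [norm_nonneg r, abs_nonneg u]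
  have h6 : 4 * |u| * ‖r‖ * ‖qf u r‖ ≤ 4 * ‖qf u r‖ := by nlinarith [norm_nonneg (qf u r)]
  have h7 : (1 - u ^ 2) ≤ 4 * ‖r‖ ^ 2 * (1 - u ^ 2) :=
    le_mul_of_one_le_left hu2 (by nlinarith)
  nlinarith [norm_nonneg (qf u r)]

/-- Reflection of the coordinates of `x` by the signs `e`. -/
noncomputable def reflect {m : ℕ} (e : Fin m → Bool) (x : EuclideanSpace ℝ (Fin m)) :
    EuclideanSpace ℝ (Fin m) := WithLp.toLp 2 fun i => sg (e i) * x i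

lemma norm_reflect {m : ℕ} (e : Fin m → Bool) (x : EuclideanSpace ℝ (Fin m)) :
    ‖reflect e x‖ = ‖x‖ := by
  simp [EuclideanSpace.norm_eq, reflect, abs_sg]

lemma inner_reflect {m : ℕ} (e : Fin m → Bool) (x y : EuclideanSpace ℝ (Fin m)) :
    inner ℝ (reflect e x) y = sgForm e (fun i => x i * y i) := by
  simp only [PiLp.inner_apply, reflect, sgForm, RCLike.inner_apply, conj_trivial]
  exact Finset.sum_congr rfl fun i _ => by ring

lemma abs_coord_le_add_sqrt {m : ℕ} {x y : EuclideanSpace ℝ (Fin m)} (hx : ‖x‖ = 1)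
    (hy : ‖y‖ = 1) (i : Fin m) :
    |y i| ≤ |x i| + √(1 - (inner ℝ x y : ℝ) ^ 2) := by
  set u : ℝ := inner ℝ x y
  have hu : |u| ≤ 1 := by simpa [hx, hy] using abs_real_inner_le_norm x y
  have h1 : ‖y - u • x‖ ^ 2 = 1 - u ^ 2 := by
    rw [norm_sub_sq_real, inner_smul_right, norm_smul, real_inner_comm, hx, hy, norm_eq_abs]
    rw [mul_one, sq_abs]
    ring
  have h2 : ‖y - u • x‖ = √(1 - u ^ 2) := by rw [← h1, sqrt_sq (norm_nonneg _)]
  have h3 : |y i - u * x i| ≤ √(1 - u ^ 2) := by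
    rw [← h2]
    simpa using PiLp.norm_apply_le (y - u • x) i
  have h4 : |y i| ≤ |y i - u * x i| + |u * x i| := by
    simpa using abs_add_le (y i - u * x i) (u * x i)
  rw [abs_mul] at h4
  nlinarith [abs_nonneg (x i)]

lemma exists_coord_sq_ge {d : ℕ} {x : EuclideanSpace ℝ (Fin (d + 1))} (hx : ‖x‖ = 1) :
    ∃ j, 1 ≤ ((d : ℝ) + 1) * |x j| := by
  by_contra! h
  have h1 : ∑ i, x i ^ 2 = 1 := by
    have := EuclideanSpace.norm_sq_eq x
    simpa [hx] using this.symm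
  have h2 : ∀ i, ((d : ℝ) + 1) * x i ^ 2 < 1 := by
    intro i
    have h3 : |x i| ≤ 1 := by simpa [hx] using PiLp.norm_apply_le x i
    rw [← sq_abs]
    have := h i
    nlinarith [abs_nonneg (x i), Nat.cast_nonneg (α := ℝ) d, mul_nonneg (Nat.cast_nonneg (α := ℝ) d) (abs_nonneg (x i))]
  have h3 : ∑ i : Fin (d + 1), ((d : ℝ) + 1) * x i ^ 2 < ∑ i : Fin (d + 1), (1 : ℝ) :=
    Finset.sum_lt_sum_of_nonempty univ_nonempty fun i _ => h2 i
  rw [← mul_sum, h1] at h3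
  simp at h3

lemma sq_coord_le {m : ℕ} {x y : EuclideanSpace ℝ (Fin m)} (hx : ‖x‖ = 1) (hy : ‖y‖ = 1)
    (e : Fin m → Bool) {r : ℂ} (h1 : 1 / 2 ≤ ‖r‖) (hr : ‖r‖ < 1) (i : Fin m)
    (hE : 0 < ‖qf (sgForm e fun i => x i * y i) r‖) :
    |y i| ^ 2 ≤ 36 * (1 + ‖1 - r ^ 2‖ ^ 2 / ‖qf (sgForm e fun i => x i * y i) r‖) *
      (‖qf (sgForm e fun i => x i * y i) r‖ + |x i * y i|) := by
  have hu : |sgForm e fun i => x i * y i| ≤ 1 :=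
    (abs_sgForm_le e _).trans (sum_abs_mul_le_one hx hy)
  have h2 := one_sub_sq_le hu h1 hr
  have h3 := abs_coord_le_add_sqrt ((norm_reflect e x).trans hx) hy i
  rw [inner_reflect] at h3
  set u := sgForm e fun i => x i * y i
  set E := ‖qf u r‖
  set ψ := ‖1 - r ^ 2‖
  have hxi : |reflect e x i| = |x i| := by simp [reflect, abs_mul, abs_sg]
  rw [hxi] at h3
  have hW : (1 + ψ ^ 2 / E) * E = E + ψ ^ 2 := by field_simp
  have hW1 : 1 ≤ 1 + ψ ^ 2 / E := by
    have : 0 ≤ ψ ^ 2 / E := by positivity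
    linarith
  set W := 1 + ψ ^ 2 / E
  have hu2 : 0 ≤ 1 - u ^ 2 := by nlinarith [abs_le.1 hu]
  rcases le_total (√(1 - u ^ 2)) |x i| with h | h
  · rw [abs_mul]
    have : |y i| ^ 2 ≤ 2 * (|x i| * |y i|) := by nlinarith [abs_nonneg (y i)]
    have h0 : 0 ≤ |x i| * |y i| := by positivity
    nlinarith [mul_nonneg (sub_nonneg.2 hW1) h0, mul_pos (lt_of_lt_of_le one_pos hW1) hE]
  · have h4 : |y i| ^ 2 ≤ 4 * (1 - u ^ 2) := by
      rw [← sq_sqrt hu2]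
      nlinarith [abs_nonneg (y i), abs_nonneg (x i)]
    have h0 : 0 ≤ |x i * y i| := abs_nonneg _
    nlinarith [mul_nonneg (zero_le_one.trans hW1) h0, sq_nonneg ψ]

lemma vertexTerm_mul_hsq_le {d : ℕ} {κ : Fin (d + 1) → ℝ} (hκ : ∀ i, 0 < κ i)
    {x y : EuclideanSpace ℝ (Fin (d + 1))} (hx : ‖x‖ = 1) (hy : ‖y‖ = 1)
    (e : Fin (d + 1) → Bool) {r : ℂ} (h1 : 1 / 2 ≤ ‖r‖) (hr : ‖r‖ < 1)
    {τ : ℝ} (hτ : ∀ j, ∑ i, κ i - κ j ≤ τ) :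
    vertexTerm κ (fun i => x i * y i) (lamK d κ + 1) ‖qf (sgForm e fun i => x i * y i) r‖ *
      hsq κ y ≤ (((d : ℝ) + 1) ^ (∑ i, κ i) * 36 ^ τ) *
        zmaj d τ (sgForm e fun i => x i * y i) r := by
  have hu : |sgForm e fun i => x i * y i| ≤ 1 :=
    (abs_sgForm_le e _).trans (sum_abs_mul_le_one hx hy)
  have hE : 0 < ‖qf (sgForm e fun i => x i * y i) r‖ := norm_pos_iff.2 (qf_ne_zero hu hr)
  have hsq' := fun i => sq_coord_le hx hy e h1 hr i hE
  unfold vertexTerm zmaj hsq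
  rw [lamK_add_one]
  set E := ‖qf (sgForm e fun i => x i * y i) r‖
  set W := 1 + ‖1 - r ^ 2‖ ^ 2 / E with hW
  have hW1 : 1 ≤ W := by
    have : 0 ≤ ‖1 - r ^ 2‖ ^ 2 / E := by positivity
    linarith
  obtain ⟨j, hj⟩ := exists_coord_sq_ge hx
  have hd0 : (1 : ℝ) ≤ d + 1 := by linarith [Nat.cast_nonneg (α := ℝ) d]
  have hterm : ∀ i, (E + |x i * y i|) ^ (-κ i) * |y i| ^ (2 * κ i) =
      (|y i| ^ 2 / (E + |x i * y i|)) ^ κ i := by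
    intro i
    have h0 : 0 < E + |x i * y i| := by positivity
    rw [div_rpow (by positivity) h0.le, rpow_neg h0.le, rpow_mul (abs_nonneg _), rpow_two]
    field_simp
  have hj' : (|y j| ^ 2 / (E + |x j * y j|)) ≤ d + 1 := by
    have h0 : 0 < E + |x j * y j| := by positivity
    rw [div_le_iff₀ h0, abs_mul]
    have hyj : |y j| ≤ 1 := by simpa [hy] using PiLp.norm_apply_le y j
    have : |y j| ^ 2 ≤ (((d : ℝ) + 1) * |x j|) * |y j| := by nlinarith [abs_nonneg (y j)]
    nlinarith
  have hprod : (∏ i, (E + |x i * y i|) ^ (-κ i)) * ∏ i, |y i| ^ (2 * κ i) ≤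
      ((d : ℝ) + 1) ^ (∑ i, κ i) * 36 ^ τ * W ^ τ := by
    rw [← prod_mul_distrib]
    simp only [hterm]
    rw [← mul_prod_erase _ _ (mem_univ j), mul_assoc, ← mul_rpow (by norm_num) (by linarith)]
    have hsum : ∑ i ∈ univ.erase j, κ i = ∑ i, κ i - κ j := by
      rw [← add_sum_erase _ _ (mem_univ j)]; ring
    refine mul_le_mul ?_ ?_ (prod_nonneg fun i _ => by positivity) (by positivity)
    · calc (|y j| ^ 2 / (E + |x j * y j|)) ^ κ j ≤ ((d : ℝ) + 1) ^ κ j :=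
          rpow_le_rpow (by positivity) hj' (hκ j).le
        _ ≤ _ := rpow_le_rpow_of_exponent_le hd0
          (single_le_sum (f := κ) (fun i _ => (hκ i).le) (mem_univ j))
    · calc ∏ i ∈ univ.erase j, (|y i| ^ 2 / (E + |x i * y i|)) ^ κ i
          ≤ ∏ i ∈ univ.erase j, (36 * W) ^ κ i := by
            refine prod_le_prod (fun i _ => by positivity) fun i _ => ?_
            refine rpow_le_rpow (by positivity) ?_ (hκ i).le
            rw [div_le_iff₀ (by positivity)]
            exact hsq' i
        _ = (36 * W) ^ (∑ i, κ i - κ j) := by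
            rw [← hsum, rpow_sum_of_pos (by positivity)]
        _ ≤ _ := rpow_le_rpow_of_exponent_le (by linarith) (hτ j)
  have hexp : -(∑ i, κ i + ((d : ℝ) + 1) / 2 - ∑ i, κ i) = -(((d : ℝ) + 1) / 2) := by ring
  rw [hexp, mul_assoc]
  calc _ ≤ E ^ (-(((d : ℝ) + 1) / 2)) * (((d : ℝ) + 1) ^ (∑ i, κ i) * 36 ^ τ * W ^ τ) := by
        gcongr
    _ = _ := by ring

lemma sq_norm_one_sub_circleMap (ρ β : ℝ) :
    ‖1 - circleMap 0 ρ β‖ ^ 2 = (1 - ρ) ^ 2 + 4 * ρ * sin (β / 2) ^ 2 := by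
  have h : cos β = 1 - 2 * sin (β / 2) ^ 2 := by
    have := cos_two_mul (β / 2)
    rw [mul_div_cancel₀ _ (two_ne_zero)] at this
    rw [this, cos_sq']; ring
  rw [← Complex.normSq_eq_norm_sq, Complex.normSq_apply, circleMap_zero]
  simp only [Complex.sub_re, Complex.sub_im, Complex.one_re, Complex.one_im, Complex.mul_re,
    Complex.mul_im, Complex.ofReal_re, Complex.ofReal_im, Complex.exp_ofReal_mul_I_re,
    Complex.exp_ofReal_mul_I_im, zero_mul, sub_zero, add_zero]
  have h2 := sin_sq_add_cos_sq β
  linear_combination ρ ^ 2 * h2 - 2 * ρ * h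

lemma norm_one_sub_circleMap_ge {ρ β : ℝ} (h0 : 1 / 2 ≤ ρ) (hβ : |β| ≤ π) :
    (|β| + (1 - ρ)) / 4 ≤ ‖1 - circleMap 0 ρ β‖ := by
  have hs : |β| / π ≤ |sin (β / 2)| := by
    have h3 := mul_abs_le_abs_sin (x := β / 2) (by rw [abs_div, abs_two]; linarith)
    calc |β| / π = 2 / π * |β / 2| := by rw [abs_div, abs_two]; ring
      _ ≤ _ := h3
  have h4 : (|β| / 4) ^ 2 ≤ sin (β / 2) ^ 2 := by
    rw [← sq_abs (sin _)]
    refine pow_le_pow_left₀ (by positivity) (le_trans ?_ hs) 2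
    exact div_le_div_of_nonneg_left (abs_nonneg _) pi_pos pi_le_four
  refine le_of_sq_le_sq ?_ (norm_nonneg _)
  rw [sq_norm_one_sub_circleMap]
  nlinarith [sq_nonneg (|β| - (1 - ρ))]

lemma norm_one_sub_circleMap_le {ρ β : ℝ} (h1 : ρ < 1) :
    ‖1 - circleMap 0 ρ β‖ ≤ |β| + (1 - ρ) := by
  have h4 : sin (β / 2) ^ 2 ≤ (β / 2) ^ 2 := by
    rw [← sq_abs (sin _), ← sq_abs (β / 2)]
    exact pow_le_pow_left₀ (abs_nonneg _) abs_sin_le_abs 2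
  refine le_of_sq_le_sq ?_ (by have := abs_nonneg β; linarith)
  rw [sq_norm_one_sub_circleMap]
  nlinarith [abs_nonneg β, sq_abs β, sq_nonneg β, mul_nonneg (abs_nonneg β) (sub_nonneg.2 h1.le)]

lemma norm_qf_circleMap_abs (u ρ φ : ℝ) :
    ‖qf u (circleMap 0 ρ φ)‖ = ‖qf u (circleMap 0 ρ |φ|)‖ := by
  rcases abs_choice φ with h | h
  · rw [h]
  · have : circleMap 0 ρ |φ| = starRingEnd ℂ (circleMap 0 ρ φ) := by
      rw [h, circleMap_zero, circleMap_zero, map_mul, Complex.conj_ofReal, ← Complex.exp_conj]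
      simp
    rw [this, qf_conj, Complex.norm_conj]

lemma norm_one_sub_sq_circleMap_abs (ρ φ : ℝ) :
    ‖1 - circleMap 0 ρ φ ^ 2‖ = ‖1 - circleMap 0 ρ |φ| ^ 2‖ := by
  rcases abs_choice φ with h | h
  · rw [h]
  · have : circleMap 0 ρ |φ| = starRingEnd ℂ (circleMap 0 ρ φ) := by
      rw [h, circleMap_zero, circleMap_zero, map_mul, Complex.conj_ofReal, ← Complex.exp_conj]
      simp
    rw [this, ← Complex.norm_conj]
    simp

lemma qf_cos_circleMap_ge {ρ φ θ : ℝ} (h0 : 1 / 2 ≤ ρ) (h1 : ρ < 1) (hφ : |φ| ≤ π)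
    (hθ : θ ∈ Set.Icc 0 π) :
    ‖1 - circleMap 0 ρ φ ^ 2‖ * (|(|φ| - θ)| + (1 - ρ)) / 16 ≤ ‖qf (cos θ) (circleMap 0 ρ φ)‖ ∧
    (|(|φ| - θ)| + (1 - ρ)) ^ 2 / 16 ≤ ‖qf (cos θ) (circleMap 0 ρ φ)‖ := by
  rw [norm_qf_circleMap_abs, norm_one_sub_sq_circleMap_abs]
  have hα := abs_nonneg φ
  set α := |φ|
  have hP : circleMap 0 ρ α * Complex.exp (θ * Complex.I) = circleMap 0 ρ (α + θ) := by
    rw [circleMap_zero, circleMap_zero, mul_assoc, ← Complex.exp_add]; push_cast; ring_nf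
  have hQ : circleMap 0 ρ α * Complex.exp (-θ * Complex.I) = circleMap 0 ρ (α - θ) := by
    rw [circleMap_zero, circleMap_zero, mul_assoc, ← Complex.exp_add]; push_cast; ring_nf
  have hPQ : circleMap 0 ρ (α + θ) * circleMap 0 ρ (α - θ) = circleMap 0 ρ α ^ 2 := by
    rw [circleMap_zero, circleMap_zero, circleMap_zero, mul_mul_mul_comm, ← Complex.exp_add,
      mul_pow, ← Complex.exp_nat_mul]
    push_cast; ring_nf
  rw [qf_cos, hP, hQ, norm_mul]
  have hQa : (|α - θ| + (1 - ρ)) / 4 ≤ ‖1 - circleMap 0 ρ (α - θ)‖ :=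
    norm_one_sub_circleMap_ge h0 (abs_le.2 ⟨by linarith [hθ.2], by linarith [hθ.1]⟩)
  have hQP : ‖1 - circleMap 0 ρ (α - θ)‖ ≤ ‖1 - circleMap 0 ρ (α + θ)‖ := by
    refine le_of_sq_le_sq ?_ (norm_nonneg _)
    rw [sq_norm_one_sub_circleMap, sq_norm_one_sub_circleMap]
    have e1 : sin ((α + θ) / 2) ^ 2 = sin ((α - θ) / 2) ^ 2 + sin α * sin θ := by
      have c1 := cos_two_mul ((α + θ) / 2)
      have c2 := cos_two_mul ((α - θ) / 2)
      rw [mul_div_cancel₀ _ (two_ne_zero), cos_sq', cos_add] at c1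
      rw [mul_div_cancel₀ _ (two_ne_zero), cos_sq', cos_sub] at c2
      linarith
    have e2 : 0 ≤ sin α * sin θ := mul_nonneg (sin_nonneg_of_nonneg_of_le_pi hα hφ)
      (sin_nonneg_of_nonneg_of_le_pi hθ.1 hθ.2)
    rw [e1]
    nlinarith
  have hψ : ‖1 - circleMap 0 ρ α ^ 2‖ ≤ ‖1 - circleMap 0 ρ (α + θ)‖ +
      ‖1 - circleMap 0 ρ (α - θ)‖ := by
    have e3 : 1 - circleMap 0 ρ α ^ 2 = (1 - circleMap 0 ρ (α + θ)) +
        circleMap 0 ρ (α + θ) * (1 - circleMap 0 ρ (α - θ)) := by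
      rw [← hPQ]; ring
    rw [e3]
    refine (norm_add_le _ _).trans ?_
    rw [norm_mul, norm_circleMap_zero' (by linarith)]
    nlinarith [norm_nonneg (1 - circleMap 0 ρ (α - θ))]
  set P := ‖1 - circleMap 0 ρ (α + θ)‖
  set Q := ‖1 - circleMap 0 ρ (α - θ)‖
  have ha : 0 ≤ |α - θ| + (1 - ρ) := by have := abs_nonneg (α - θ); linarith
  set a := |α - θ| + (1 - ρ)
  have hQ0 : 0 ≤ Q := norm_nonneg _
  constructor
  · nlinarith [mul_le_mul_of_nonneg_left hQa (hQ0.trans hQP)]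
  · nlinarith [mul_le_mul hQa (hQa.trans hQP) (by linarith) hQ0]

lemma le_norm_one_sub_sq_circleMap {ρ : ℝ} (h0 : 0 < ρ) (h1 : ρ < 1) (φ : ℝ) :
    1 - ρ ≤ ‖1 - circleMap 0 ρ φ ^ 2‖ := by
  have := norm_sub_norm_le (1 : ℂ) (circleMap 0 ρ φ ^ 2)
  rw [norm_one, norm_pow, norm_circleMap_zero' h0] at this
  nlinarith

/-- The near-diagonal integral of a power strictly below `-1`. -/
lemma exists_lintegral_abs_add_rpow_le {q : ℝ} (hq : 0 < q) :
    ∃ C > 0, ∀ α ε : ℝ, 0 < ε → ∫⁻ θ in Set.Ioo 0 π, ENNReal.ofReal ((|α - θ| + ε) ^ (-1 - q)) ≤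
      ENNReal.ofReal (C * ε ^ (-q)) := by
  have hInt : Integrable (fun s : ℝ => (1 + ‖s‖) ^ (-(1 + q))) :=
    integrable_one_add_norm (by simp; exact hq)
  refine ⟨(∫ s : ℝ, (1 + ‖s‖) ^ (-(1 + q))) + 1, ?_, fun α ε hε => ?_⟩
  · have : 0 ≤ ∫ s : ℝ, (1 + ‖s‖) ^ (-(1 + q)) := integral_nonneg fun s => by positivity
    linarith
  · have h1 : ∀ θ : ℝ, (|θ - α| + ε) ^ (-1 - q) =
        ε ^ (-1 - q) * (1 + ‖ε⁻¹ * (θ - α)‖) ^ (-(1 + q)) := by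
      intro θ
      rw [show -(1 + q) = -1 - q by ring, ← mul_rpow hε.le (by positivity), norm_mul, norm_inv,
        norm_of_nonneg hε.le, norm_eq_abs]
      congr 1
      field_simp
      ring
    have hint2 : Integrable (fun s : ℝ => ε ^ (-1 - q) * (1 + ‖ε⁻¹ * s‖) ^ (-(1 + q))) :=
      (hInt.comp_mul_left' (inv_ne_zero hε.ne')).const_mul _
    calc ∫⁻ θ in Set.Ioo 0 π, ENNReal.ofReal ((|α - θ| + ε) ^ (-1 - q))
        ≤ ∫⁻ θ : ℝ, ENNReal.ofReal ((|α - θ| + ε) ^ (-1 - q)) := setLIntegral_le_lintegral _ _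
      _ = ∫⁻ θ : ℝ, ENNReal.ofReal (ε ^ (-1 - q) * (1 + ‖ε⁻¹ * (θ - α)‖) ^ (-(1 + q))) := by
          simp only [abs_sub_comm α, h1]
      _ = ∫⁻ θ : ℝ, ENNReal.ofReal (ε ^ (-1 - q) * (1 + ‖ε⁻¹ * θ‖) ^ (-(1 + q))) :=
          lintegral_sub_right_eq_self
            (fun θ : ℝ => ENNReal.ofReal (ε ^ (-1 - q) * (1 + ‖ε⁻¹ * θ‖) ^ (-(1 + q)))) α
      _ = ENNReal.ofReal (∫ θ : ℝ, ε ^ (-1 - q) * (1 + ‖ε⁻¹ * θ‖) ^ (-(1 + q))) := by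
          rw [ofReal_integral_eq_lintegral_ofReal hint2]
          exact Filter.Eventually.of_forall fun s => by positivity
      _ ≤ _ := by
          refine ENNReal.ofReal_le_ofReal ?_
          rw [integral_const_mul, Measure.integral_comp_mul_left
            (fun s : ℝ => (1 + ‖s‖) ^ (-(1 + q))), inv_inv, abs_of_pos hε, smul_eq_mul,
            ← mul_assoc, ← rpow_add_one hε.ne', show -1 - q + 1 = -q by ring, mul_comm]
          have : 0 < ε ^ (-q) := by positivity
          nlinarith

lemma exists_zmaj_mul_sin_le {d : ℕ} (hd : 1 ≤ d) {τ : ℝ} (hτ : 0 < τ) :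
    ∃ C > 0, ∀ ρ φ θ : ℝ, 1 / 2 ≤ ρ → ρ < 1 → |φ| ≤ π → θ ∈ Set.Icc 0 π →
      sin θ ^ (d - 1) * zmaj d τ (cos θ) (circleMap 0 ρ φ) ≤
        C * (‖qf (cos θ) (circleMap 0 ρ φ)‖⁻¹ +
          ‖1 - circleMap 0 ρ φ ^ 2‖ ^ (2 * (τ + ((d : ℝ) - 1) / 2)) *
            ‖qf (cos θ) (circleMap 0 ρ φ)‖ ^ (-1 - (τ + ((d : ℝ) - 1) / 2))) := by
  have hd1 : (0 : ℝ) ≤ (d : ℝ) - 1 := by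
    have : (1 : ℝ) ≤ d := by exact_mod_cast hd
    linarith
  set σ := τ + ((d : ℝ) - 1) / 2 with hσ
  have hσ0 : 0 < σ := by linarith
  refine ⟨9 ^ (((d : ℝ) - 1) / 2) * 2 ^ σ, by positivity, fun ρ φ θ h0 h1 hφ hθ => ?_⟩
  have hρ : 0 < ρ := by linarith
  have hn := norm_circleMap_zero' hρ φ
  set r := circleMap 0 ρ φ
  have hE : 0 < ‖qf (cos θ) r‖ := norm_pos_iff.2 (qf_ne_zero (abs_cos_le_one θ) (by rw [hn]; exact h1))
  have h2 := one_sub_sq_le (abs_cos_le_one θ) (by rw [hn]; exact h0) (by rw [hn]; exact h1)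
  unfold zmaj
  set E := ‖qf (cos θ) r‖
  have hψ0 : 0 < ‖1 - r ^ 2‖ := lt_of_lt_of_le (by linarith) (le_norm_one_sub_sq_circleMap hρ h1 φ)
  set ψ := ‖1 - r ^ 2‖
  have hz : 0 < ψ ^ 2 / E := by positivity
  have hsin : sin θ ^ 2 ≤ 9 * (E * (1 + ψ ^ 2 / E)) := by
    have : E * (1 + ψ ^ 2 / E) = E + ψ ^ 2 := by field_simp
    rw [this, sin_sq]
    nlinarith [sq_nonneg ψ]
  set z := ψ ^ 2 / E with hzdef
  have hs0 := sin_nonneg_of_nonneg_of_le_pi hθ.1 hθ.2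
  have h3 : sin θ ^ (d - 1) ≤ 9 ^ (((d : ℝ) - 1) / 2) * (E ^ (((d : ℝ) - 1) / 2) *
      (1 + z) ^ (((d : ℝ) - 1) / 2)) := by
    rw [← mul_rpow hE.le (by linarith), ← mul_rpow (by norm_num) (by positivity)]
    calc sin θ ^ (d - 1) = (sin θ ^ 2) ^ (((d : ℝ) - 1) / 2) := by
          rw [← rpow_natCast_mul hs0, ← rpow_natCast, Nat.cast_sub hd]
          push_cast; ring_nf
      _ ≤ _ := rpow_le_rpow (sq_nonneg _) hsin (by linarith)
  have h4 : (1 + z) ^ σ ≤ 2 ^ σ * (1 + z ^ σ) := by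
    have hzs : 0 < z ^ σ := by positivity
    rcases le_total z 1 with h | h
    · calc (1 + z) ^ σ ≤ 2 ^ σ := rpow_le_rpow (by linarith) (by linarith) hσ0.le
        _ ≤ _ := le_mul_of_one_le_right (by positivity) (by linarith)
    · calc (1 + z) ^ σ ≤ (2 * z) ^ σ := rpow_le_rpow (by linarith) (by linarith) hσ0.le
        _ = 2 ^ σ * z ^ σ := mul_rpow (by norm_num) hz.le
        _ ≤ _ := by gcongr; linarith
  have h5 : E ^ (((d : ℝ) - 1) / 2) * E ^ (-(((d : ℝ) + 1) / 2)) = E⁻¹ := by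
    rw [← rpow_add hE, show ((d : ℝ) - 1) / 2 + -(((d : ℝ) + 1) / 2) = -1 by ring, rpow_neg_one]
  have h6 : (1 + z) ^ (((d : ℝ) - 1) / 2) * (1 + z) ^ τ = (1 + z) ^ σ := by
    rw [← rpow_add (by linarith), hσ, add_comm (((d : ℝ) - 1) / 2)]
  have h7 : E⁻¹ * z ^ σ = ψ ^ (2 * σ) * E ^ (-1 - σ) := by
    rw [hzdef, div_rpow (by positivity) hE.le, rpow_sub hE, rpow_neg_one, rpow_mul hψ0.le,
      rpow_two]
    field_simp
  calc _ ≤ 9 ^ (((d : ℝ) - 1) / 2) * (E ^ (((d : ℝ) - 1) / 2) * (1 + z) ^ (((d : ℝ) - 1) / 2)) *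
        (E ^ (-(((d : ℝ) + 1) / 2)) * (1 + z) ^ τ) := by gcongr
    _ = 9 ^ (((d : ℝ) - 1) / 2) * ((E ^ (((d : ℝ) - 1) / 2) * E ^ (-(((d : ℝ) + 1) / 2))) *
        ((1 + z) ^ (((d : ℝ) - 1) / 2) * (1 + z) ^ τ)) := by ring
    _ = 9 ^ (((d : ℝ) - 1) / 2) * (E⁻¹ * (1 + z) ^ σ) := by rw [h5, h6]
    _ ≤ 9 ^ (((d : ℝ) - 1) / 2) * (E⁻¹ * (2 ^ σ * (1 + z ^ σ))) := by gcongr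
    _ = _ := by rw [← h7]; ring

lemma exists_lintegral_zmaj_le {d : ℕ} (hd : 1 ≤ d) {τ : ℝ} (hτ : 0 < τ) :
    ∃ C > 0, ∀ ρ φ : ℝ, 1 / 2 ≤ ρ → ρ < 1 → |φ| ≤ π →
      ∫⁻ θ in Set.Ioo 0 π, ENNReal.ofReal (sin θ ^ (d - 1)) *
        ENNReal.ofReal (zmaj d τ (cos θ) (circleMap 0 ρ φ)) ≤
      ENNReal.ofReal (C * ((1 - ρ) ^ (-(τ + ((d : ℝ) - 1) / 2)) *
        ‖1 - circleMap 0 ρ φ ^ 2‖ ^ (τ + ((d : ℝ) - 1) / 2 - 1))) := by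
  have hd1 : (0 : ℝ) ≤ (d : ℝ) - 1 := by
    have : (1 : ℝ) ≤ d := by exact_mod_cast hd
    linarith
  obtain ⟨C₀, hC₀, hz⟩ := exists_zmaj_mul_sin_le hd hτ
  set σ := τ + ((d : ℝ) - 1) / 2 with hσ
  have hσ0 : 0 < σ := by linarith
  set η := min σ 1 with hη
  have hη0 : 0 < η := lt_min hσ0 one_pos
  have hη1 : η ≤ 1 := min_le_right _ _
  have hησ : η ≤ σ := min_le_left _ _
  obtain ⟨C₁, hC₁, h1⟩ := exists_lintegral_abs_add_rpow_le hσ0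
  obtain ⟨C₂, hC₂, h2⟩ := exists_lintegral_abs_add_rpow_le hη0
  refine ⟨C₀ * (16 * C₂ + 16 ^ (1 + σ) * C₁), by positivity, fun ρ φ h0 h1' hφ => ?_⟩
  have hρ : 0 < ρ := by linarith
  have hn := norm_circleMap_zero' hρ φ
  have hψε := le_norm_one_sub_sq_circleMap hρ h1' φ
  have hε : 0 < 1 - ρ := by linarith
  have hge := fun θ => qf_cos_circleMap_ge (θ := θ) h0 h1' hφ
  have hzz := fun θ => hz ρ φ θ h0 h1' hφ
  set r := circleMap 0 ρ φ
  have hψ0 : 0 < ‖1 - r ^ 2‖ := lt_of_lt_of_le hε hψε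
  set ψ := ‖1 - r ^ 2‖
  have hpt : ∀ θ ∈ Set.Ioo (0 : ℝ) π, ENNReal.ofReal (sin θ ^ (d - 1)) *
        ENNReal.ofReal (zmaj d τ (cos θ) r) ≤
      ENNReal.ofReal (C₀ * 16 * ψ ^ (η - 1)) *
        ENNReal.ofReal ((|(|φ| - θ)| + (1 - ρ)) ^ (-1 - η)) +
      ENNReal.ofReal (C₀ * 16 ^ (1 + σ) * ψ ^ (σ - 1)) *
        ENNReal.ofReal ((|(|φ| - θ)| + (1 - ρ)) ^ (-1 - σ)) := by
    intro θ hθ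
    have hθ' := Set.Ioo_subset_Icc_self hθ
    have hs0 := sin_nonneg_of_nonneg_of_le_pi hθ'.1 hθ'.2
    have hE : 0 < ‖qf (cos θ) r‖ :=
      norm_pos_iff.2 (qf_ne_zero (abs_cos_le_one θ) (by rw [hn]; exact h1'))
    obtain ⟨hg1, hg2⟩ := hge θ hθ'
    have hzθ := hzz θ hθ'
    have ha : 0 < |(|φ| - θ)| + (1 - ρ) := by positivity
    set a := |(|φ| - θ)| + (1 - ρ)
    set E := ‖qf (cos θ) r‖
    rw [← ENNReal.ofReal_mul (by positivity), ← ENNReal.ofReal_mul (by positivity),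
      ← ENNReal.ofReal_mul (by positivity), ← ENNReal.ofReal_add (by positivity) (by positivity)]
    refine ENNReal.ofReal_le_ofReal (hzθ.trans ?_)
    have e1 : E⁻¹ ≤ 16 * ψ ^ (η - 1) * a ^ (-1 - η) := by
      have : ψ ^ (1 - η) * a ^ (1 + η) / 16 ≤ E := by
        calc ψ ^ (1 - η) * a ^ (1 + η) / 16 = (ψ * a / 16) ^ (1 - η) * (a ^ 2 / 16) ^ η := by
              rw [div_rpow (by positivity) (by norm_num), div_rpow (by positivity) (by norm_num),
                mul_rpow hψ0.le ha.le, ← rpow_natCast, ← rpow_mul ha.le]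
              have t1 : a ^ (1 + η) = a ^ (1 - η) * a ^ (((2 : ℕ) : ℝ) * η) := by
                rw [← rpow_add ha]; congr 1; push_cast; ring
              have t2 : (16 : ℝ) = 16 ^ (1 - η) * 16 ^ η := by
                rw [← rpow_add (by norm_num)]; simp
              rw [t1, div_mul_div_comm, ← t2]
              ring
          _ ≤ E ^ (1 - η) * E ^ η := by gcongr
          _ = E := by rw [← rpow_add hE]; simp
      calc E⁻¹ ≤ (ψ ^ (1 - η) * a ^ (1 + η) / 16)⁻¹ := by
            exact inv_anti₀ (by positivity) this
        _ = _ := by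
          rw [show η - 1 = -(1 - η) by ring, show -1 - η = -(1 + η) by ring, rpow_neg hψ0.le,
            rpow_neg ha.le]
          field_simp
    have e2 : ψ ^ (2 * σ) * E ^ (-1 - σ) ≤ 16 ^ (1 + σ) * ψ ^ (σ - 1) * a ^ (-1 - σ) := by
      calc ψ ^ (2 * σ) * E ^ (-1 - σ) ≤ ψ ^ (2 * σ) * (ψ * a / 16) ^ (-1 - σ) := by
            gcongr ?_ * ?_
            exact rpow_le_rpow_of_nonpos (by positivity) hg1 (by linarith)
        _ = _ := by
          rw [div_rpow (by positivity) (by norm_num), mul_rpow hψ0.le ha.le,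
            show σ - 1 = 2 * σ + (-1 - σ) by ring, rpow_add hψ0,
            show 1 + σ = -(-1 - σ) by ring, rpow_neg (by norm_num)]
          field_simp
    calc _ ≤ C₀ * (16 * ψ ^ (η - 1) * a ^ (-1 - η) +
          16 ^ (1 + σ) * ψ ^ (σ - 1) * a ^ (-1 - σ)) := by gcongr
      _ = _ := by ring
  have e3 : (1 - ρ) ^ (-η) * ψ ^ (η - 1) ≤ (1 - ρ) ^ (-σ) * ψ ^ (σ - 1) := by
    have : (1 - ρ) ^ (σ - η) ≤ ψ ^ (σ - η) := rpow_le_rpow hε.le hψε (by linarith)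
    rw [show -η = -σ + (σ - η) by ring, rpow_add hε,
      show σ - 1 = (σ - η) + (η - 1) by ring, rpow_add hψ0, mul_assoc]
    gcongr
  calc _ ≤ ∫⁻ θ in Set.Ioo 0 π, (ENNReal.ofReal (C₀ * 16 * ψ ^ (η - 1)) *
        ENNReal.ofReal ((|(|φ| - θ)| + (1 - ρ)) ^ (-1 - η)) +
      ENNReal.ofReal (C₀ * 16 ^ (1 + σ) * ψ ^ (σ - 1)) *
        ENNReal.ofReal ((|(|φ| - θ)| + (1 - ρ)) ^ (-1 - σ))) :=
        setLIntegral_mono (by fun_prop) hpt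
    _ = ENNReal.ofReal (C₀ * 16 * ψ ^ (η - 1)) *
        (∫⁻ θ in Set.Ioo 0 π, ENNReal.ofReal ((|(|φ| - θ)| + (1 - ρ)) ^ (-1 - η))) +
      ENNReal.ofReal (C₀ * 16 ^ (1 + σ) * ψ ^ (σ - 1)) *
        ∫⁻ θ in Set.Ioo 0 π, ENNReal.ofReal ((|(|φ| - θ)| + (1 - ρ)) ^ (-1 - σ)) := by
        rw [lintegral_add_left (by fun_prop), lintegral_const_mul _ (by fun_prop),
          lintegral_const_mul _ (by fun_prop)]
    _ ≤ ENNReal.ofReal (C₀ * 16 * ψ ^ (η - 1)) * ENNReal.ofReal (C₂ * (1 - ρ) ^ (-η)) +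
      ENNReal.ofReal (C₀ * 16 ^ (1 + σ) * ψ ^ (σ - 1)) *
        ENNReal.ofReal (C₁ * (1 - ρ) ^ (-σ)) := by
        gcongr
        · exact h2 _ _ hε
        · exact h1 _ _ hε
    _ ≤ _ := by
        rw [← ENNReal.ofReal_mul (by positivity), ← ENNReal.ofReal_mul (by positivity),
          ← ENNReal.ofReal_add (by positivity) (by positivity)]
        refine ENNReal.ofReal_le_ofReal ?_
        calc _ = C₀ * 16 * C₂ * ((1 - ρ) ^ (-η) * ψ ^ (η - 1)) +
              C₀ * 16 ^ (1 + σ) * C₁ * ((1 - ρ) ^ (-σ) * ψ ^ (σ - 1)) := by ring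
          _ ≤ C₀ * 16 * C₂ * ((1 - ρ) ^ (-σ) * ψ ^ (σ - 1)) +
              C₀ * 16 ^ (1 + σ) * C₁ * ((1 - ρ) ^ (-σ) * ψ ^ (σ - 1)) := by gcongr
          _ = _ := by ring

lemma hsq_nonneg {m : ℕ} (κ : Fin m → ℝ) (y : EuclideanSpace ℝ (Fin m)) : 0 ≤ hsq κ y :=
  prod_nonneg fun _ _ => by positivity

lemma zmaj_nonneg (d : ℕ) (τ u : ℝ) (r : ℂ) : 0 ≤ zmaj d τ u r := by
  unfold zmaj; positivity

lemma ae_circleMap_im_ne_zero {ρ : ℝ} (h0 : 0 < ρ) :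
    ∀ᵐ φ ∂(volume.restrict (Set.Ioc (-π) π)), (circleMap 0 ρ φ).im ≠ 0 := by
  have hnull : ∀ᵐ φ : ℝ, φ ∉ ({0, π} : Set ℝ) :=
    (Set.toFinite ({0, π} : Set ℝ)).measure_zero volume |> measure_eq_zero_iff_ae_notMem.1
  filter_upwards [ae_restrict_of_ae hnull, ae_restrict_mem measurableSet_Ioc] with φ h1 h2
  simp only [Set.mem_insert_iff, Set.mem_singleton_iff, not_or] at h1
  have him : (circleMap 0 ρ φ).im = ρ * sin φ := by
    rw [circleMap_zero]; simp [Complex.exp_ofReal_mul_I_im]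
  rw [him]
  refine mul_ne_zero h0.ne' ?_
  rw [Ne, sin_eq_zero_iff_of_lt_of_lt]
  · exact h1.1
  · exact h2.1
  · exact lt_of_le_of_ne h2.2 h1.2

lemma exists_hK_mul_hsq_le {d : ℕ} (hd : 1 ≤ d) {κ : Fin (d + 1) → ℝ} (hκ : ∀ i, 0 < κ i)
    {τ : ℝ} (hτ : ∀ j, ∑ i, κ i - κ j ≤ τ) :
    ∃ C > 0, ∀ δ ρ : ℝ, 1 / 2 ≤ ρ → ρ < 1 → ∀ n : ℕ, ∀ x y : EuclideanSpace ℝ (Fin (d + 1)),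
      ‖x‖ = 1 → ‖y‖ = 1 → ENNReal.ofReal (|hK d κ δ n x y| * hsq κ y) ≤
        ENNReal.ofReal (C * |(cesA δ n)⁻¹| * (ρ ^ n)⁻¹) * ∫⁻ φ in Set.Ioc (-π) π,
          ∑ e : Fin (d + 1) → Bool, ENNReal.ofReal (‖1 - circleMap 0 ρ φ‖ ^ (-(δ + 1)) *
            ‖1 - circleMap 0 ρ φ ^ 2‖) *
            ENNReal.ofReal (zmaj d τ (inner ℝ (reflect e x) y) (circleMap 0 ρ φ)) := by
  have hl := lamK_pos hd hκ
  have hd1 : (1 : ℝ) ≤ d := by exact_mod_cast hd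
  obtain ⟨C₀, hC₀, hG⟩ := exists_norm_cubeG_le hκ (p := lamK d κ + 1)
    (by rw [lamK_add_one]; linarith)
  set W := |(∫ t in cube (d + 1), wprod κ t)⁻¹ * (2 * π)⁻¹| with hW
  set C₁ := ((d : ℝ) + 1) ^ (∑ i, κ i) * 36 ^ τ with hC₁
  have hC₁0 : 0 < C₁ := by positivity
  refine ⟨(W + 1) * (C₀ * C₁), by positivity, fun δ ρ h0 h1 n x y hx hy => ?_⟩
  have hρ : 0 < ρ := by linarith
  have hb := sum_abs_mul_le_one hx hy
  set A : ℝ → ℝ := fun φ => ‖1 - circleMap 0 ρ φ‖ ^ (-(δ + 1)) * ‖1 - circleMap 0 ρ φ ^ 2‖ with hA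
  have hA0 : ∀ φ, 0 ≤ A φ := fun φ => by positivity
  set I := ∫ φ in (-π)..π, (((circleMap 0 ρ φ) ^ n)⁻¹ *
          ((1 - circleMap 0 ρ φ) ^ (-((δ + 1 : ℝ) : ℂ)) * (1 - circleMap 0 ρ φ ^ 2))) *
          cubeG κ (fun i => x i * y i) (lamK d κ + 1) (circleMap 0 ρ φ) with hI
  have habs : |hK d κ δ n x y| = |(cesA δ n)⁻¹| * W * ‖I‖ := by
    have h := congrArg norm (hK_eq_integral hκ hl δ hx hy hρ h1 n)
    rw [Complex.norm_real, norm_eq_abs, ← hI] at h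
    have e : (cesA δ n : ℂ)⁻¹ * (((∫ t in cube (d + 1), wprod κ t : ℝ) : ℂ)⁻¹ * (2 * π : ℂ)⁻¹ * I) =
        (((cesA δ n)⁻¹ * ((∫ t in cube (d + 1), wprod κ t)⁻¹ * (2 * π)⁻¹) : ℝ) : ℂ) * I := by
      push_cast; ring
    rw [h, e, norm_mul, Complex.norm_real, norm_eq_abs, abs_mul]
  have hIle : ENNReal.ofReal ‖I‖ ≤ ∫⁻ φ in Set.Ioc (-π) π, ENNReal.ofReal ((ρ ^ n)⁻¹ * (A φ *
      ‖cubeG κ (fun i => x i * y i) (lamK d κ + 1) (circleMap 0 ρ φ)‖)) := by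
    rw [hI, intervalIntegral.integral_of_le (by linarith [pi_pos]), ofReal_norm]
    refine (enorm_integral_le_lintegral_enorm _).trans (le_of_eq ?_)
    refine lintegral_congr fun φ => ?_
    rw [← ofReal_norm, norm_mul, norm_mul, norm_mul, norm_inv, norm_pow, norm_circleMap_zero' hρ,
      ← Complex.ofReal_neg, Complex.norm_cpow_real, mul_assoc]
  have hpt : ∀ᵐ φ ∂(volume.restrict (Set.Ioc (-π) π)), ENNReal.ofReal ((ρ ^ n)⁻¹ * (A φ *
      ‖cubeG κ (fun i => x i * y i) (lamK d κ + 1) (circleMap 0 ρ φ)‖)) * ENNReal.ofReal (hsq κ y) ≤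
      ENNReal.ofReal (C₀ * C₁ * (ρ ^ n)⁻¹) * ∑ e : Fin (d + 1) → Bool, ENNReal.ofReal (A φ) *
        ENNReal.ofReal (zmaj d τ (inner ℝ (reflect e x) y) (circleMap 0 ρ φ)) := by
    filter_upwards [ae_circleMap_im_ne_zero hρ] with φ him
    have hn := norm_circleMap_zero' hρ φ
    have h3 := hG _ hb _ (by rw [hn]; exact h0) (by rw [hn]; exact h1) him
    have h4 := fun e => vertexTerm_mul_hsq_le hκ hx hy e (r := circleMap 0 ρ φ)
      (by rw [hn]; exact h0) (by rw [hn]; exact h1) hτ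
    simp only [← ENNReal.ofReal_mul (hA0 φ)]
    rw [← ENNReal.ofReal_sum_of_nonneg (fun e _ => mul_nonneg (hA0 φ) (zmaj_nonneg _ _ _ _)),
      ← ENNReal.ofReal_mul (by positivity), ← ENNReal.ofReal_mul (by have := hA0 φ; positivity)]
    refine ENNReal.ofReal_le_ofReal ?_
    have h5 : ‖cubeG κ (fun i => x i * y i) (lamK d κ + 1) (circleMap 0 ρ φ)‖ * hsq κ y ≤
        C₀ * C₁ * ∑ e : Fin (d + 1) → Bool,
          zmaj d τ (inner ℝ (reflect e x) y) (circleMap 0 ρ φ) := by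
      calc _ ≤ (C₀ * ∑ e : Fin (d + 1) → Bool, vertexTerm κ (fun i => x i * y i) (lamK d κ + 1)
              ‖qf (sgForm e fun i => x i * y i) (circleMap 0 ρ φ)‖) * hsq κ y :=
            mul_le_mul_of_nonneg_right h3 (hsq_nonneg _ _)
        _ = C₀ * ∑ e : Fin (d + 1) → Bool, vertexTerm κ (fun i => x i * y i) (lamK d κ + 1)
              ‖qf (sgForm e fun i => x i * y i) (circleMap 0 ρ φ)‖ * hsq κ y := by
            rw [mul_assoc, sum_mul]
        _ ≤ C₀ * ∑ e : Fin (d + 1) → Bool, C₁ *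
              zmaj d τ (inner ℝ (reflect e x) y) (circleMap 0 ρ φ) := by
            refine mul_le_mul_of_nonneg_left (sum_le_sum fun e _ => ?_) hC₀.le
            rw [inner_reflect]
            exact h4 e
        _ = _ := by rw [← mul_sum]; ring
    calc _ = (ρ ^ n)⁻¹ * A φ *
          (‖cubeG κ (fun i => x i * y i) (lamK d κ + 1) (circleMap 0 ρ φ)‖ * hsq κ y) := by ring
      _ ≤ (ρ ^ n)⁻¹ * A φ * (C₀ * C₁ * ∑ e : Fin (d + 1) → Bool,
          zmaj d τ (inner ℝ (reflect e x) y) (circleMap 0 ρ φ)) :=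
          mul_le_mul_of_nonneg_left h5 (by have := hA0 φ; positivity)
      _ = _ := by rw [← mul_sum]; ring
  rw [habs, ENNReal.ofReal_mul (by positivity), ENNReal.ofReal_mul (by positivity)]
  calc _ ≤ ENNReal.ofReal (|(cesA δ n)⁻¹| * W) * (∫⁻ φ in Set.Ioc (-π) π,
        ENNReal.ofReal ((ρ ^ n)⁻¹ * (A φ *
      ‖cubeG κ (fun i => x i * y i) (lamK d κ + 1) (circleMap 0 ρ φ)‖))) *
        ENNReal.ofReal (hsq κ y) := by gcongr
    _ = ENNReal.ofReal (|(cesA δ n)⁻¹| * W) * ∫⁻ φ in Set.Ioc (-π) π,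
        ENNReal.ofReal ((ρ ^ n)⁻¹ * (A φ *
      ‖cubeG κ (fun i => x i * y i) (lamK d κ + 1) (circleMap 0 ρ φ)‖)) *
        ENNReal.ofReal (hsq κ y) := by
        rw [mul_assoc, lintegral_mul_const' _ _ ENNReal.ofReal_ne_top]
    _ ≤ ENNReal.ofReal (|(cesA δ n)⁻¹| * W) * ∫⁻ φ in Set.Ioc (-π) π,
        ENNReal.ofReal (C₀ * C₁ * (ρ ^ n)⁻¹) * ∑ e : Fin (d + 1) → Bool, ENNReal.ofReal (A φ) *
        ENNReal.ofReal (zmaj d τ (inner ℝ (reflect e x) y) (circleMap 0 ρ φ)) := by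
        gcongr 1
        exact lintegral_mono_ae hpt
    _ = ENNReal.ofReal (|(cesA δ n)⁻¹| * W * (C₀ * C₁ * (ρ ^ n)⁻¹)) * ∫⁻ φ in Set.Ioc (-π) π,
        ∑ e : Fin (d + 1) → Bool, ENNReal.ofReal (A φ) *
        ENNReal.ofReal (zmaj d τ (inner ℝ (reflect e x) y) (circleMap 0 ρ φ)) := by
        rw [lintegral_const_mul' _ _ ENNReal.ofReal_ne_top, ← mul_assoc,
          ← ENNReal.ofReal_mul (by positivity)]
    _ ≤ _ := by
        gcongr ENNReal.ofReal ?_ * _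
        have hc : 0 ≤ |(cesA δ n)⁻¹| * (C₀ * C₁ * (ρ ^ n)⁻¹) := by positivity
        nlinarith

lemma measurable_zmaj_comp {X : Type*} [MeasurableSpace X] (d : ℕ) (τ : ℝ) {u : X → ℝ} {r : X → ℂ}
    (hu : Measurable u) (hr : Measurable r) : Measurable fun z => zmaj d τ (u z) (r z) := by
  unfold zmaj qf
  have : Measurable fun z => (u z : ℂ) := Complex.measurable_ofReal.comp hu
  fun_prop

lemma exists_lintegral_hK_le {d : ℕ} (hd : 1 ≤ d) {κ : Fin (d + 1) → ℝ} (hκ : ∀ i, 0 < κ i)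
    {τ : ℝ} (hτ0 : 0 < τ) (hτ : ∀ j, ∑ i, κ i - κ j ≤ τ) :
    ∃ C > 0, ∀ δ ρ : ℝ, 1 / 2 ≤ ρ → ρ < 1 → ∀ n : ℕ, ∀ x : EuclideanSpace ℝ (Fin (d + 1)),
      ‖x‖ = 1 → ∫⁻ y, ENNReal.ofReal (|hK d κ δ n x y| * hsq κ y) ∂(sphereMeas d) ≤
        ENNReal.ofReal (C * |(cesA δ n)⁻¹| * (ρ ^ n)⁻¹ * (1 - ρ) ^ (-(τ + ((d : ℝ) - 1) / 2))) *
        ∫⁻ φ in Set.Ioc (-π) π, ENNReal.ofReal (‖1 - circleMap 0 ρ φ‖ ^ (-(δ + 1)) *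
            ‖1 - circleMap 0 ρ φ ^ 2‖ ^ (τ + ((d : ℝ) - 1) / 2)) := by
  obtain ⟨C₁, hC₁, h1⟩ := exists_hK_mul_hsq_le hd hκ hτ
  obtain ⟨C₂, hC₂, h2⟩ := exists_lintegral_zmaj_le hd hτ0
  set S := ((volume : Measure (EuclideanSpace ℝ (Fin d))).toSphere Set.univ).toReal with hS
  have hSe : (volume : Measure (EuclideanSpace ℝ (Fin d))).toSphere Set.univ = ENNReal.ofReal S :=
    (ENNReal.ofReal_toReal (measure_ne_top _ _)).symm
  have hS0 : 0 ≤ S := ENNReal.toReal_nonneg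
  set N := (Fintype.card (Fin (d + 1) → Bool) : ℝ) with hN
  refine ⟨C₁ * (N * ((S + 1) * C₂)), by
    have : 0 < N := by rw [hN]; exact_mod_cast Fintype.card_pos
    positivity, fun δ ρ h0 hρ1 n x hx => ?_⟩
  have hρ : 0 < ρ := by linarith
  have hε : 0 < 1 - ρ := by linarith
  set σ := τ + ((d : ℝ) - 1) / 2
  set A : ℝ → ℝ := fun φ => ‖1 - circleMap 0 ρ φ‖ ^ (-(δ + 1)) * ‖1 - circleMap 0 ρ φ ^ 2‖ with hA
  have hA0 : ∀ φ, 0 ≤ A φ := fun φ => by positivity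
  have hAm : Measurable A := by
    have := (continuous_circleMap 0 ρ).measurable
    fun_prop
  have hzm : ∀ e : Fin (d + 1) → Bool, Measurable
      fun p : Metric.sphere (0 : EuclideanSpace ℝ (Fin (d + 1))) 1 × ℝ =>
      zmaj d τ (inner ℝ (reflect e x) (p.1 : EuclideanSpace ℝ (Fin (d + 1)))) (circleMap 0 ρ p.2) := by
    intro e
    refine measurable_zmaj_comp d τ ?_ ?_
    · have : Continuous fun p : Metric.sphere (0 : EuclideanSpace ℝ (Fin (d + 1))) 1 × ℝ =>
        (inner ℝ (reflect e x) (p.1 : EuclideanSpace ℝ (Fin (d + 1))) : ℝ) := by fun_prop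
      exact this.measurable
    · exact ((continuous_circleMap 0 ρ).measurable).comp measurable_snd
  have hinner : ∀ φ ∈ Set.Ioc (-π) π, ∀ e : Fin (d + 1) → Bool,
      ∫⁻ y, ENNReal.ofReal (A φ) * ENNReal.ofReal (zmaj d τ (inner ℝ (reflect e x)
        (y : EuclideanSpace ℝ (Fin (d + 1)))) (circleMap 0 ρ φ)) ∂(sphereMeas d) ≤
      ENNReal.ofReal ((S + 1) * C₂ * (1 - ρ) ^ (-σ)) *
        ENNReal.ofReal (‖1 - circleMap 0 ρ φ‖ ^ (-(δ + 1)) * ‖1 - circleMap 0 ρ φ ^ 2‖ ^ σ) := by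
    intro φ hφ e
    have hψ : 0 < ‖1 - circleMap 0 ρ φ ^ 2‖ :=
      lt_of_lt_of_le hε (le_norm_one_sub_sq_circleMap hρ hρ1 φ)
    have hzu : Measurable fun u : ℝ => ENNReal.ofReal (zmaj d τ u (circleMap 0 ρ φ)) :=
      (measurable_zmaj_comp d τ measurable_id measurable_const).ennreal_ofReal
    rw [lintegral_const_mul' _ _ ENNReal.ofReal_ne_top,
      lintegral_zonal hd ((norm_reflect e x).trans hx) hzu, hSe]
    calc _ ≤ ENNReal.ofReal (A φ) * (ENNReal.ofReal S * ENNReal.ofReal (C₂ * ((1 - ρ) ^ (-σ) *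
          ‖1 - circleMap 0 ρ φ ^ 2‖ ^ (σ - 1)))) := by
          gcongr
          exact h2 ρ φ h0 hρ1 (abs_le.2 ⟨hφ.1.le, hφ.2⟩)
      _ = ENNReal.ofReal (S * C₂ * (1 - ρ) ^ (-σ) *
            (‖1 - circleMap 0 ρ φ‖ ^ (-(δ + 1)) * ‖1 - circleMap 0 ρ φ ^ 2‖ ^ σ)) := by
          rw [← ENNReal.ofReal_mul hS0, ← ENNReal.ofReal_mul (hA0 φ), hA]
          congr 1
          rw [show ‖1 - circleMap 0 ρ φ ^ 2‖ ^ σ = ‖1 - circleMap 0 ρ φ ^ 2‖ *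
            ‖1 - circleMap 0 ρ φ ^ 2‖ ^ (σ - 1) by
              rw [mul_comm, ← rpow_add_one hψ.ne', sub_add_cancel]]
          ring
      _ ≤ _ := by
          rw [← ENNReal.ofReal_mul (by positivity)]
          gcongr
          linarith
  calc ∫⁻ y, ENNReal.ofReal (|hK d κ δ n x y| * hsq κ y) ∂(sphereMeas d)
      ≤ ∫⁻ y, ENNReal.ofReal (C₁ * |(cesA δ n)⁻¹| * (ρ ^ n)⁻¹) * (∫⁻ φ in Set.Ioc (-π) π,
          ∑ e : Fin (d + 1) → Bool, ENNReal.ofReal (A φ) *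
            ENNReal.ofReal (zmaj d τ (inner ℝ (reflect e x) (y : EuclideanSpace ℝ (Fin (d + 1))))
              (circleMap 0 ρ φ))) ∂(sphereMeas d) :=
        lintegral_mono fun y => h1 δ ρ h0 hρ1 n x y hx (by simp)
    _ = ENNReal.ofReal (C₁ * |(cesA δ n)⁻¹| * (ρ ^ n)⁻¹) * ∫⁻ φ in Set.Ioc (-π) π,
          ∑ e : Fin (d + 1) → Bool, ∫⁻ y, ENNReal.ofReal (A φ) *
            ENNReal.ofReal (zmaj d τ (inner ℝ (reflect e x) (y : EuclideanSpace ℝ (Fin (d + 1))))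
              (circleMap 0 ρ φ)) ∂(sphereMeas d) := by
        rw [lintegral_const_mul' _ _ ENNReal.ofReal_ne_top]
        congr 1
        have : SFinite (sphereMeas d) := by unfold sphereMeas; infer_instance
        rw [lintegral_lintegral_swap]
        · refine lintegral_congr fun φ => ?_
          rw [lintegral_finsetSum']
          intro e _
          exact (((hzm e).comp (measurable_id.prodMk measurable_const)).ennreal_ofReal.const_mul
            _).aemeasurable
        · refine Measurable.aemeasurable ?_
          refine Finset.measurable_sum _ fun e _ => ?_
          exact ((hAm.comp measurable_snd).ennreal_ofReal).mul (hzm e).ennreal_ofReal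
    _ ≤ ENNReal.ofReal (C₁ * |(cesA δ n)⁻¹| * (ρ ^ n)⁻¹) * ∫⁻ φ in Set.Ioc (-π) π,
          ENNReal.ofReal (N * ((S + 1) * C₂ * (1 - ρ) ^ (-σ))) *
        ENNReal.ofReal (‖1 - circleMap 0 ρ φ‖ ^ (-(δ + 1)) * ‖1 - circleMap 0 ρ φ ^ 2‖ ^ σ) := by
        gcongr 1
        refine setLIntegral_mono' measurableSet_Ioc fun φ hφ => ?_
        refine (sum_le_sum fun e _ => hinner φ hφ e).trans (le_of_eq ?_)
        rw [sum_const, card_univ, nsmul_eq_mul, ← mul_assoc,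
          ENNReal.ofReal_mul (show (0 : ℝ) ≤ N by positivity), hN, ENNReal.ofReal_natCast]
    _ = _ := by
        rw [lintegral_const_mul' _ _ ENNReal.ofReal_ne_top, ← mul_assoc,
          ← ENNReal.ofReal_mul (by positivity)]
        congr 2
        ring

lemma lintegral_abs_add_rpow {ε : ℝ} (hε : 0 < ε) (s : ℝ) :
    ∫⁻ φ in Set.Ioc (-π) π, ENNReal.ofReal ((|φ| + ε) ^ s) =
      ENNReal.ofReal (2 * ∫ φ in ε..(π + ε), φ ^ s) := by
  have hpos : ∀ φ : ℝ, 0 < |φ| + ε := fun φ => by positivity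
  have hc : Continuous fun φ : ℝ => (|φ| + ε) ^ s :=
    (by fun_prop : Continuous fun φ : ℝ => |φ| + ε).rpow_const fun φ => Or.inl (hpos φ).ne'
  have hle : -π ≤ π := by linarith [pi_pos]
  rw [← ofReal_integral_eq_lintegral_ofReal
    ((hc.intervalIntegrable (-π) π).1) (Filter.Eventually.of_forall fun φ => by
      have := hpos φ; positivity), ← intervalIntegral.integral_of_le hle,
    ← intervalIntegral.integral_add_adjacent_intervals (hc.intervalIntegrable (-π) 0)
      (hc.intervalIntegrable 0 π)]
  have h1 : ∫ φ in (-π)..0, (|φ| + ε) ^ s = ∫ φ in (0:ℝ)..π, (|φ| + ε) ^ s := by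
    rw [← neg_zero, ← intervalIntegral.integral_comp_neg]
    simp
  have h2 : ∫ φ in (0:ℝ)..π, (|φ| + ε) ^ s = ∫ φ in ε..(π + ε), φ ^ s := by
    have h3 := intervalIntegral.integral_comp_add_right (a := 0) (b := π) (fun φ : ℝ => φ ^ s) ε
    rw [zero_add] at h3
    rw [← h3]
    refine intervalIntegral.integral_congr fun φ hφ => ?_
    rw [Set.uIcc_of_le pi_pos.le] at hφ
    simp [abs_of_nonneg hφ.1]
  rw [h1, h2]
  congr 1
  ring

/-- The order of growth of `∫ (|φ| + 1/n)^{s-1} dφ`. -/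
noncomputable def growthRate (s : ℝ) (n : ℕ) : ℝ :=
  if 0 < s then 1 else if s = 0 then log n else (n : ℝ) ^ (-s)

lemma growthRate_nonneg (s : ℝ) (n : ℕ) : 0 ≤ growthRate s n := by
  unfold growthRate
  split_ifs
  · simp
  · exact log_natCast_nonneg n
  · positivity

lemma exists_integral_rpow_le (s : ℝ) : ∃ C > 0, ∀ n : ℕ, 2 ≤ n → ∀ ε : ℝ, 1 / (2 * n) ≤ ε →
    ε ≤ 1 → ∫ φ in ε..(π + ε), φ ^ (s - 1) ≤ C * growthRate s n := by
  rcases lt_trichotomy s 0 with hs | hs | hs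
  · refine ⟨(1 / 2) ^ s / (-s), div_pos (by positivity) (by linarith), fun n hn ε h1 h2 => ?_⟩
    have hn0 : (0 : ℝ) < n := by positivity
    have hε : 0 < ε := lt_of_lt_of_le (by positivity) h1
    rw [integral_rpow (Or.inr ⟨by linarith, by
      rw [Set.uIcc_of_le (by linarith [pi_pos])]; exact fun h => absurd h.1 (not_le.2 hε)⟩),
      sub_add_cancel, growthRate, if_neg (by linarith), if_neg hs.ne]
    have e : (1 / 2) ^ s / (-s) * (n : ℝ) ^ (-s) = (1 / (2 * n)) ^ s / (-s) := by
      rw [show (1 : ℝ) / (2 * n) = (1 / 2) * (n : ℝ)⁻¹ by field_simp,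
        mul_rpow (by positivity) (by positivity), inv_rpow hn0.le, ← rpow_neg hn0.le]
      ring
    rw [e, ← neg_div_neg_eq ((π + ε) ^ s - ε ^ s)]
    have h3 : ε ^ s ≤ (1 / (2 * n)) ^ s := rpow_le_rpow_of_nonpos (by positivity) h1 hs.le
    have h4 : 0 ≤ (π + ε) ^ s := by positivity
    gcongr
    · linarith
    · linarith
  · refine ⟨5, by norm_num, fun n hn ε h1 h2 => ?_⟩
    have hn0 : (0 : ℝ) < n := by positivity
    have hn2 : (2 : ℝ) ≤ n := by exact_mod_cast hn
    have hε : 0 < ε := lt_of_lt_of_le (by positivity) h1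
    subst hs
    rw [zero_sub]
    simp only [rpow_neg_one, growthRate, lt_irrefl, if_false, if_true]
    rw [integral_inv_of_pos hε (by positivity)]
    have : (π + ε) / ε ≤ (n : ℝ) ^ 5 := by
      rw [div_le_iff₀ hε]
      have h5 : (n : ℝ) * (1 / (2 * n)) = 1 / 2 := by field_simp
      have h6 : 1 / 2 ≤ n * ε := h5 ▸ mul_le_mul_of_nonneg_left h1 hn0.le
      have h7 : (2 : ℝ) ^ 4 ≤ (n : ℝ) ^ 4 := by gcongr
      have h8 : (n : ℝ) ^ 5 * ε = n ^ 4 * (n * ε) := by ring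
      have := pi_lt_four
      nlinarith
    calc _ ≤ log ((n : ℝ) ^ 5) := log_le_log (by positivity) this
      _ = _ := by rw [log_pow]; norm_num
  · refine ⟨(π + 1) ^ s / s, by positivity, fun n hn ε h1 h2 => ?_⟩
    have hn0 : (0 : ℝ) < n := by positivity
    have hε : 0 < ε := lt_of_lt_of_le (by positivity) h1
    rw [integral_rpow (Or.inl (by linarith)), sub_add_cancel, growthRate, if_pos hs, mul_one]
    have h3 : (π + ε) ^ s ≤ (π + 1) ^ s := by gcongr
    have h4 : 0 ≤ ε ^ s := by positivity
    gcongr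
    linarith

lemma exp_neg_inv_bounds {n : ℕ} (hn : 2 ≤ n) : 1 / 2 ≤ exp (-(1 / n : ℝ)) ∧
    exp (-(1 / n : ℝ)) < 1 ∧ 1 / (2 * n : ℝ) ≤ 1 - exp (-(1 / n : ℝ)) ∧
    1 - exp (-(1 / n : ℝ)) ≤ 1 / n ∧ ((exp (-(1 / n : ℝ))) ^ n)⁻¹ = exp 1 := by
  have hn2 : (2 : ℝ) ≤ n := by exact_mod_cast hn
  have hn0 : (0 : ℝ) < n := by linarith
  have h0 : 0 < (1 / n : ℝ) := by positivity
  have h1 : (1 / n : ℝ) ≤ 1 / 2 := by gcongr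
  have h2 := one_sub_le_exp_neg (1 / n : ℝ)
  refine ⟨by linarith, by rw [exp_lt_one_iff]; linarith, ?_, by linarith, ?_⟩
  · have h3 := add_one_le_exp (1 / n : ℝ)
    have h4 : exp (-(1 / n : ℝ)) ≤ (1 + 1 / n : ℝ)⁻¹ := by
      rw [exp_neg]; gcongr; linarith
    have h5 : (1 + 1 / n : ℝ)⁻¹ ≤ 1 - 1 / (2 * n) := by
      rw [inv_le_iff_one_le_mul₀ (by positivity)]
      have : 1 / (2 * n : ℝ) = (1 / n) / 2 := by field_simp
      rw [this]; nlinarith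
    linarith
  · rw [← exp_nat_mul, ← exp_neg]
    congr 1
    field_simp

lemma norm_one_sub_rpow_mul_le {σ : ℝ} (hσ : 0 ≤ σ) (δ : ℝ) {ρ φ : ℝ} (h0 : 1 / 2 ≤ ρ) (h1 : ρ < 1)
    (hφ : |φ| ≤ π) :
    ‖1 - circleMap 0 ρ φ‖ ^ (-(δ + 1)) * ‖1 - circleMap 0 ρ φ ^ 2‖ ^ σ ≤
      2 ^ σ * 4 ^ |σ - δ - 1| * 4⁻¹ ^ (σ - δ - 1) * (|φ| + (1 - ρ)) ^ (σ - δ - 1) := by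
  have hρ : 0 < ρ := by linarith
  have ha : 0 < |φ| + (1 - ρ) := by have := abs_nonneg φ; linarith
  have hlo := norm_one_sub_circleMap_ge h0 hφ
  have hhi := norm_one_sub_circleMap_le h1 (β := φ)
  have hz : 0 < ‖1 - circleMap 0 ρ φ‖ := lt_of_lt_of_le (by positivity) hlo
  have h2 : ‖1 - circleMap 0 ρ φ ^ 2‖ ≤ 2 * ‖1 - circleMap 0 ρ φ‖ := by
    rw [show 1 - circleMap 0 ρ φ ^ 2 = (1 + circleMap 0 ρ φ) * (1 - circleMap 0 ρ φ) by ring,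
      norm_mul]
    gcongr
    refine (norm_add_le _ _).trans ?_
    rw [norm_one, norm_circleMap_zero' hρ]; linarith
  have h3 := rpow_le_of_mem_Icc (s := σ - δ - 1) (show 0 < (|φ| + (1 - ρ)) / 4 by positivity)
    (by norm_num : (1 : ℝ) ≤ 4) hlo (by linarith)
  rw [div_eq_inv_mul, mul_rpow (by norm_num) ha.le] at h3
  calc _ ≤ ‖1 - circleMap 0 ρ φ‖ ^ (-(δ + 1)) * (2 * ‖1 - circleMap 0 ρ φ‖) ^ σ := by gcongr
    _ = 2 ^ σ * ‖1 - circleMap 0 ρ φ‖ ^ (σ - δ - 1) := by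
      rw [mul_rpow (by norm_num) hz.le, show σ - δ - 1 = -(δ + 1) + σ by ring, rpow_add hz]
      ring
    _ ≤ 2 ^ σ * (4 ^ |σ - δ - 1| * (4⁻¹ ^ (σ - δ - 1) * (|φ| + (1 - ρ)) ^ (σ - δ - 1))) := by
      gcongr
    _ = _ := by ring

lemma exists_eq_sigmaK {d : ℕ} (κ : Fin (d + 1) → ℝ) :
    ∃ j, (∀ i, κ j ≤ κ i) ∧ sigmaK d κ = ((d : ℝ) - 1) / 2 + (∑ i, κ i - κ j) := by
  obtain ⟨j, -, hj⟩ := exists_mem_eq_inf' (univ_nonempty (α := Fin (d + 1))) κ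
  exact ⟨j, fun i => hj ▸ inf'_le κ (mem_univ i), by rw [sigmaK, hj]; ring⟩

lemma sum_sub_pos {d : ℕ} (hd : 1 ≤ d) {κ : Fin (d + 1) → ℝ} (hκ : ∀ i, 0 < κ i)
    (j : Fin (d + 1)) : 0 < ∑ i, κ i - κ j := by
  rw [← sum_erase_eq_sub (mem_univ j)]
  refine sum_pos (fun i _ => hκ i) ?_
  rw [← card_pos, card_erase_of_mem (mem_univ j)]
  simp; lia

lemma sigmaK_pos {d : ℕ} (hd : 1 ≤ d) {κ : Fin (d + 1) → ℝ} (hκ : ∀ i, 0 < κ i) :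
    0 < sigmaK d κ := by
  obtain ⟨j, -, hj⟩ := exists_eq_sigmaK κ
  have := sum_sub_pos hd hκ j
  have hd1 : (1 : ℝ) ≤ d := by exact_mod_cast hd
  rw [hj]; linarith

lemma exists_integral_abs_hK_le {d : ℕ} (hd : 1 ≤ d) {κ : Fin (d + 1) → ℝ} (hκ : ∀ i, 0 < κ i)
    {δ : ℝ} (hδ : -1 < δ) : ∃ C > 0, ∀ n : ℕ, 2 ≤ n →
      ∀ x : Metric.sphere (0 : EuclideanSpace ℝ (Fin (d + 1))) 1,
      (∫ y, hsq κ y ∂(sphereMeas d))⁻¹ * ∫ y, |hK d κ δ n x y| * hsq κ y ∂(sphereMeas d) ≤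
        C * ((n : ℝ) ^ (sigmaK d κ - δ) * growthRate (sigmaK d κ - δ) n) := by
  obtain ⟨j, hj, hσ⟩ := exists_eq_sigmaK κ
  have hτ0 := sum_sub_pos hd hκ j
  have hσ0 := sigmaK_pos hd hκ
  set σ := sigmaK d κ with hσdef
  obtain ⟨C₁, hC₁, h1⟩ := exists_lintegral_hK_le hd hκ hτ0 (fun i => by linarith [hj i])
  rw [show ∑ i, κ i - κ j + ((d : ℝ) - 1) / 2 = σ by rw [hσ]; ring] at h1
  obtain ⟨C₂, hC₂, h2⟩ := exists_integral_rpow_le (σ - δ)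
  obtain ⟨a, _, ha, -, hA⟩ := growth_cesA hδ
  set H := (∫ y, hsq κ y ∂(sphereMeas d))⁻¹ with hH
  have hH0 : 0 ≤ H := inv_nonneg.2 (integral_nonneg fun y => hsq_nonneg κ _)
  set C₃ := (2 : ℝ) ^ σ * 4 ^ |σ - δ - 1| * 4⁻¹ ^ (σ - δ - 1) with hC₃
  refine ⟨(H + 1) * (C₁ * a⁻¹ * exp 1 * (1 / 2) ^ (-σ) * (C₃ * (2 * C₂))), by positivity,
    fun n hn x => ?_⟩
  have hn0 : (0 : ℝ) < n := by positivity
  obtain ⟨e1, e2, e3, e4, e5⟩ := exp_neg_inv_bounds hn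
  set ρ := exp (-(1 / n : ℝ)) with hρ
  have hε : 0 < 1 - ρ := by linarith
  have hg := growthRate_nonneg (σ - δ) n
  have hI : ∫⁻ φ in Set.Ioc (-π) π, ENNReal.ofReal (‖1 - circleMap 0 ρ φ‖ ^ (-(δ + 1)) *
      ‖1 - circleMap 0 ρ φ ^ 2‖ ^ σ) ≤ ENNReal.ofReal (C₃ * (2 * C₂) * growthRate (σ - δ) n) := by
    calc _ ≤ ∫⁻ φ in Set.Ioc (-π) π, ENNReal.ofReal C₃ *
          ENNReal.ofReal ((|φ| + (1 - ρ)) ^ (σ - δ - 1)) := by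
          refine setLIntegral_mono' measurableSet_Ioc fun φ hφ => ?_
          rw [← ENNReal.ofReal_mul (by positivity)]
          exact ENNReal.ofReal_le_ofReal
            (norm_one_sub_rpow_mul_le hσ0.le δ e1 e2 (abs_le.2 ⟨hφ.1.le, hφ.2⟩))
      _ = ENNReal.ofReal (C₃ * (2 * ∫ φ in (1 - ρ)..(π + (1 - ρ)), φ ^ (σ - δ - 1))) := by
          rw [lintegral_const_mul' _ _ ENNReal.ofReal_ne_top, lintegral_abs_add_rpow hε,
            ← ENNReal.ofReal_mul (by positivity)]
      _ ≤ _ := by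
          refine ENNReal.ofReal_le_ofReal ?_
          rw [mul_assoc C₃, mul_assoc 2]
          gcongr
          exact h2 n hn _ e3 (by linarith)
  have hAn : |(cesA δ n)⁻¹| ≤ a⁻¹ * (n : ℝ) ^ (-δ) := by
    rw [abs_of_pos (inv_pos.2 (cesA_pos hδ n)), rpow_neg hn0.le, ← mul_inv]
    exact inv_anti₀ (by positivity) (hA n (by lia)).1
  have hεσ : (1 - ρ) ^ (-σ) ≤ (1 / 2) ^ (-σ) * (n : ℝ) ^ σ := by
    calc _ ≤ (1 / (2 * n : ℝ)) ^ (-σ) :=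
          rpow_le_rpow_of_nonpos (by positivity) e3 (by linarith)
      _ = _ := by
          rw [show (1 : ℝ) / (2 * n) = (1 / 2) * (n : ℝ)⁻¹ by field_simp,
            mul_rpow (by positivity) (by positivity), inv_rpow hn0.le, ← rpow_neg hn0.le, neg_neg]
  have hx : ‖(x : EuclideanSpace ℝ (Fin (d + 1)))‖ = 1 := by simp
  have hmain : ∫ y, |hK d κ δ n x y| * hsq κ y ∂(sphereMeas d) ≤
      (C₁ * (a⁻¹ * (n : ℝ) ^ (-δ)) * exp 1 * ((1 / 2) ^ (-σ) * (n : ℝ) ^ σ)) *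
        (C₃ * (2 * C₂) * growthRate (σ - δ) n) := by
    have h3 := h1 δ ρ e1 e2 n x hx
    have h4 := h3.trans (mul_le_mul_right hI _)
    rw [← ENNReal.ofReal_mul (by positivity), e5] at h4
    have h5 : ∫ y, |hK d κ δ n x y| * hsq κ y ∂(sphereMeas d) ≤
        (∫⁻ y, ENNReal.ofReal (|hK d κ δ n x y| * hsq κ y) ∂(sphereMeas d)).toReal := by
      by_cases hi : Integrable (fun y : Metric.sphere (0 : EuclideanSpace ℝ (Fin (d + 1))) 1 =>
        |hK d κ δ n x y| * hsq κ y) (sphereMeas d)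
      · rw [integral_eq_lintegral_of_nonneg_ae
          (Filter.Eventually.of_forall fun y => mul_nonneg (abs_nonneg _) (hsq_nonneg _ _))
          hi.aestronglyMeasurable]
      · rw [integral_undef hi]; exact ENNReal.toReal_nonneg
    refine h5.trans ((ENNReal.toReal_mono ENNReal.ofReal_ne_top h4).trans ?_)
    rw [ENNReal.toReal_ofReal (by positivity)]
    gcongr
  calc _ ≤ H * ((C₁ * (a⁻¹ * (n : ℝ) ^ (-δ)) * exp 1 * ((1 / 2) ^ (-σ) * (n : ℝ) ^ σ)) *
        (C₃ * (2 * C₂) * growthRate (σ - δ) n)) := mul_le_mul_of_nonneg_left hmain hH0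
    _ ≤ (H + 1) * ((C₁ * (a⁻¹ * (n : ℝ) ^ (-δ)) * exp 1 * ((1 / 2) ^ (-σ) * (n : ℝ) ^ σ)) *
        (C₃ * (2 * C₂) * growthRate (σ - δ) n)) := by
        gcongr
        linarith
    _ = _ := by
        rw [show σ - δ = σ + -δ by ring, rpow_add hn0]
        ring

section GegenbauerPolynomials

open Polynomial

lemma C_two_eq : (C 2 : ℝ[X]) = 2 := map_ofNat C 2

/-- The Gegenbauer polynomial `C_n^l` as an element of `ℝ[X]`, from its three-term recurrence. -/
noncomputable def gegenPoly (l : ℝ) : ℕ → ℝ[X]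
  | 0 => 1
  | 1 => C (2 * l) * X
  | n + 2 => C ((n + 2 : ℝ)⁻¹) * (C (2 * (n + 1 + l)) * X * gegenPoly l (n + 1) -
      C (n + 2 * l) * gegenPoly l n)

lemma gegenPoly_rec (l : ℝ) (n : ℕ) : ((n : ℝ[X]) + 2) * gegenPoly l (n + 2) =
    2 * ((n : ℝ[X]) + 1 + C l) * X * gegenPoly l (n + 1) - ((n : ℝ[X]) + 2 * C l) * gegenPoly l n := by
  have h : ((n : ℝ[X]) + 2) * C ((n + 2 : ℝ)⁻¹) = 1 := by
    rw [show ((n : ℝ[X]) + 2) = C (n + 2 : ℝ) by simp [C_two_eq], ← C_mul,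
      mul_inv_cancel₀ (by positivity), C_1]
  rw [gegenPoly, ← mul_assoc, h, one_mul]
  simp [C_two_eq]

lemma eval_gegenPoly {l : ℝ} (hl : 0 < l) (t : ℝ) :
    ∀ n, (gegenPoly l n).eval t = gegenC n l t
  | 0 => by rw [gegenC_zero hl]; simp [gegenPoly]
  | 1 => by simp [gegenPoly, gegenC_one hl]
  | n + 2 => by
    have h := congrArg (Polynomial.eval t) (gegenPoly_rec l n)
    simp only [eval_mul, eval_add, eval_sub, eval_natCast, eval_ofNat, eval_one, eval_C, eval_X,
      eval_gegenPoly hl t n, eval_gegenPoly hl t (n + 1)] at h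
    rw [← gegenC_rec hl] at h
    exact mul_left_cancel₀ (by positivity) h

lemma gegenPoly_comp_neg_X (l : ℝ) : ∀ n, (gegenPoly l n).comp (-X) = (-1) ^ n * gegenPoly l n
  | 0 => by simp [gegenPoly]
  | 1 => by simp [gegenPoly]
  | n + 2 => by
    simp only [gegenPoly, mul_comp, sub_comp, C_comp, X_comp, gegenPoly_comp_neg_X l n,
      gegenPoly_comp_neg_X l (n + 1)]
    ring

lemma derivative_gegenPoly (l : ℝ) (n : ℕ) :
    X * derivative (gegenPoly l (n + 1)) - derivative (gegenPoly l n) =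
      ((n : ℝ[X]) + 1) * gegenPoly l (n + 1) ∧
    derivative (gegenPoly l (n + 1)) - X * derivative (gegenPoly l n) =
      ((n : ℝ[X]) + 2 * C l) * gegenPoly l n := by
  induction n with
  | zero =>
    constructor <;> simp [gegenPoly, C_two_eq, mul_comm]
  | succ n ih =>
    obtain ⟨ha, hb⟩ := ih
    have hr := gegenPoly_rec l n
    have hd := congrArg derivative hr
    simp only [derivative_mul, derivative_add, derivative_sub, derivative_natCast, derivative_ofNat,
      derivative_one, derivative_C, derivative_X] at hd
    have hn : ((n : ℝ[X]) + 2) ≠ 0 := by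
      rw [show ((n : ℝ[X]) + 2) = C (n + 2 : ℝ) by simp [C_two_eq], Ne, C_eq_zero]
      positivity
    have hb' : derivative (gegenPoly l (n + 1 + 1)) - X * derivative (gegenPoly l (n + 1)) =
      (((n + 1 : ℕ) : ℝ[X]) + 2 * C l) * gegenPoly l (n + 1) := by
      refine mul_left_cancel₀ hn ?_
      push_cast
      linear_combination hd + (n + 2 * C l) * ha
    refine ⟨?_, hb'⟩
    push_cast at hb' ⊢
    linear_combination X * hb' - hr + X * ha - hb

lemma derivative_gegenPoly_add_two (l : ℝ) (n : ℕ) :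
    derivative (gegenPoly l (n + 2) - gegenPoly l n) =
      2 * ((n : ℝ[X]) + 1 + C l) * gegenPoly l (n + 1) := by
  have h1 := (derivative_gegenPoly l n).1
  have h2 := (derivative_gegenPoly l (n + 1)).2
  push_cast at h2
  rw [derivative_sub]
  linear_combination h1 + h2

lemma gegenPoly_divergence (l : ℝ) (n : ℕ) :
    2 * ((n : ℝ[X]) + 1 + C l) * ((1 - X ^ 2) * derivative (gegenPoly l (n + 1)) -
      (2 * C l + 1) * X * gegenPoly l (n + 1)) =
    (n : ℝ[X]) * ((n : ℝ[X]) + 2 * C l) * gegenPoly l n - ((n : ℝ[X]) + 2) * ((n : ℝ[X]) + 2 + 2 * C l) * gegenPoly l (n + 2) := by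
  have h1 := (derivative_gegenPoly l n).1
  have h2 := (derivative_gegenPoly l n).2
  have hr := gegenPoly_rec l n
  linear_combination 2 * (n + 1 + C l) * (h2 - X * h1) + (n + 2 + 2 * C l) * hr

/-- The diagonal operator `X ^ i ↦ m i X ^ i` on polynomials. -/
noncomputable def diagMap (m : ℕ → ℝ) : ℝ[X] →ₗ[ℝ] ℝ[X] :=
  (Polynomial.basisMonomials ℝ).constr ℝ fun i => monomial i (m i)

lemma diagMap_monomial (m : ℕ → ℝ) (i : ℕ) (a : ℝ) :
    diagMap m (monomial i a) = monomial i (m i * a) := by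
  have h : monomial i a = a • Polynomial.basisMonomials ℝ i := by
    rw [coe_basisMonomials, smul_monomial, smul_eq_mul, mul_one]
  rw [h, map_smul, diagMap, Module.Basis.constr_basis, smul_monomial, smul_eq_mul, mul_comm]

/-- The coefficient `i + 2κ` for odd `i` and `i` for even `i` of the Dunkl operator. -/
noncomputable def dunklE (κ : ℝ) (i : ℕ) : ℝ := if Even i then i else i + 2 * κ

lemma X_mul_diagMap_derivative {κ : ℝ} {m : ℕ → ℝ}
    (hm : ∀ i, dunklE κ (i + 1) * m (i + 1) = (i + 1) * m i) (P : ℝ[X]) :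
    X * diagMap m (derivative P) =
      diagMap m (X * derivative P) + κ • diagMap m (P - P.comp (-X)) := by
  induction P using Polynomial.induction_on' with
  | add p q hp hq =>
    simp only [map_add, mul_add, hp, hq, add_comp, add_sub_add_comm, smul_add]
    ring
  | monomial i a =>
    rcases i with _ | i
    · simp
    · have hcomp : (monomial (i + 1) a).comp (-X) = monomial (i + 1) ((-1) ^ (i + 1) * a) := by
        rw [monomial_comp, neg_pow, ← C_mul_X_pow_eq_monomial, C_mul, C_pow, C_neg, C_1]
        ring
      rw [hcomp, derivative_monomial_succ, ← monomial_sub, diagMap_monomial, diagMap_monomial,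
        smul_monomial, X_mul_monomial, X_mul_monomial, diagMap_monomial, ← (monomial (i + 1)).map_add]
      congr 1
      have := hm i
      unfold dunklE at this
      split_ifs at this with he
      · rw [he.neg_one_pow]
        push_cast at this
        simp only [smul_eq_mul]
        linear_combination (-a) * this
      · rw [(Nat.not_even_iff_odd.1 he).neg_one_pow]
        push_cast at this
        simp only [smul_eq_mul]
        linear_combination (-a) * this

/-- The coefficient of `q_{k-1}` in the three-term recurrence of the generalized Gegenbauer
polynomials. -/
noncomputable def dunklF (l κ : ℝ) (k : ℕ) : ℝ :=
  if Even k then k - 1 + 2 * l - 2 * κ else k - 1 + 2 * l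

lemma diagMap_gegenPoly_rec {κ l : ℝ} {m : ℕ → ℝ}
    (hm : ∀ i, dunklE κ (i + 1) * m (i + 1) = (i + 1) * m i) (n : ℕ) :
    (2 * (n + 1 + l)) • (X * diagMap m (gegenPoly l (n + 1))) =
      dunklE κ (n + 2) • diagMap m (gegenPoly l (n + 2)) +
        dunklF l κ (n + 1) • diagMap m (gegenPoly l n) := by
  have h := X_mul_diagMap_derivative hm (gegenPoly l (n + 2) - gegenPoly l n)
  have hC : ∀ (c : ℝ) (p : ℝ[X]), C c * p = c • p := fun c p => (smul_eq_C_mul c).symm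
  have e1 : 2 * ((n : ℝ[X]) + 1 + C l) = C (2 * (n + 1 + l)) := by simp [C_two_eq]
  have e2 : X * (2 * ((n : ℝ[X]) + 1 + C l) * gegenPoly l (n + 1)) =
      C (n + 2 : ℝ) * gegenPoly l (n + 2) + C (n + 2 * l) * gegenPoly l n := by
    have := gegenPoly_rec l n
    simp only [map_add, map_mul, map_natCast, C_two_eq]
    linear_combination -this
  rw [derivative_gegenPoly_add_two, e2, e1, hC, hC, hC, sub_comp, gegenPoly_comp_neg_X,
    gegenPoly_comp_neg_X, map_smul, mul_smul_comm] at h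
  rw [h]
  rcases Nat.even_or_odd n with he | ho
  · have ho' : ¬ Even (n + 1) := by simpa [Nat.even_add_one] using he
    rw [dunklE, if_pos (by simpa [Nat.even_add] using he), dunklF, if_neg ho',
      he.neg_one_pow, (by simpa [Nat.even_add] using he : Even (n + 2)).neg_one_pow]
    simp only [one_mul, sub_self, map_zero, smul_zero, map_add, map_smul, add_zero]
    push_cast
    congr 2
    ring
  · have he' : Even (n + 1) := by simpa [Nat.even_add_one] using ho
    have ho2 : Odd (n + 2) := by simpa [Nat.odd_add] using ho
    rw [dunklE, if_neg (Nat.not_even_iff_odd.2 ho2), dunklF, if_pos he',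
      ho.neg_one_pow, ho2.neg_one_pow]
    simp only [neg_mul, one_mul, map_add, map_sub, map_neg, map_smul]
    push_cast
    module

end GegenbauerPolynomials

lemma intervalIntegrable_pow_mul_one_sub_sq_rpow {κ : ℝ} (hκ : 0 < κ) (i : ℕ) :
    IntervalIntegrable (fun t : ℝ => t ^ i * (1 - t ^ 2) ^ (κ - 1)) volume (-1) 1 :=
  (intervalIntegrable_one_sub_sq_rpow (by linarith)).continuousOn_mul (by fun_prop)

lemma integral_pow_mul_one_sub_sq_rpow_add_two {κ : ℝ} (hκ : 0 < κ) (i : ℕ) :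
    (i + 1 + 2 * κ) * ∫ t in (-1 : ℝ)..1, t ^ (i + 2) * (1 - t ^ 2) ^ (κ - 1) =
      (i + 1) * ∫ t in (-1 : ℝ)..1, t ^ i * (1 - t ^ 2) ^ (κ - 1) := by
  have hi := intervalIntegrable_pow_mul_one_sub_sq_rpow hκ
  have hF := intervalIntegral.integral_eq_sub_of_hasDerivAt_of_le
    (f := fun t : ℝ => t ^ (i + 1) * (1 - t ^ 2) ^ κ)
    (f' := fun t : ℝ => (i + 1) * (t ^ i * (1 - t ^ 2) ^ (κ - 1)) -
      (i + 1 + 2 * κ) * (t ^ (i + 2) * (1 - t ^ 2) ^ (κ - 1))) (by norm_num : (-1 : ℝ) ≤ 1) ?_ ?_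
    (((hi i).const_mul _).sub ((hi (i + 2)).const_mul _))
  · rw [intervalIntegral.integral_sub ((hi i).const_mul _) ((hi (i + 2)).const_mul _),
      intervalIntegral.integral_const_mul, intervalIntegral.integral_const_mul] at hF
    norm_num [hκ.ne'] at hF
    linarith
  · refine Continuous.continuousOn ?_
    have : Continuous fun t : ℝ => (1 - t ^ 2) ^ κ :=
      (by fun_prop : Continuous fun t : ℝ => 1 - t ^ 2).rpow_const fun t => Or.inr hκ.le
    fun_prop
  · intro t ht
    have h1 : 0 < 1 - t ^ 2 := by nlinarith [ht.1, ht.2]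
    have h2 : HasDerivAt (fun t : ℝ => 1 - t ^ 2) (-(2 * t)) t := by
      simpa using (hasDerivAt_pow 2 t).const_sub 1
    have h3 := (hasDerivAt_pow (i + 1) t).mul (h2.rpow_const (p := κ) (Or.inl h1.ne'))
    refine h3.congr_deriv ?_
    have h4 : (1 - t ^ 2) ^ κ = (1 - t ^ 2) * (1 - t ^ 2) ^ (κ - 1) := by
      rw [mul_comm, ← rpow_add_one h1.ne', sub_add_cancel]
    rw [h4]
    push_cast
    ring

lemma integral_odd_eq_zero {f : ℝ → ℝ} (hf : ∀ t, f (-t) = -f t) (a : ℝ) :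
    ∫ t in (-a)..a, f t = 0 := by
  have h := intervalIntegral.integral_comp_neg (a := -a) (b := a) f
  simp only [hf, intervalIntegral.integral_neg, neg_neg] at h
  linarith

lemma integral_pow_mul_wone {κ : ℝ} (hκ : 0 < κ) (i : ℕ) :
    ∫ t in Set.Icc (-1 : ℝ) 1, t ^ i * wone κ t = (∫ t in (-1 : ℝ)..1, t ^ i * (1 - t ^ 2) ^ (κ - 1)) +
      ∫ t in (-1 : ℝ)..1, t ^ (i + 1) * (1 - t ^ 2) ^ (κ - 1) := by
  have hi := intervalIntegrable_pow_mul_one_sub_sq_rpow hκ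
  rw [integral_Icc_eq_integral_Ioc, ← intervalIntegral.integral_of_le (by norm_num),
    ← intervalIntegral.integral_add (hi i) (hi (i + 1))]
  refine intervalIntegral.integral_congr fun t _ => ?_
  simp only [wone]
  ring

lemma dunklE_mul_integral_wone {κ : ℝ} (hκ : 0 < κ) (i : ℕ) :
    dunklE κ (i + 1) * ∫ t in Set.Icc (-1 : ℝ) 1, t ^ (i + 1) * wone κ t =
      (i + 1) * ∫ t in Set.Icc (-1 : ℝ) 1, t ^ i * wone κ t := by
  have hodd : ∀ k, Odd k → ∫ t in (-1 : ℝ)..1, t ^ k * (1 - t ^ 2) ^ (κ - 1) = 0 := by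
    intro k hk
    refine integral_odd_eq_zero (fun t => ?_) 1
    rw [hk.neg_pow, neg_sq]; ring
  rw [integral_pow_mul_wone hκ, integral_pow_mul_wone hκ, dunklE]
  have h := integral_pow_mul_one_sub_sq_rpow_add_two hκ i
  rcases Nat.even_or_odd i with he | ho
  · rw [if_neg (by simpa [Nat.even_add_one] using he), hodd (i + 1) he.add_one]
    push_cast
    linear_combination h
  · rw [if_pos ho.add_one, hodd i ho, hodd (i + 1 + 1) ho.add_one.add_one]
    push_cast
    ring

/-- The normalized moments of the coordinate `t j` with respect to the weight on the cube. -/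
noncomputable def cubeMoment {m : ℕ} (κ : Fin m → ℝ) (j : Fin m) (i : ℕ) : ℝ :=
  (∫ t in cube m, wprod κ t)⁻¹ * ∫ t in cube m, t j ^ i * wprod κ t

lemma integral_cube_pow_mul_wprod {m : ℕ} (κ : Fin m → ℝ) (j : Fin m) (i : ℕ) :
    ∫ t in cube m, t j ^ i * wprod κ t = (∫ t in Set.Icc (-1 : ℝ) 1, t ^ i * wone (κ j) t) *
      ∏ l ∈ univ.erase j, ∫ t in Set.Icc (-1 : ℝ) 1, wone (κ l) t := by
  have h1 : ∀ t : Fin m → ℝ, t j ^ i * wprod κ t =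
      ∏ l, (fun s => (if l = j then s ^ i else 1) * wone (κ l) s) (t l) := by
    intro t
    simp only [prod_mul_distrib, prod_ite_eq', mem_univ, if_true]
    rfl
  rw [restrict_cube, integral_congr_ae (Filter.Eventually.of_forall h1),
    integral_fintype_prod_eq_prod (fun l s => (if l = j then s ^ i else 1) * wone (κ l) s),
    ← mul_prod_erase univ _ (mem_univ j)]
  simp only [if_true]
  congr 1
  refine prod_congr rfl fun l hl => ?_
  simp [(mem_erase.1 hl).1]

lemma dunklE_mul_cubeMoment {m : ℕ} {κ : Fin m → ℝ} (hκ : ∀ i, 0 < κ i) (j : Fin m) (i : ℕ) :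
    dunklE (κ j) (i + 1) * cubeMoment κ j (i + 1) = (i + 1) * cubeMoment κ j i := by
  have h := dunklE_mul_integral_wone (hκ j) i
  rw [cubeMoment, cubeMoment, integral_cube_pow_mul_wprod, integral_cube_pow_mul_wprod]
  linear_combination ((∫ t in cube m, wprod κ t)⁻¹ *
    ∏ l ∈ univ.erase j, ∫ t in Set.Icc (-1 : ℝ) 1, wone (κ l) t) * h

lemma integral_wprod_pos {m : ℕ} {κ : Fin m → ℝ} (hκ : ∀ i, 0 < κ i) :
    0 < ∫ t in cube m, wprod κ t := by
  have h1 : ∀ t : Fin m → ℝ, wprod κ t = ∏ l, (fun s => wone (κ l) s) (t l) := fun t => rfl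
  rw [restrict_cube, integral_congr_ae (Filter.Eventually.of_forall h1),
    integral_fintype_prod_eq_prod (fun l s => wone (κ l) s)]
  refine prod_pos fun l _ => ?_
  rw [integral_Icc_eq_integral_Ioo]
  rw [setIntegral_pos_iff_support_of_nonneg_ae]
  · refine lt_of_lt_of_le ?_ (measure_mono (s := Set.Ioo (-1 : ℝ) 1) fun t ht => ⟨?_, ht⟩)
    · simp
    · have h2 : 0 < 1 - t ^ 2 := by nlinarith [ht.1, ht.2]
      have h3 : 0 < 1 + t := by linarith [ht.1]
      simp only [Function.mem_support, wone]
      positivity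
  · filter_upwards [ae_restrict_mem measurableSet_Ioo] with t ht
    exact wone_nonneg ⟨ht.1.le, ht.2.le⟩
  · exact (integrableOn_wone (hκ l)).mono_set Set.Ioo_subset_Icc_self

lemma cubeMoment_zero {m : ℕ} {κ : Fin m → ℝ} (hκ : ∀ i, 0 < κ i) (j : Fin m) :
    cubeMoment κ j 0 = 1 := by
  simp [cubeMoment, (integral_wprod_pos hκ).ne']

open Polynomial in
lemma eval_diagMap_cubeMoment {m : ℕ} {κ : Fin m → ℝ} (hκ : ∀ i, 0 < κ i) (j : Fin m) (P : ℝ[X])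
    (s : ℝ) : (∫ t in cube m, wprod κ t)⁻¹ * ∫ t in cube m, P.eval (s * t j) * wprod κ t =
      (diagMap (cubeMoment κ j) P).eval s := by
  have hi : ∀ P : ℝ[X], IntegrableOn (fun t => P.eval (s * t j) * wprod κ t) (cube m) := fun P =>
    integrableOn_continuous_mul_wprod hκ (f := fun t => P.eval (s * t j)) (by fun_prop)
  induction P using Polynomial.induction_on' with
  | add p q hp hq =>
    simp only [eval_add, add_mul, map_add]
    rw [integral_add (hi p) (hi q), mul_add, hp, hq]
  | monomial i a =>
    rw [diagMap_monomial]
    simp only [eval_monomial, mul_pow, cubeMoment]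
    have : ∀ t : Fin m → ℝ, a * (s ^ i * t j ^ i) * wprod κ t =
      a * s ^ i * (t j ^ i * wprod κ t) := fun t => by ring
    simp only [this]
    rw [integral_const_mul]
    ring

/-- The polynomials `q_k` with `hP k (e_j) y = ((k + λ) / λ) q_k (y_j)`. -/
noncomputable def axisPoly (d : ℕ) (κ : Fin (d + 1) → ℝ) (j : Fin (d + 1)) (k : ℕ) :
    Polynomial ℝ := diagMap (cubeMoment κ j) (gegenPoly (lamK d κ) k)

lemma hP_single {d : ℕ} {κ : Fin (d + 1) → ℝ} (hκ : ∀ i, 0 < κ i) (hl : 0 < lamK d κ)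
    (j : Fin (d + 1)) (k : ℕ) (y : EuclideanSpace ℝ (Fin (d + 1))) :
    hP d κ k (EuclideanSpace.single j 1) y =
      (k + lamK d κ) / lamK d κ * (axisPoly d κ j k).eval (y j) := by
  rw [axisPoly, ← eval_diagMap_cubeMoment hκ, hP]
  have : ∀ t : Fin (d + 1) → ℝ, ∑ i, (EuclideanSpace.single j (1 : ℝ) :
      EuclideanSpace ℝ (Fin (d + 1))) i * y i * t i = y j * t j := by
    intro t
    rw [sum_eq_single j]
    · simp
    · intro b _ hb; simp [hb]
    · simp
  simp only [this, eval_gegenPoly hl]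
  ring

lemma integral_rpow_mul_exp_neg_sq {s : ℝ} (hs : -1 < s) :
    ∫ r in Set.Ioi (0 : ℝ), r ^ s * exp (-r ^ 2) = Gamma ((s + 1) / 2) / 2 := by
  have := integral_rpow_mul_exp_neg_rpow (p := 2) (by norm_num) hs
  simp only [rpow_two] at this
  rw [this]; ring

lemma integrableOn_rpow_mul_exp_neg_sq {s : ℝ} (hs : -1 < s) :
    IntegrableOn (fun r : ℝ => r ^ s * exp (-r ^ 2)) (Set.Ioi 0) := by
  simpa using integrableOn_rpow_mul_exp_neg_mul_sq (b := 1) one_pos hs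

lemma lintegral_rpow_mul_exp_neg_sq {s : ℝ} (hs : -1 < s) :
    ∫⁻ r in Set.Ioi (0 : ℝ), ENNReal.ofReal (r ^ s * exp (-r ^ 2)) =
      ENNReal.ofReal (Gamma ((s + 1) / 2) / 2) := by
  rw [← integral_rpow_mul_exp_neg_sq hs, ofReal_integral_eq_lintegral_ofReal
    (integrableOn_rpow_mul_exp_neg_sq hs)]
  filter_upwards [ae_restrict_mem measurableSet_Ioi] with r hr
  have hr' : (0 : ℝ) < r := hr
  simp only [Pi.zero_apply]
  positivity

lemma lintegral_homogeneous_mul_exp {d : ℕ} {F : EuclideanSpace ℝ (Fin (d + 1)) → ENNReal}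
    (hF : Measurable F) {a : ℝ} (ha : 0 ≤ a)
    (h : ∀ r : ℝ, 0 < r → ∀ y, F (r • y) = ENNReal.ofReal (r ^ a) * F y) :
    ∫⁻ x, F x * ENNReal.ofReal (exp (-‖x‖ ^ 2)) =
      ENNReal.ofReal (Gamma ((d + a + 1) / 2) / 2) * ∫⁻ y, F y ∂(sphereMeas d) := by
  rw [lintegral_polar volume (by fun_prop), sphereMeas, ← lintegral_rpow_mul_exp_neg_sq
    (by linarith [Nat.cast_nonneg (α := ℝ) d]), mul_comm, ← lintegral_mul_const _ (by fun_prop)]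
  refine lintegral_congr fun y => ?_
  rw [← lintegral_const_mul _ (by fun_prop)]
  refine setLIntegral_congr_fun measurableSet_Ioi fun r hr => ?_
  have hr' : (0 : ℝ) < r := hr
  have hy : ‖(y : EuclideanSpace ℝ (Fin (d + 1)))‖ = 1 := by simp
  simp only [h r hr', norm_smul, hy, mul_one, norm_of_nonneg hr'.le, finrank_euclideanSpace,
    Fintype.card_fin, add_tsub_cancel_right]
  rw [rpow_add hr', rpow_natCast, ENNReal.ofReal_mul (by positivity),
    ENNReal.ofReal_mul (by positivity)]
  ring

lemma lintegral_sphere_neg {d : ℕ} {F : EuclideanSpace ℝ (Fin (d + 1)) → ENNReal}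
    (hF : Measurable F) {a : ℝ} (ha : 0 ≤ a)
    (h : ∀ r : ℝ, 0 < r → ∀ y, F (r • y) = ENNReal.ofReal (r ^ a) * F y) :
    ∫⁻ y, F (-y) ∂(sphereMeas d) = ∫⁻ y, F y ∂(sphereMeas d) := by
  have h1 := lintegral_homogeneous_mul_exp hF ha h
  have h2 := lintegral_homogeneous_mul_exp (F := fun x => F (-x)) (by fun_prop) ha
    (fun r hr y => by rw [← smul_neg, h r hr])
  have h3 := lintegral_neg_eq_self (μ := (volume : Measure (EuclideanSpace ℝ (Fin (d + 1)))))
    (fun x => F x * ENNReal.ofReal (exp (-‖x‖ ^ 2)))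
  simp only [norm_neg] at h3
  rw [h1, h2] at h3
  have hpos : 0 < Gamma ((d + a + 1) / 2) / 2 := div_pos (Gamma_pos_of_pos (by positivity)) two_pos
  exact (ENNReal.mul_right_inj (by simpa using hpos) ENNReal.ofReal_ne_top).1 h3

instance (d : ℕ) : IsFiniteMeasure (sphereMeas d) := by unfold sphereMeas; infer_instance

lemma integrable_sphere {d : ℕ} {f : EuclideanSpace ℝ (Fin (d + 1)) → ℝ} (hf : Continuous f) :
    Integrable (fun y : Metric.sphere (0 : EuclideanSpace ℝ (Fin (d + 1))) 1 => f y)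
      (sphereMeas d) := by
  have hc : Continuous fun y : Metric.sphere (0 : EuclideanSpace ℝ (Fin (d + 1))) 1 =>
    f y := by fun_prop
  exact hc.integrable_of_hasCompactSupport (HasCompactSupport.of_compactSpace _)

lemma integral_sphere_odd {d : ℕ} {f : EuclideanSpace ℝ (Fin (d + 1)) → ℝ} (hf : Continuous f)
    (hodd : ∀ y, f (-y) = -f y) {a : ℝ} (ha : 0 ≤ a)
    (h : ∀ r : ℝ, 0 < r → ∀ y, f (r • y) = r ^ a * f y) :
    ∫ y, f y ∂(sphereMeas d) = 0 := by
  have h1 := lintegral_sphere_neg (F := fun y => ENNReal.ofReal (f y)) (by fun_prop) ha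
    (fun r hr y => by rw [h r hr, ENNReal.ofReal_mul (by positivity)])
  simp only [hodd] at h1
  rw [integral_eq_lintegral_pos_part_sub_lintegral_neg_part (integrable_sphere hf), h1, sub_self]

lemma integral_abs_rpow_mul_exp {a : ℝ} (ha : 0 ≤ a) :
    ∫ t : ℝ, |t| ^ a * exp (-t ^ 2) = Gamma ((a + 1) / 2) := by
  have := integral_comp_abs (f := fun t : ℝ => t ^ a * exp (-t ^ 2))
  simp only [sq_abs] at this
  rw [this, integral_rpow_mul_exp_neg_sq (by linarith)]
  ring

lemma integrable_abs_rpow_mul_exp {a : ℝ} (ha : 0 ≤ a) :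
    Integrable fun t : ℝ => |t| ^ a * exp (-t ^ 2) := by
  refine Integrable.of_integral_ne_zero ?_
  rw [integral_abs_rpow_mul_exp ha]
  exact (Gamma_pos_of_pos (by positivity)).ne'

lemma lintegral_prod_abs_rpow_mul_exp {m : ℕ} {a : Fin m → ℝ} (ha : ∀ i, 0 ≤ a i) :
    ∫⁻ x : EuclideanSpace ℝ (Fin m), ENNReal.ofReal (∏ i, |x i| ^ a i) *
      ENNReal.ofReal (exp (-‖x‖ ^ 2)) = ENNReal.ofReal (∏ i, Gamma ((a i + 1) / 2)) := by
  have h1 : ∀ x : EuclideanSpace ℝ (Fin m), ENNReal.ofReal (∏ i, |x i| ^ a i) *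
      ENNReal.ofReal (exp (-‖x‖ ^ 2)) =
      (fun t : Fin m → ℝ => ENNReal.ofReal (∏ i, |t i| ^ a i * exp (-t i ^ 2))) (WithLp.ofLp x) := by
    intro x
    simp only
    rw [← ENNReal.ofReal_mul (prod_nonneg fun _ _ => by positivity), prod_mul_distrib,
      ← exp_sum, EuclideanSpace.norm_sq_eq]
    simp
  rw [lintegral_congr h1]
  have h2 := (PiLp.volume_preserving_ofLp (Fin m)).lintegral_comp_emb
    (MeasurableEquiv.toLp 2 (Fin m → ℝ)).symm.measurableEmbedding
    (fun t => ENNReal.ofReal (∏ i, |t i| ^ a i * exp (-t i ^ 2)))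
  refine h2.trans ?_
  rw [← ofReal_integral_eq_lintegral_ofReal]
  · rw [volume_pi, integral_fintype_prod_eq_prod (fun i t => |t| ^ a i * exp (-t ^ 2))]
    simp only [integral_abs_rpow_mul_exp (ha _)]
  · exact Integrable.fintype_prod fun i => integrable_abs_rpow_mul_exp (ha i)
  · exact Filter.Eventually.of_forall fun t => prod_nonneg fun _ _ => by positivity

/-- The Dirichlet integral over the sphere. -/
lemma integral_sphere_prod_abs_rpow {d : ℕ} {a : Fin (d + 1) → ℝ} (ha : ∀ i, 0 ≤ a i) :
    Gamma ((d + ∑ i, a i + 1) / 2) / 2 *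
      ∫ y, ∏ i, |(y : EuclideanSpace ℝ (Fin (d + 1))) i| ^ a i ∂(sphereMeas d) =
      ∏ i, Gamma ((a i + 1) / 2) := by
  have hs : 0 ≤ ∑ i, a i := sum_nonneg fun i _ => ha i
  have hcont : Continuous fun y : EuclideanSpace ℝ (Fin (d + 1)) => ∏ i, |y i| ^ a i :=
    continuous_finsetProd _ fun i _ =>
      (by fun_prop : Continuous fun y : EuclideanSpace ℝ (Fin (d + 1)) => |y i|).rpow_const
        fun _ => Or.inr (ha i)
  have h1 := lintegral_homogeneous_mul_exp (d := d)
    (F := fun y => ENNReal.ofReal (∏ i, |y i| ^ a i)) (by fun_prop) hs (fun r hr y => by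
      rw [← ENNReal.ofReal_mul (by positivity)]
      congr 1
      rw [rpow_sum_of_pos hr, ← prod_mul_distrib]
      refine prod_congr rfl fun i _ => ?_
      rw [← mul_rpow hr.le (abs_nonneg _)]
      simp [abs_mul, abs_of_pos hr])
  have hpos : 0 < Gamma ((d + ∑ i, a i + 1) / 2) / 2 :=
    div_pos (Gamma_pos_of_pos (by positivity)) two_pos
  rw [lintegral_prod_abs_rpow_mul_exp ha, ← ofReal_integral_eq_lintegral_ofReal
    (integrable_sphere hcont) (Filter.Eventually.of_forall fun y => prod_nonneg fun _ _ => by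
      positivity), ← ENNReal.ofReal_mul hpos.le] at h1
  refine ((ENNReal.ofReal_eq_ofReal_iff (prod_nonneg fun i _ => (Gamma_pos_of_pos ?_).le)
    (mul_nonneg hpos.le (integral_nonneg fun y => prod_nonneg fun _ _ => by positivity))).1 h1).symm
  have := ha i
  positivity

lemma continuous_hsq {m : ℕ} {κ : Fin m → ℝ} (hκ : ∀ i, 0 < κ i) : Continuous (hsq κ) := by
  refine continuous_finsetProd _ fun i _ => ?_
  exact (by fun_prop : Continuous fun y : EuclideanSpace ℝ (Fin m) => |y i|).rpow_const
    fun _ => Or.inr (by have := hκ i; positivity)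

lemma hsq_smul {m : ℕ} (κ : Fin m → ℝ) {r : ℝ} (hr : 0 < r) (y : EuclideanSpace ℝ (Fin m)) :
    hsq κ (r • y) = r ^ (2 * ∑ i, κ i) * hsq κ y := by
  rw [hsq, hsq, mul_sum, rpow_sum_of_pos hr, ← prod_mul_distrib]
  refine prod_congr rfl fun i _ => ?_
  rw [← mul_rpow hr.le (abs_nonneg _)]
  simp [abs_mul, abs_of_pos hr]

lemma hsq_neg {m : ℕ} (κ : Fin m → ℝ) (y : EuclideanSpace ℝ (Fin m)) : hsq κ (-y) = hsq κ y := by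
  simp [hsq]

open Polynomial in
lemma diagMap_X_pow (m : ℕ → ℝ) (i : ℕ) : diagMap m (X ^ i) = m i • X ^ i := by
  rw [X_pow_eq_monomial, diagMap_monomial, smul_monomial, smul_eq_mul]

open Polynomial in
/-- Integration of polynomials in the `j`-th coordinate against `h_κ²` on the sphere. -/
noncomputable def axisInt {d : ℕ} {κ : Fin (d + 1) → ℝ} (hκ : ∀ i, 0 < κ i) (j : Fin (d + 1)) :
    ℝ[X] →ₗ[ℝ] ℝ where
  toFun P := ∫ y, P.eval ((y : EuclideanSpace ℝ (Fin (d + 1))) j) * hsq κ y ∂(sphereMeas d)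
  map_add' P Q := by
    have hi : ∀ P : ℝ[X], Integrable (fun y : Metric.sphere (0 : EuclideanSpace ℝ (Fin (d + 1))) 1 =>
        P.eval ((y : EuclideanSpace ℝ (Fin (d + 1))) j) * hsq κ y) (sphereMeas d) := fun P =>
      integrable_sphere (f := fun y => P.eval (y j) * hsq κ y)
        ((P.continuous.comp (by fun_prop)).mul (continuous_hsq hκ))
    simp only [eval_add, add_mul]
    exact integral_add (hi P) (hi Q)
  map_smul' c P := by
    simp only [eval_smul, smul_eq_mul, mul_assoc, integral_const_mul, RingHom.id_apply]

open Polynomial in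
lemma axisInt_apply {d : ℕ} {κ : Fin (d + 1) → ℝ} (hκ : ∀ i, 0 < κ i) (j : Fin (d + 1)) (P : ℝ[X]) :
    axisInt hκ j P =
      ∫ y, P.eval ((y : EuclideanSpace ℝ (Fin (d + 1))) j) * hsq κ y ∂(sphereMeas d) := rfl

open Polynomial in
lemma axisInt_X_pow_odd {d : ℕ} {κ : Fin (d + 1) → ℝ} (hκ : ∀ i, 0 < κ i) (j : Fin (d + 1))
    {i : ℕ} (hi : Odd i) : axisInt hκ j (X ^ i) = 0 := by
  have hs : 0 ≤ ∑ l, κ l := sum_nonneg fun l _ => (hκ l).le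
  rw [axisInt_apply]
  simp only [eval_pow, eval_X]
  refine integral_sphere_odd (f := fun y => y j ^ i * hsq κ y) (a := i + 2 * ∑ l, κ l)
    (Continuous.mul (by fun_prop) (continuous_hsq hκ)) (fun y => ?_) (by positivity)
    fun r hr y => ?_
  · simp only [hsq_neg, PiLp.neg_apply, hi.neg_pow, neg_mul]
  · simp only [hsq_smul κ hr, PiLp.smul_apply, smul_eq_mul, mul_pow]
    rw [rpow_add hr, rpow_natCast]
    ring

open Polynomial in
lemma axisInt_X_pow_even {d : ℕ} {κ : Fin (d + 1) → ℝ} (hκ : ∀ i, 0 < κ i) (j : Fin (d + 1))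
    {i : ℕ} (hi : Even i) : Gamma (lamK d κ + 1 + i / 2) / 2 * axisInt hκ j (X ^ i) =
      Gamma (κ j + (i + 1) / 2) * ∏ l ∈ univ.erase j, Gamma (κ l + 1 / 2) := by
  have h := integral_sphere_prod_abs_rpow (d := d) (a := fun l => 2 * κ l + if l = j then (i : ℝ) else 0)
    (fun l => by have := hκ l; split_ifs <;> positivity)
  simp only [sum_add_distrib, sum_ite_eq', mem_univ, if_true, ← mul_sum] at h
  rw [← mul_prod_erase univ _ (mem_univ j)] at h
  rw [axisInt_apply]
  convert h using 1
  · congr 3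
    · rw [lamK]; ring
    · funext y
      rw [hsq, ← mul_prod_erase univ _ (mem_univ j), ← mul_prod_erase univ _ (mem_univ j),
        if_pos rfl, rpow_add_of_nonneg (abs_nonneg _) (by have := hκ j; positivity) (by positivity),
        rpow_natCast, hi.pow_abs, eval_pow, eval_X]
      have hE : ∀ l ∈ univ.erase j, |(y : EuclideanSpace ℝ (Fin (d + 1))) l| ^
          (2 * κ l + if l = j then (i : ℝ) else 0) =
          |(y : EuclideanSpace ℝ (Fin (d + 1))) l| ^ (2 * κ l) := fun l hl => by
        rw [if_neg (ne_of_mem_erase hl), add_zero]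
      rw [prod_congr rfl hE]
      ring
  · congr 1
    · rw [if_pos rfl]; congr 1; ring
    · refine prod_congr rfl fun l hl => ?_
      rw [if_neg (ne_of_mem_erase hl)]; congr 1; ring

open Polynomial in
lemma axisInt_X_pow_add_two {d : ℕ} (hd : 1 ≤ d) {κ : Fin (d + 1) → ℝ} (hκ : ∀ i, 0 < κ i)
    (j : Fin (d + 1)) (i : ℕ) : (i + 2 + 2 * lamK d κ) * axisInt hκ j (X ^ (i + 2)) =
      dunklE (κ j) (i + 1) * axisInt hκ j (X ^ i) := by
  rcases Nat.even_or_odd i with hi | hi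
  · have h0 := axisInt_X_pow_even hκ j hi
    have h2 := axisInt_X_pow_even hκ j (hi.add even_two)
    have hl := lamK_pos hd hκ
    have hj := hκ j
    rw [dunklE, if_neg (by simpa [Nat.even_add_one] using hi)]
    push_cast at h2 ⊢
    rw [show lamK d κ + 1 + (i + 2 : ℝ) / 2 = (lamK d κ + 1 + i / 2) + 1 by ring,
      Gamma_add_one (by positivity),
      show κ j + ((i : ℝ) + 2 + 1) / 2 = (κ j + (i + 1) / 2) + 1 by ring,
      Gamma_add_one (by positivity)] at h2
    have hG : 0 < Gamma (lamK d κ + 1 + i / 2) := Gamma_pos_of_pos (by positivity)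
    refine mul_left_cancel₀ hG.ne' ?_
    linear_combination 4 * h2 - 2 * ((i : ℝ) + 1 + 2 * κ j) * h0
  · rw [axisInt_X_pow_odd hκ j hi, axisInt_X_pow_odd hκ j (hi.add_even even_two)]
    simp

open Polynomial in
lemma axisInt_diagMap_X_pow_add_two {d : ℕ} (hd : 1 ≤ d) {κ : Fin (d + 1) → ℝ}
    (hκ : ∀ i, 0 < κ i) (j : Fin (d + 1)) (i : ℕ) :
    (i + 2 + 2 * lamK d κ) * axisInt hκ j (diagMap (cubeMoment κ j) (X ^ (i + 2))) =
      (i + 1) * axisInt hκ j (diagMap (cubeMoment κ j) (X ^ i)) := by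
  have hm : ∀ i, axisInt hκ j (diagMap (cubeMoment κ j) (X ^ i)) =
      cubeMoment κ j i * axisInt hκ j (X ^ i) := fun i => by
    rw [diagMap_X_pow, map_smul, smul_eq_mul]
  rw [hm, hm]
  have h1 := axisInt_X_pow_add_two hd hκ j i
  have h2 := dunklE_mul_cubeMoment hκ j i
  rcases Nat.even_or_odd i with hi | hi
  · have h3 := dunklE_mul_cubeMoment hκ j (i + 1)
    rw [dunklE, if_pos (by simpa [Nat.even_add_one] using hi)] at h3
    push_cast at h3
    have h4 : cubeMoment κ j (i + 2) = cubeMoment κ j (i + 1) := by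
      refine mul_left_cancel₀ (by positivity : (i + 1 + 1 : ℝ) ≠ 0) ?_
      linear_combination h3
    rw [h4]
    linear_combination cubeMoment κ j (i + 1) * h1 + axisInt hκ j (X ^ i) * h2
  · rw [axisInt_X_pow_odd hκ j hi, axisInt_X_pow_odd hκ j (hi.add_even even_two)]
    simp

open Polynomial in
lemma axisInt_diagMap_divergence {d : ℕ} (hd : 1 ≤ d) {κ : Fin (d + 1) → ℝ}
    (hκ : ∀ i, 0 < κ i) (j : Fin (d + 1)) (p : ℝ[X]) :
    axisInt hκ j (diagMap (cubeMoment κ j)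
      ((1 - X ^ 2) * derivative p - (2 * C (lamK d κ) + 1) * X * p)) = 0 := by
  induction p using Polynomial.induction_on' with
  | add p q hp hq =>
    rw [derivative_add, mul_add, mul_add, add_sub_add_comm, map_add, map_add, hp, hq, add_zero]
  | monomial n a =>
    have h1 : axisInt hκ j (diagMap (cubeMoment κ j) X) = 0 := by
      have := axisInt_X_pow_odd hκ j odd_one
      rw [← pow_one (X : ℝ[X]), diagMap_X_pow, map_smul, this, smul_zero]
    have hX : ∀ c : ℝ, ∀ i, C c * X ^ i = c • (X ^ i : ℝ[X]) := fun c i => (smul_eq_C_mul c).symm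
    cases n with
    | zero =>
      have : (1 - X ^ 2) * derivative (monomial 0 a) - (2 * C (lamK d κ) + 1) * X * monomial 0 a =
          (-(2 * lamK d κ + 1) * a) • (X : ℝ[X]) := by
        rw [smul_eq_C_mul]
        simp [C_two_eq]; ring
      rw [this, map_smul, map_smul, h1, smul_zero]
    | succ n =>
      have : (1 - X ^ 2) * derivative (monomial (n + 1) a) -
          (2 * C (lamK d κ) + 1) * X * monomial (n + 1) a =
          (a * (n + 1)) • (X ^ n : ℝ[X]) - (a * (n + 2 + 2 * lamK d κ)) • (X ^ (n + 2) : ℝ[X]) := by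
        rw [smul_eq_C_mul, smul_eq_C_mul, derivative_monomial, ← C_mul_X_pow_eq_monomial,
          ← C_mul_X_pow_eq_monomial]
        simp [C_two_eq]; ring
      rw [this, map_sub, map_sub, map_smul, map_smul, map_smul, map_smul, smul_eq_mul, smul_eq_mul]
      have := axisInt_diagMap_X_pow_add_two hd hκ j n
      linear_combination -a * this

open Polynomial in
lemma axisInt_axisPoly {d : ℕ} (hd : 1 ≤ d) {κ : Fin (d + 1) → ℝ} (hκ : ∀ i, 0 < κ i)
    (j : Fin (d + 1)) (k : ℕ) : axisInt hκ j (axisPoly d κ j (k + 1)) = 0 := by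
  have hl := lamK_pos hd hκ
  have hstep : ∀ n : ℕ, (n : ℝ) * axisInt hκ j (axisPoly d κ j n) = 0 →
      axisInt hκ j (axisPoly d κ j (n + 2)) = 0 := by
    intro n hn
    have hcast : ∀ p : ℝ[X], axisInt hκ j (diagMap (cubeMoment κ j)
        ((n : ℝ[X]) * ((n : ℝ[X]) + 2 * C (lamK d κ)) * p)) =
        n * (n + 2 * lamK d κ) * axisInt hκ j (diagMap (cubeMoment κ j) p) := fun p => by
      rw [show (n : ℝ[X]) * ((n : ℝ[X]) + 2 * C (lamK d κ)) * p =
        ((n : ℝ) * (n + 2 * lamK d κ)) • p by rw [smul_eq_C_mul]; simp [C_two_eq],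
        map_smul, map_smul, smul_eq_mul]
    have hcast2 : ∀ p : ℝ[X], axisInt hκ j (diagMap (cubeMoment κ j)
        (((n : ℝ[X]) + 2) * ((n : ℝ[X]) + 2 + 2 * C (lamK d κ)) * p)) =
        (n + 2) * (n + 2 + 2 * lamK d κ) * axisInt hκ j (diagMap (cubeMoment κ j) p) := fun p => by
      rw [show ((n : ℝ[X]) + 2) * ((n : ℝ[X]) + 2 + 2 * C (lamK d κ)) * p =
        (((n : ℝ) + 2) * (n + 2 + 2 * lamK d κ)) • p by rw [smul_eq_C_mul]; simp [C_two_eq],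
        map_smul, map_smul, smul_eq_mul]
    have h := congrArg (fun p => axisInt hκ j (diagMap (cubeMoment κ j) p))
      (gegenPoly_divergence (lamK d κ) n)
    simp only [map_sub, hcast, hcast2] at h
    rw [show (2 : ℝ[X]) * ((n : ℝ[X]) + 1 + C (lamK d κ)) = C (2 * (n + 1 + lamK d κ)) by
      simp [C_two_eq], ← smul_eq_C_mul, map_smul, map_smul, axisInt_diagMap_divergence hd hκ,
      smul_zero] at h
    have hpos : (n + 2 : ℝ) * (n + 2 + 2 * lamK d κ) ≠ 0 := by positivity
    refine (mul_eq_zero.1 ?_).resolve_left hpos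
    rw [axisPoly] at hn ⊢
    linear_combination h + (n + 2 * lamK d κ) * hn
  induction k using Nat.twoStepInduction with
  | zero =>
    rw [axisPoly, gegenPoly, ← smul_eq_C_mul, map_smul, map_smul, ← pow_one (X : ℝ[X]),
      diagMap_X_pow, map_smul, axisInt_X_pow_odd hκ j odd_one, smul_zero, smul_zero]
  | one => exact hstep 0 (by simp)
  | more k h1 _ => exact hstep (k + 1) (by rw [h1, mul_zero])

open Polynomial in
lemma axisPoly_zero {d : ℕ} {κ : Fin (d + 1) → ℝ} (hκ : ∀ i, 0 < κ i) (j : Fin (d + 1)) :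
    axisPoly d κ j 0 = 1 := by
  rw [axisPoly, gegenPoly, ← pow_zero X, diagMap_X_pow, cubeMoment_zero hκ, one_smul]

open Polynomial in
lemma axisPoly_rec_zero {d : ℕ} {κ : Fin (d + 1) → ℝ} (hκ : ∀ i, 0 < κ i) (j : Fin (d + 1)) :
    (2 * lamK d κ) • (X * axisPoly d κ j 0) = dunklE (κ j) 1 • axisPoly d κ j 1 := by
  have h := dunklE_mul_cubeMoment hκ j 0
  rw [cubeMoment_zero hκ] at h
  rw [axisPoly_zero hκ, mul_one, axisPoly, gegenPoly, ← smul_eq_C_mul, map_smul, ← pow_one X,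
    diagMap_X_pow, smul_smul, smul_smul]
  congr 1
  norm_num at h ⊢
  linear_combination -(2 * lamK d κ) * h

open Polynomial in
lemma axisPoly_rec {d : ℕ} {κ : Fin (d + 1) → ℝ} (hκ : ∀ i, 0 < κ i) (j : Fin (d + 1)) (n : ℕ) :
    (2 * (n + 1 + lamK d κ)) • (X * axisPoly d κ j (n + 1)) =
      dunklE (κ j) (n + 2) • axisPoly d κ j (n + 2) +
        dunklF (lamK d κ) (κ j) (n + 1) • axisPoly d κ j n :=
  diagMap_gegenPoly_rec (dunklE_mul_cubeMoment hκ j) n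

lemma dunklE_pos {k : ℝ} (hk : 0 < k) (n : ℕ) : 0 < dunklE k (n + 1) := by
  rw [dunklE]; split_ifs <;> positivity

open Polynomial in
lemma axisInt_axisPoly_mul_of_lt {d : ℕ} (hd : 1 ≤ d) {κ : Fin (d + 1) → ℝ} (hκ : ∀ i, 0 < κ i)
    (j : Fin (d + 1)) (l : ℕ) :
    ∀ k, l < k → axisInt hκ j (axisPoly d κ j l * axisPoly d κ j k) = 0 := by
  have hl := lamK_pos hd hκ
  have key : ∀ i n, axisInt hκ j (axisPoly d κ j i * axisPoly d κ j (n + 2)) = 0 →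
      axisInt hκ j (axisPoly d κ j i * axisPoly d κ j n) = 0 →
      axisInt hκ j (X * axisPoly d κ j i * axisPoly d κ j (n + 1)) = 0 := by
    intro i n h1 h2
    have h := congrArg (fun p => axisInt hκ j (axisPoly d κ j i * p)) (axisPoly_rec hκ j n)
    simp only [mul_add, mul_smul_comm, map_add, map_smul, h1, h2, smul_zero, add_zero] at h
    rw [mul_comm X, mul_assoc]
    have hp : (2 * (n + 1 + lamK d κ)) ≠ 0 := by positivity
    exact (smul_eq_zero.1 h).resolve_left (by simpa only [mul_add] using hp)
  induction l using Nat.twoStepInduction with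
  | zero =>
    intro k hk
    obtain ⟨k, rfl⟩ := Nat.exists_eq_add_of_lt hk
    rw [axisPoly_zero hκ, one_mul]
    exact axisInt_axisPoly hd hκ j _
  | one =>
    intro k hk
    obtain ⟨k, rfl⟩ := Nat.exists_eq_add_of_lt hk
    have h := congrArg (fun p => axisInt hκ j (p * axisPoly d κ j (1 + k + 1)))
      (axisPoly_rec_zero hκ j)
    simp only [smul_mul_assoc, map_smul] at h
    rw [key 0 (1 + k), smul_zero, eq_comm] at h
    · exact (smul_eq_zero.1 h).resolve_left (dunklE_pos (hκ j) 0).ne'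
    · rw [axisPoly_zero hκ, one_mul]; exact axisInt_axisPoly hd hκ j _
    · rw [axisPoly_zero hκ, one_mul, add_comm]; exact axisInt_axisPoly hd hκ j _
  | more l h0 h1 =>
    intro k hk
    obtain ⟨k, rfl⟩ := Nat.exists_eq_add_of_lt hk
    have h := congrArg (fun p => axisInt hκ j (p * axisPoly d κ j (l + 2 + k + 1)))
      (axisPoly_rec hκ j l)
    simp only [add_mul, smul_mul_assoc, map_add, map_smul] at h
    rw [key (l + 1) (l + 2 + k) (h1 _ (by omega)) (h1 _ (by omega)), h0 _ (by omega), smul_zero,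
      smul_zero, add_zero, eq_comm] at h
    exact (smul_eq_zero.1 h).resolve_left (dunklE_pos (hκ j) (l + 1)).ne'

open Polynomial in
lemma axisInt_axisPoly_mul {d : ℕ} (hd : 1 ≤ d) {κ : Fin (d + 1) → ℝ} (hκ : ∀ i, 0 < κ i)
    (j : Fin (d + 1)) {l k : ℕ} (h : l ≠ k) :
    axisInt hκ j (axisPoly d κ j l * axisPoly d κ j k) = 0 := by
  rcases lt_or_gt_of_ne h with h | h
  · exact axisInt_axisPoly_mul_of_lt hd hκ j l k h
  · rw [mul_comm]; exact axisInt_axisPoly_mul_of_lt hd hκ j k l h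

open Polynomial in
lemma axisInt_axisPoly_sq_succ {d : ℕ} (hd : 1 ≤ d) {κ : Fin (d + 1) → ℝ} (hκ : ∀ i, 0 < κ i)
    (j : Fin (d + 1)) (n : ℕ) :
    dunklF (lamK d κ) (κ j) (n + 1) * (n + lamK d κ) *
        axisInt hκ j (axisPoly d κ j n * axisPoly d κ j n) =
      dunklE (κ j) (n + 1) * (n + 1 + lamK d κ) *
        axisInt hκ j (axisPoly d κ j (n + 1) * axisPoly d κ j (n + 1)) := by
  have h1 := congrArg (fun p => axisInt hκ j (axisPoly d κ j n * p)) (axisPoly_rec hκ j n)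
  simp only [mul_add, mul_smul_comm, map_add, map_smul,
    axisInt_axisPoly_mul hd hκ j (by omega : n ≠ n + 2), smul_eq_mul, mul_zero, zero_add] at h1
  have h2 : 2 * (n + lamK d κ) *
      axisInt hκ j (axisPoly d κ j n * (X * axisPoly d κ j (n + 1))) =
      dunklE (κ j) (n + 1) * axisInt hκ j (axisPoly d κ j (n + 1) * axisPoly d κ j (n + 1)) := by
    rw [show axisPoly d κ j n * (X * axisPoly d κ j (n + 1)) =
      (X * axisPoly d κ j n) * axisPoly d κ j (n + 1) by ring]
    cases n with
    | zero =>
      have h := congrArg (fun p => axisInt hκ j (p * axisPoly d κ j 1)) (axisPoly_rec_zero hκ j)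
      simp only [smul_mul_assoc, map_smul, smul_eq_mul] at h
      simpa using h
    | succ m =>
      have h := congrArg (fun p => axisInt hκ j (p * axisPoly d κ j (m + 2)))
        (axisPoly_rec hκ j m)
      simp only [add_mul, smul_mul_assoc, map_add, map_smul,
        axisInt_axisPoly_mul hd hκ j (by omega : m ≠ m + 2), smul_eq_mul, mul_zero, add_zero] at h
      push_cast
      linear_combination h
  linear_combination (-(n + lamK d κ)) * h1 + (n + 1 + lamK d κ) * h2

/-- The squared norm of the projection kernel `P_k(h_κ²; e_j, ·)`. -/
noncomputable def axisNorm {d : ℕ} {κ : Fin (d + 1) → ℝ} (hκ : ∀ i, 0 < κ i) (j : Fin (d + 1))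
    (k : ℕ) : ℝ :=
  ((k + lamK d κ) / lamK d κ) ^ 2 * axisInt hκ j (axisPoly d κ j k * axisPoly d κ j k)

lemma integral_hP_mul_hP {d : ℕ} (hd : 1 ≤ d) {κ : Fin (d + 1) → ℝ} (hκ : ∀ i, 0 < κ i)
    (j : Fin (d + 1)) (k l : ℕ) :
    ∫ y, hP d κ k (EuclideanSpace.single j 1) (y : EuclideanSpace ℝ (Fin (d + 1))) *
      hP d κ l (EuclideanSpace.single j 1) y * hsq κ y ∂(sphereMeas d) =
      if k = l then axisNorm hκ j k else 0 := by
  have hl := lamK_pos hd hκ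
  have h : ∀ y : Metric.sphere (0 : EuclideanSpace ℝ (Fin (d + 1))) 1,
      hP d κ k (EuclideanSpace.single j 1) y * hP d κ l (EuclideanSpace.single j 1) y * hsq κ y =
      ((k + lamK d κ) / lamK d κ) * ((l + lamK d κ) / lamK d κ) *
        ((axisPoly d κ j k * axisPoly d κ j l).eval ((y : EuclideanSpace ℝ (Fin (d + 1))) j) *
          hsq κ y) := by
    intro y
    rw [hP_single hκ hl, hP_single hκ hl, Polynomial.eval_mul]
    ring
  simp only [h, integral_const_mul]
  rw [← axisInt_apply hκ]
  split_ifs with hkl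
  · subst hkl; rw [axisNorm]; ring
  · rw [axisInt_axisPoly_mul hd hκ j hkl, mul_zero]

lemma axisNorm_zero {d : ℕ} (hd : 1 ≤ d) {κ : Fin (d + 1) → ℝ} (hκ : ∀ i, 0 < κ i)
    (j : Fin (d + 1)) : axisNorm hκ j 0 = ∫ y, hsq κ y ∂(sphereMeas d) := by
  have hl := lamK_pos hd hκ
  rw [axisNorm, axisPoly_zero hκ, axisInt_apply]
  simp [hl.ne']

lemma integral_hsq_pos {d : ℕ} (hd : 1 ≤ d) {κ : Fin (d + 1) → ℝ} (hκ : ∀ i, 0 < κ i) :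
    0 < ∫ y, hsq κ y ∂(sphereMeas d) := by
  have hl := lamK_pos hd hκ
  have h := axisInt_X_pow_even hκ 0 (i := 0) (by simp)
  rw [axisInt_apply] at h
  simp only [pow_zero, Polynomial.eval_one, one_mul] at h
  have hG : 0 < Gamma (lamK d κ + 1 + (0 : ℕ) / 2) / 2 :=
    div_pos (Gamma_pos_of_pos (by positivity)) two_pos
  refine pos_of_mul_pos_right (a := Gamma (lamK d κ + 1 + (0 : ℕ) / 2) / 2) ?_ hG.le
  rw [h]
  refine mul_pos (Gamma_pos_of_pos ?_) (prod_pos fun l _ => Gamma_pos_of_pos ?_)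
  · have := hκ 0; positivity
  · have := hκ l; positivity

lemma axisNorm_succ {d : ℕ} (hd : 1 ≤ d) {κ : Fin (d + 1) → ℝ} (hκ : ∀ i, 0 < κ i)
    (j : Fin (d + 1)) (n : ℕ) :
    dunklF (lamK d κ) (κ j) (n + 1) * (axisNorm hκ j n / (n + lamK d κ)) =
      dunklE (κ j) (n + 1) * (axisNorm hκ j (n + 1) / (n + 1 + lamK d κ)) := by
  have hl := lamK_pos hd hκ
  have h := axisInt_axisPoly_sq_succ hd hκ j n
  have h1 : (n + lamK d κ) ≠ 0 := by positivity
  have h2 : (n + 1 + lamK d κ) ≠ 0 := by positivity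
  rw [axisNorm, axisNorm]
  push_cast
  field_simp
  linear_combination h

lemma poch_succ' (a : ℝ) (n : ℕ) : poch a (n + 1) = poch a n * (a + n) := by
  rw [poch, poch, prod_range_succ]

lemma axisNorm_two_mul {d : ℕ} (hd : 1 ≤ d) {κ : Fin (d + 1) → ℝ} (hκ : ∀ i, 0 < κ i)
    (j : Fin (d + 1)) (m : ℕ) :
    axisNorm hκ j (2 * m) = axisNorm hκ j 0 / lamK d κ * (2 * m + lamK d κ) *
      ((poch (lamK d κ - κ j + 1 / 2) m / m.factorial) * (poch (lamK d κ) m / m.factorial) *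
        (poch (κ j + 1 / 2) m / m.factorial)⁻¹) := by
  have hl := lamK_pos hd hκ
  have hj := hκ j
  induction m with
  | zero => simp [poch]; field_simp
  | succ m ih =>
    have h1 := axisNorm_succ hd hκ j (2 * m)
    have h2 := axisNorm_succ hd hκ j (2 * m + 1)
    rw [ih, dunklF, if_neg (by simp), dunklE, if_neg (by simp)] at h1
    rw [dunklF, if_pos (by simp [Nat.even_add_one]), dunklE, if_pos (by simp [Nat.even_add_one])] at h2
    rw [show 2 * (m + 1) = 2 * m + 1 + 1 by ring, poch_succ', poch_succ', poch_succ',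
      Nat.factorial_succ]
    have p1 := poch_pos (by positivity : 0 < κ j + 1 / 2) m
    have p3 : (0 : ℝ) < m.factorial := by positivity
    push_cast at h1 h2 ⊢
    have n1 : (2 * m + lamK d κ) ≠ 0 := by positivity
    have n2 : (2 * m + 1 + lamK d κ) ≠ 0 := by positivity
    have n3 : (2 * m + 1 + 1 + lamK d κ) ≠ 0 := by positivity
    have n4 : (κ j + 1 / 2 + m) ≠ 0 := by positivity
    have n5 : (m + 1 : ℝ) ≠ 0 := by positivity
    have e1 : axisNorm hκ j (2 * m + 1) / (2 * m + 1 + lamK d κ) =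
        axisNorm hκ j 0 / lamK d κ * ((poch (lamK d κ - κ j + 1 / 2) m / m.factorial) *
          (poch (lamK d κ) m / m.factorial) * (poch (κ j + 1 / 2) m / m.factorial)⁻¹) *
          ((m + lamK d κ) / (κ j + 1 / 2 + m)) := by
      rw [← mul_div_assoc, eq_div_iff n4]
      have hc : ∀ a b : ℝ, a * (2 * m + lamK d κ) * b / (2 * m + lamK d κ) = a * b := fun a b => by
        field_simp
      rw [hc] at h1
      linear_combination -(1 / 2) * h1
    rw [e1] at h2
    have e2 : axisNorm hκ j (2 * m + 1 + 1) = (2 * m + 1 + 1 + lamK d κ) *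
      (axisNorm hκ j (2 * m + 1 + 1) / (2 * m + 1 + 1 + lamK d κ)) := by field_simp
    rw [e2]
    have e3 : axisNorm hκ j (2 * m + 1 + 1) / (2 * m + 1 + 1 + lamK d κ) =
      ((lamK d κ - κ j + 1 / 2 + m) * (axisNorm hκ j 0 / lamK d κ * ((poch (lamK d κ - κ j + 1 / 2) m / m.factorial) *
          (poch (lamK d κ) m / m.factorial) * (poch (κ j + 1 / 2) m / m.factorial)⁻¹) *
          ((m + lamK d κ) / (κ j + 1 / 2 + m)))) / (m + 1) := by
      rw [eq_div_iff n5]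
      linear_combination -(1 / 2) * h2
    rw [e3]
    field_simp
    ring

lemma growth_of_even_odd {a : ℕ → ℝ} {q : ℝ} (h0 : Growth (fun m => a (2 * m)) q)
    (h1 : Growth (fun m => a (2 * m + 1)) q) (ha : 0 < a 1) : Growth a q := by
  obtain ⟨c₁, c₂, p1, p2, h0⟩ := h0
  obtain ⟨d₁, d₂, q1, q2, h1⟩ := h1
  have hb : (1 : ℝ) ≤ 3 ^ |q| := one_le_rpow (by norm_num) (abs_nonneg q)
  have hb0 : (0 : ℝ) < 3 ^ |q| := by positivity
  have hcmp : ∀ m k : ℕ, 1 ≤ m → m ≤ k → k ≤ 3 * m →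
      (3 ^ |q|)⁻¹ * (k : ℝ) ^ q ≤ (m : ℝ) ^ q ∧ (m : ℝ) ^ q ≤ 3 ^ |q| * (k : ℝ) ^ q := by
    intro m k hm h1 h2
    have hm' : (0 : ℝ) < m := by exact_mod_cast hm
    have h1' : (m : ℝ) ≤ k := by exact_mod_cast h1
    have h2' : (k : ℝ) ≤ 3 * m := by exact_mod_cast h2
    have hk' : (0 : ℝ) < k := hm'.trans_le h1'
    have u := rpow_le_of_mem_Icc (s := q) hm' (by norm_num) h1' h2'
    have v := rpow_le_of_mem_Icc (s := -q) hm' (by norm_num) h1' h2'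
    rw [abs_neg, rpow_neg hk'.le, rpow_neg hm'.le] at v
    refine ⟨by rwa [inv_mul_le_iff₀ hb0], ?_⟩
    have pk : 0 < (k : ℝ) ^ q := by positivity
    have pm : 0 < (m : ℝ) ^ q := by positivity
    rw [inv_le_iff_one_le_mul₀ pk, mul_assoc, mul_left_comm, ← div_eq_inv_mul,
      le_div_iff₀ pm, one_mul] at v
    exact v
  refine ⟨min (min c₁ d₁ * (3 ^ |q|)⁻¹) (a 1), max (max c₂ d₂ * 3 ^ |q|) (a 1), by positivity,
    by positivity, fun n hn => ?_⟩
  have key : ∀ m, 1 ≤ m → m ≤ n → n ≤ 3 * m → min c₁ d₁ * (m : ℝ) ^ q ≤ a n →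
      a n ≤ max c₂ d₂ * (m : ℝ) ^ q →
      min (min c₁ d₁ * (3 ^ |q|)⁻¹) (a 1) * (n : ℝ) ^ q ≤ a n ∧
        a n ≤ max (max c₂ d₂ * 3 ^ |q|) (a 1) * (n : ℝ) ^ q := by
    intro m hm e1 e2 e3 e4
    obtain ⟨u, v⟩ := hcmp m n hm e1 e2
    have pn : 0 ≤ (n : ℝ) ^ q := by positivity
    constructor
    · refine le_trans (mul_le_mul_of_nonneg_right (min_le_left _ _) pn) (le_trans ?_ e3)
      rw [mul_assoc]
      exact mul_le_mul_of_nonneg_left u (by positivity)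
    · refine e4.trans (le_trans ?_ (mul_le_mul_of_nonneg_right (le_max_left _ _) pn))
      rw [mul_assoc]
      exact mul_le_mul_of_nonneg_left v (by positivity)
  rcases Nat.even_or_odd' n with ⟨m, rfl | rfl⟩
  · obtain ⟨u, v⟩ := h0 m (by omega)
    exact key m (by omega) (by omega) (by omega)
      (le_trans (mul_le_mul_of_nonneg_right (min_le_left _ _) (by positivity)) u)
      (v.trans (mul_le_mul_of_nonneg_right (le_max_left _ _) (by positivity)))
  · rcases Nat.eq_zero_or_pos m with rfl | hm
    · simp
    · obtain ⟨u, v⟩ := h1 m (by omega)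
      exact key m (by omega) (by omega) (by omega)
        (le_trans (mul_le_mul_of_nonneg_right (min_le_right _ _) (by positivity)) u)
        (v.trans (mul_le_mul_of_nonneg_right (le_max_right _ _) (by positivity)))

lemma growth_axisNorm {d : ℕ} (hd : 1 ≤ d) {κ : Fin (d + 1) → ℝ} (hκ : ∀ i, 0 < κ i)
    (j : Fin (d + 1)) : Growth (axisNorm hκ j) (2 * (lamK d κ - κ j)) := by
  have hl := lamK_pos hd hκ
  have hj := hκ j
  have hs : 0 < lamK d κ - κ j := by
    have := sum_sub_pos hd hκ j
    have hd' : (1 : ℝ) ≤ d := by exact_mod_cast hd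
    rw [lamK]; linarith
  have hN : 0 < axisNorm hκ j 0 := by rw [axisNorm_zero hd]; exact integral_hsq_pos hd hκ
  have heven : Growth (fun m => axisNorm hκ j (2 * m)) (2 * (lamK d κ - κ j)) := by
    refine ((growth_mul_add_const (c := 2 * axisNorm hκ j 0 / lamK d κ) (s := axisNorm hκ j 0)
      (by positivity) hN.le).mul
      (((growth_poch_div_factorial (by positivity : 0 < lamK d κ - κ j + 1 / 2)).mul
        (growth_poch_div_factorial hl)).mul
        (growth_poch_div_factorial (by positivity : 0 < κ j + 1 / 2)).inv)).congr
      (fun m _ => ?_) (by ring)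
    rw [axisNorm_two_mul hd]
    congr 1
    field_simp
  have hodd : ∀ m : ℕ, axisNorm hκ j (2 * m + 1) = axisNorm hκ j (2 * m) *
      ((2 * m + (1 + lamK d κ)) * (2 * m + lamK d κ)⁻¹ *
        ((2 * m + 2 * lamK d κ) * (2 * m + (1 + 2 * κ j))⁻¹)) := by
    intro m
    have h1 := axisNorm_succ hd hκ j (2 * m)
    rw [dunklF, if_neg (by simp), dunklE, if_neg (by simp)] at h1
    push_cast at h1
    have n1 : (2 * m + lamK d κ) ≠ 0 := by positivity
    have n2 : (2 * m + 1 + lamK d κ) ≠ 0 := by positivity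
    have n4 : (2 * m + 1 + 2 * κ j) ≠ 0 := by positivity
    rw [← add_assoc, ← add_assoc]
    field_simp at h1 ⊢
    linear_combination -h1
  refine growth_of_even_odd heven ?_ ?_
  · exact (heven.mul (((growth_mul_add_const two_pos (by positivity : 0 ≤ 1 + lamK d κ)).mul
      (growth_mul_add_const two_pos hl.le).inv).mul
      ((growth_mul_add_const two_pos (by positivity : 0 ≤ 2 * lamK d κ)).mul
        (growth_mul_add_const two_pos (by positivity : 0 ≤ 1 + 2 * κ j)).inv))).congr
      (fun m _ => (hodd m).symm) (by ring)
  · have := hodd 0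
    simp only [mul_zero, zero_add, Nat.cast_zero] at this
    rw [this]
    positivity

lemma circleMap_zero_mul_exp (ρ φ θ : ℝ) :
    circleMap 0 ρ φ * Complex.exp (θ * Complex.I) = circleMap 0 ρ (φ + θ) := by
  simp only [circleMap, zero_add, mul_assoc, ← Complex.exp_add]
  push_cast
  ring_nf

lemma norm_one_sub_circleMap_pos {ρ : ℝ} (h0 : 0 ≤ ρ) (h1 : ρ < 1) (φ : ℝ) :
    0 < ‖1 - circleMap 0 ρ φ‖ := by
  have h := norm_sub_norm_le (1 : ℂ) (circleMap 0 ρ φ)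
  rw [norm_one, norm_circleMap_zero, abs_of_nonneg h0] at h
  linarith

lemma continuous_norm_one_sub_circleMap_rpow {ρ : ℝ} (h0 : 0 ≤ ρ) (h1 : ρ < 1) (θ s : ℝ) :
    Continuous fun φ => ‖1 - circleMap 0 ρ (φ + θ)‖ ^ s :=
  (by fun_prop : Continuous fun φ => ‖1 - circleMap 0 ρ (φ + θ)‖).rpow_const
    fun φ => Or.inl (norm_one_sub_circleMap_pos h0 h1 _).ne'

lemma exists_integral_norm_one_sub_circleMap_le {σ : ℝ} (hσ : 0 < σ) : ∃ C > 0, ∀ n : ℕ, 2 ≤ n →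
    ∀ θ : ℝ, ∫ φ in (-π)..π, ‖1 - circleMap 0 (exp (-(1 / n : ℝ))) (φ + θ)‖ ^ (-(σ + 1)) ≤
      C * (n : ℝ) ^ σ := by
  obtain ⟨C, hC, h⟩ := exists_integral_rpow_le (-σ)
  refine ⟨4 ^ (σ + 1) * (2 * C), by positivity, fun n hn θ => ?_⟩
  obtain ⟨b1, b2, b3, b4, -⟩ := exp_neg_inv_bounds hn
  have hn2 : (2 : ℝ) ≤ n := by exact_mod_cast hn
  set ρ := exp (-(1 / n : ℝ)) with hρ
  have hρ0 : 0 ≤ ρ := by linarith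
  have hε : 0 < 1 - ρ := by linarith
  have hper : Function.Periodic (fun φ => ‖1 - circleMap 0 ρ φ‖ ^ (-(σ + 1))) (2 * π) := fun φ => by
    simp only [periodic_circleMap 0 ρ φ]
  have hs : ∫ φ in (-π)..π, ‖1 - circleMap 0 ρ (φ + θ)‖ ^ (-(σ + 1)) =
      ∫ φ in (-π)..π, ‖1 - circleMap 0 ρ φ‖ ^ (-(σ + 1)) := by
    rw [intervalIntegral.integral_comp_add_right (fun φ => ‖1 - circleMap 0 ρ φ‖ ^ (-(σ + 1)))]
    have := hper.intervalIntegral_add_eq (-π + θ) (-π)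
    rwa [show -π + θ + 2 * π = π + θ by ring, show -π + 2 * π = π by ring] at this
  have hpos : ∀ φ : ℝ, 0 < |φ| + (1 - ρ) := fun φ => by positivity
  have hc : Continuous fun φ : ℝ => (|φ| + (1 - ρ)) ^ (-(σ + 1)) :=
    (by fun_prop : Continuous fun φ : ℝ => |φ| + (1 - ρ)).rpow_const fun φ => Or.inl (hpos φ).ne'
  have hle : -π ≤ π := by linarith [pi_pos]
  have h1 : ∫ φ in (-π)..π, (|φ| + (1 - ρ)) ^ (-(σ + 1)) =
      2 * ∫ φ in (1 - ρ)..(π + (1 - ρ)), φ ^ (-(σ + 1)) := by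
    have := lintegral_abs_add_rpow hε (-(σ + 1))
    rw [← ofReal_integral_eq_lintegral_ofReal ((hc.intervalIntegrable (-π) π).1)
      (Filter.Eventually.of_forall fun φ => by have := hpos φ; positivity),
      ← intervalIntegral.integral_of_le hle] at this
    refine (ENNReal.ofReal_eq_ofReal_iff (intervalIntegral.integral_nonneg hle fun φ _ => by
      have := hpos φ; positivity) (mul_nonneg two_pos.le
      (intervalIntegral.integral_nonneg (by linarith [pi_pos]) fun φ hφ => ?_))).1 this
    exact rpow_nonneg (by linarith [hφ.1]) _
  have h2 : ∫ φ in (-π)..π, ‖1 - circleMap 0 ρ φ‖ ^ (-(σ + 1)) ≤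
      ∫ φ in (-π)..π, 4 ^ (σ + 1) * (|φ| + (1 - ρ)) ^ (-(σ + 1)) := by
    have hc0 := continuous_norm_one_sub_circleMap_rpow hρ0 b2 0 (-(σ + 1))
    simp only [add_zero] at hc0
    refine intervalIntegral.integral_mono_on hle (hc0.intervalIntegrable _ _)
      ((hc.const_mul _).intervalIntegrable _ _) fun φ hφ => ?_
    have h3 := norm_one_sub_circleMap_ge b1 (abs_le.2 hφ)
    have := hpos φ
    refine (rpow_le_rpow_of_nonpos (by positivity) h3 (by linarith)).trans_eq ?_
    rw [div_rpow this.le (by norm_num), rpow_neg (by norm_num : (0 : ℝ) ≤ 4), div_inv_eq_mul,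
      mul_comm]
  have hn1 : 1 / (n : ℝ) ≤ 1 := by rw [div_le_one (by linarith)]; linarith
  have h4 := h n hn (1 - ρ) b3 (b4.trans hn1)
  rw [growthRate, if_neg (by linarith), if_neg (by linarith), neg_neg,
    show -σ - 1 = -(σ + 1) by ring] at h4
  rw [hs]
  refine h2.trans ?_
  rw [intervalIntegral.integral_const_mul, h1, mul_assoc]
  refine mul_le_mul_of_nonneg_left ?_ (by positivity)
  linarith

lemma add_rpow_le_two_rpow_mul {x y p : ℝ} (hx : 0 ≤ x) (hy : 0 ≤ y) (hp : 0 ≤ p) :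
    (x + y) ^ p ≤ 2 ^ p * (x ^ p + y ^ p) := by
  have px : 0 ≤ x ^ p := by positivity
  have py : 0 ≤ y ^ p := by positivity
  rcases le_total x y with h | h
  · calc (x + y) ^ p ≤ (2 * y) ^ p := by gcongr; linarith
      _ = 2 ^ p * y ^ p := mul_rpow (by norm_num) hy
      _ ≤ _ := by gcongr; linarith
  · calc (x + y) ^ p ≤ (2 * x) ^ p := by gcongr; linarith
      _ = 2 ^ p * x ^ p := mul_rpow (by norm_num) hx
      _ ≤ _ := by gcongr; linarith

lemma norm_one_sub_sq_le_mul {A B : ℂ} (hA0 : A ≠ 0) (hB0 : B ≠ 0) (hA : ‖A‖ ≤ 2) :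
    ‖1 - (1 - A) * (1 - B)‖ / ‖A * B‖ ≤ 3 * ‖A‖⁻¹ + 3 * ‖B‖⁻¹ := by
  have ha : 0 < ‖A‖ := norm_pos_iff.2 hA0
  have hb : 0 < ‖B‖ := norm_pos_iff.2 hB0
  have h : ‖1 - (1 - A) * (1 - B)‖ ≤ ‖A‖ + ‖B‖ + ‖A‖ * ‖B‖ := by
    rw [show 1 - (1 - A) * (1 - B) = A + B - A * B by ring, ← norm_mul]
    exact (norm_sub_le _ _).trans (by gcongr; exact norm_add_le _ _)
  rw [norm_mul, div_le_iff₀ (by positivity)]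
  refine h.trans ?_
  field_simp
  nlinarith

lemma symbol_mul_vertexTerm_le {σ k θ ρ φ : ℝ} (hσ : 0 ≤ σ) (hk : 0 ≤ k) (h0 : 0 ≤ ρ) (h1 : ρ < 1) :
    ‖1 - circleMap 0 ρ φ ^ 2‖ ^ (σ + 1) * ‖1 + circleMap 0 ρ φ ^ 2‖ ^ k *
      (‖qf (cos θ) (circleMap 0 ρ φ)‖ ^ (-(σ + 1)) *
        (‖qf (cos θ) (circleMap 0 ρ φ)‖ + |cos θ|) ^ (-k)) ≤
      2 ^ k * 6 ^ (σ + 1) * (‖1 - circleMap 0 ρ (φ + θ)‖ ^ (-(σ + 1)) +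
        ‖1 - circleMap 0 ρ (φ + -θ)‖ ^ (-(σ + 1))) := by
  set r := circleMap 0 ρ φ with hr
  have hA : 0 < ‖1 - circleMap 0 ρ (φ + θ)‖ := norm_one_sub_circleMap_pos h0 h1 _
  have hB : 0 < ‖1 - circleMap 0 ρ (φ + -θ)‖ := norm_one_sub_circleMap_pos h0 h1 _
  have hA2 : ‖1 - circleMap 0 ρ (φ + θ)‖ ≤ 2 := by
    refine (norm_sub_le _ _).trans ?_
    rw [norm_one, norm_circleMap_zero, abs_of_nonneg h0]; linarith
  have e1 : r * Complex.exp (θ * Complex.I) = circleMap 0 ρ (φ + θ) := circleMap_zero_mul_exp ρ φ θ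
  have e2 : r * Complex.exp (-θ * Complex.I) = circleMap 0 ρ (φ + -θ) := by
    rw [← circleMap_zero_mul_exp]; push_cast; rfl
  have hq : qf (cos θ) r = (1 - circleMap 0 ρ (φ + θ)) * (1 - circleMap 0 ρ (φ + -θ)) := by
    rw [qf_cos, e1, e2]
  have hW := norm_one_sub_sq_le_mul (norm_pos_iff.1 hA) (norm_pos_iff.1 hB) hA2
  have e3 : 1 - (1 - (1 - circleMap 0 ρ (φ + θ))) * (1 - (1 - circleMap 0 ρ (φ + -θ))) = 1 - r ^ 2 := by
    rw [← e1, ← e2, sub_sub_cancel, sub_sub_cancel, mul_mul_mul_comm, ← Complex.exp_add]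
    ring_nf; simp
  rw [e3, ← hq] at hW
  have hD : 0 < ‖qf (cos θ) r‖ := by rw [hq, norm_mul]; positivity
  set D := ‖qf (cos θ) r‖ with hDdef
  have hρr : ‖r‖ ≤ 1 := by rw [hr, norm_circleMap_zero, abs_of_nonneg h0]; linarith
  have hV : ‖1 + r ^ 2‖ ≤ 2 * (D + |cos θ|) := by
    have : 1 + r ^ 2 = qf (cos θ) r + 2 * (cos θ : ℂ) * r := by rw [qf]; ring
    rw [this]
    refine (norm_add_le _ _).trans ?_
    rw [norm_mul, norm_mul, Complex.norm_real, norm_eq_abs]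
    have : |cos θ| * ‖r‖ ≤ |cos θ| * 1 := by gcongr
    simp only [Complex.norm_ofNat]
    linarith
  have hDs : 0 < D + |cos θ| := by positivity
  have p1 : ‖1 - r ^ 2‖ ^ (σ + 1) * D ^ (-(σ + 1)) ≤
      6 ^ (σ + 1) * (‖1 - circleMap 0 ρ (φ + θ)‖ ^ (-(σ + 1)) +
        ‖1 - circleMap 0 ρ (φ + -θ)‖ ^ (-(σ + 1))) := by
    rw [rpow_neg hD.le, ← div_eq_mul_inv, ← div_rpow (norm_nonneg _) hD.le]
    refine (rpow_le_rpow (by positivity) hW (by linarith)).trans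
      ((add_rpow_le_two_rpow_mul (by positivity) (by positivity) (by linarith)).trans_eq ?_)
    rw [mul_rpow (by norm_num) (by positivity), mul_rpow (by norm_num) (by positivity),
      inv_rpow hA.le, inv_rpow hB.le, ← rpow_neg hA.le, ← rpow_neg hB.le, ← mul_add, ← mul_assoc,
      ← mul_rpow (by norm_num) (by norm_num)]
    norm_num
  have p2 : ‖1 + r ^ 2‖ ^ k * (D + |cos θ|) ^ (-k) ≤ 2 ^ k := by
    rw [rpow_neg hDs.le, ← div_eq_mul_inv, div_le_iff₀ (by positivity), ← mul_rpow (by norm_num) hDs.le]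
    gcongr
  calc _ = (‖1 + r ^ 2‖ ^ k * (D + |cos θ|) ^ (-k)) * (‖1 - r ^ 2‖ ^ (σ + 1) * D ^ (-(σ + 1))) := by ring
    _ ≤ 2 ^ k * (6 ^ (σ + 1) * (‖1 - circleMap 0 ρ (φ + θ)‖ ^ (-(σ + 1)) +
        ‖1 - circleMap 0 ρ (φ + -θ)‖ ^ (-(σ + 1)))) := by gcongr
    _ = _ := by ring

lemma vertexTerm_single_mul {d : ℕ} (κ : Fin (d + 1) → ℝ) (j : Fin (d + 1)) (s : ℝ) {D : ℝ}
    (hD : 0 < D) : vertexTerm κ (fun i => if i = j then s else 0) (lamK d κ + 1) D =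
      D ^ (-(lamK d κ - κ j + 1)) * (D + |s|) ^ (-κ j) := by
  have h1 : ∀ l ∈ univ.erase j, (D + |if l = j then s else 0|) ^ (-κ l) = D ^ (-κ l) := fun l hl => by
    rw [if_neg (ne_of_mem_erase hl), abs_zero, add_zero]
  rw [vertexTerm, ← mul_prod_erase univ _ (mem_univ j), prod_congr rfl h1, if_pos rfl,
    ← rpow_sum_of_pos hD, mul_left_comm, ← rpow_add hD, mul_comm, sum_neg_distrib,
    sum_erase_eq_sub (mem_univ j)]
  congr 2
  ring

lemma sgForm_single {m : ℕ} (e : Fin m → Bool) (j : Fin m) (s : ℝ) :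
    sgForm e (fun i => if i = j then s else 0) = sg (e j) * s := by
  simp [sgForm]

open Polynomial in
/-- Polynomials whose symbol vanishes to order `σ` at `±1` and `κ_j` at `±i` give zonal functions
with a small supremum. -/
lemma exists_abs_sum_coeff_mul_hP_le {d : ℕ} (hd : 1 ≤ d) {κ : Fin (d + 1) → ℝ}
    (hκ : ∀ i, 0 < κ i) (j : Fin (d + 1)) : ∃ C > 0, ∀ n : ℕ, 2 ≤ n → ∀ (c : ℝ[X]) (K : ℝ), 0 ≤ K →
      (∀ φ : ℝ, ‖aeval (circleMap 0 (exp (-(1 / n : ℝ))) φ)⁻¹ c‖ ≤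
        K * (‖1 - circleMap 0 (exp (-(1 / n : ℝ))) φ ^ 2‖ ^ (lamK d κ - κ j) *
          ‖1 + circleMap 0 (exp (-(1 / n : ℝ))) φ ^ 2‖ ^ κ j)) →
      ∀ y : EuclideanSpace ℝ (Fin (d + 1)), ‖y‖ = 1 →
      |∑ k ∈ c.support, c.coeff k * hP d κ k (EuclideanSpace.single j 1) y| ≤
        C * K * (n : ℝ) ^ (lamK d κ - κ j) := by
  have hl := lamK_pos hd hκ
  have hd' : (1 : ℝ) ≤ d := by exact_mod_cast hd
  have hσ : 0 < lamK d κ - κ j := by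
    have := sum_sub_pos hd hκ j
    rw [lamK]; linarith
  have hκj := hκ j
  obtain ⟨C₁, hC₁, h1⟩ := exists_norm_cubeG_le hκ (p := lamK d κ + 1) (by rw [lamK]; linarith)
  obtain ⟨C₂, hC₂, h2⟩ := exists_integral_norm_one_sub_circleMap_le hσ
  set σ := lamK d κ - κ j with hσdef
  set E := Fintype.card (Fin (d + 1) → Bool) with hE
  have hw := integral_wprod_pos hκ
  set B := (∫ t in cube (d + 1), wprod κ t)⁻¹ * (2 * π)⁻¹ with hB
  have hB0 : 0 < B := by have := pi_pos; positivity
  refine ⟨B * (C₁ * (2 ^ κ j * 6 ^ (σ + 1) * (E * (2 * C₂)))), by positivity, ?_⟩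
  intro n hn c K hK hc y hy
  obtain ⟨b1, b2, b3, b4, -⟩ := exp_neg_inv_bounds hn
  set ρ := exp (-(1 / n : ℝ)) with hρ
  have hρ0 : 0 < ρ := by linarith
  have hx : ‖(EuclideanSpace.single j (1 : ℝ) : EuclideanSpace ℝ (Fin (d + 1)))‖ = 1 := by simp
  have hys : |y j| ≤ 1 := by
    have := PiLp.norm_apply_le y j
    rwa [hy, norm_eq_abs] at this
  set b : Fin (d + 1) → ℝ := fun i => if i = j then y j else 0 with hb
  have hxy : (fun i => (EuclideanSpace.single j (1 : ℝ) : EuclideanSpace ℝ (Fin (d + 1))) i * y i) = b := by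
    funext i
    by_cases hij : i = j
    · subst hij; simp [hb]
    · simp [hb, hij]
  have hbs : ∑ i, |b i| ≤ 1 := hxy ▸ sum_abs_mul_le_one hx hy
  have hInt := sum_smul_hP_eq_integral hκ hl hx hy hρ0 b2 c.support c.coeff
  rw [hxy] at hInt
  have haev : ∀ φ, (∑ k ∈ c.support, (c.coeff k : ℂ) * ((circleMap 0 ρ φ) ^ k)⁻¹) =
      aeval (circleMap 0 ρ φ)⁻¹ c := fun φ => by
    rw [aeval_def, eval₂_eq_sum, Polynomial.sum_def]
    simp
  simp only [haev] at hInt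
  set θ : (Fin (d + 1) → Bool) → ℝ := fun e => arccos (sg (e j) * y j) with hθ
  have hcos : ∀ e, cos (θ e) = sg (e j) * y j := fun e => by
    have : |sg (e j) * y j| ≤ 1 := by rw [abs_mul, abs_sg, one_mul]; exact hys
    exact cos_arccos (abs_le.1 this).1 (abs_le.1 this).2
  set g : ℝ → ℝ := fun φ => K * C₁ * (2 ^ κ j * 6 ^ (σ + 1)) * ∑ e : Fin (d + 1) → Bool,
    (‖1 - circleMap 0 ρ (φ + θ e)‖ ^ (-(σ + 1)) + ‖1 - circleMap 0 ρ (φ + -θ e)‖ ^ (-(σ + 1))) with hg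
  have hle : -π ≤ π := by linarith [pi_pos]
  have hgc : ∀ t, Continuous fun φ => ‖1 - circleMap 0 ρ (φ + t)‖ ^ (-(σ + 1)) := fun t =>
    continuous_norm_one_sub_circleMap_rpow hρ0.le b2 t _
  have hgi : IntervalIntegrable g volume (-π) π :=
    (continuous_const.mul (continuous_finsetSum _ fun e _ =>
      (hgc (θ e)).add (hgc (-θ e)))).intervalIntegrable _ _
  have hpt : ∀ᵐ φ, φ ∈ Set.Ioc (-π) π → ‖aeval (circleMap 0 ρ φ)⁻¹ c * (1 - circleMap 0 ρ φ ^ 2) *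
      cubeG κ b (lamK d κ + 1) (circleMap 0 ρ φ)‖ ≤ g φ := by
    have := ae_circleMap_im_ne_zero hρ0
    rw [ae_restrict_iff' measurableSet_Ioc] at this
    filter_upwards [this] with φ hφ hmem
    have him := hφ hmem
    have hn1 : ‖circleMap 0 ρ φ‖ = ρ := norm_circleMap_zero' hρ0 φ
    have hG := h1 b hbs (circleMap 0 ρ φ) (by rw [hn1]; exact b1) (by rw [hn1]; exact b2) him
    rw [norm_mul, norm_mul]
    set W := ‖1 - circleMap 0 ρ φ ^ 2‖ with hW
    have hW0 : 0 < W := by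
      have := le_norm_one_sub_sq_circleMap hρ0 b2 φ
      linarith
    set V := ‖1 + circleMap 0 ρ φ ^ 2‖ with hV
    calc _ ≤ (K * (W ^ σ * V ^ κ j)) * W *
          (C₁ * ∑ e : Fin (d + 1) → Bool, vertexTerm κ b (lamK d κ + 1) ‖qf (sgForm e b) (circleMap 0 ρ φ)‖) := by
          gcongr
          exact hc φ
      _ = K * C₁ * ∑ e : Fin (d + 1) → Bool, W ^ (σ + 1) * V ^ κ j *
          vertexTerm κ b (lamK d κ + 1) ‖qf (sgForm e b) (circleMap 0 ρ φ)‖ := by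
          rw [← mul_sum, rpow_add_one hW0.ne']
          ring
      _ ≤ K * C₁ * ∑ e : Fin (d + 1) → Bool, 2 ^ κ j * 6 ^ (σ + 1) *
          (‖1 - circleMap 0 ρ (φ + θ e)‖ ^ (-(σ + 1)) + ‖1 - circleMap 0 ρ (φ + -θ e)‖ ^ (-(σ + 1))) := by
          refine mul_le_mul_of_nonneg_left (sum_le_sum fun e _ => ?_) (by positivity)
          rw [hb, sgForm_single, ← hcos e, vertexTerm_single_mul κ j (y j)
            (norm_pos_iff.2 (qf_ne_zero (abs_cos_le_one _) (by rw [hn1]; exact b2)))]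
          have hya : |y j| = |cos (θ e)| := by rw [hcos, abs_mul, abs_sg, one_mul]
          rw [hya]
          exact symbol_mul_vertexTerm_le hσ.le hκj.le hρ0.le b2
      _ = g φ := by rw [hg, ← mul_sum]; ring
  have hnorm := intervalIntegral.norm_integral_le_of_norm_le hle hpt hgi
  have hgint : ∫ φ in (-π)..π, g φ ≤
      K * C₁ * (2 ^ κ j * 6 ^ (σ + 1)) * (E * (2 * C₂ * (n : ℝ) ^ σ)) := by
    have hI : ∀ e ∈ (univ : Finset (Fin (d + 1) → Bool)), IntervalIntegrable
        (fun φ => ‖1 - circleMap 0 ρ (φ + θ e)‖ ^ (-(σ + 1)) +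
          ‖1 - circleMap 0 ρ (φ + -θ e)‖ ^ (-(σ + 1))) volume (-π) π := fun e _ =>
      ((hgc (θ e)).add (hgc (-θ e))).intervalIntegrable _ _
    rw [hg, intervalIntegral.integral_const_mul, intervalIntegral.integral_finsetSum hI]
    refine mul_le_mul_of_nonneg_left ?_ (by positivity)
    refine (sum_le_card_nsmul _ _ (2 * C₂ * (n : ℝ) ^ σ) fun e _ => ?_).trans_eq ?_
    · rw [intervalIntegral.integral_add ((hgc (θ e)).intervalIntegrable _ _)
        ((hgc (-θ e)).intervalIntegrable _ _)]
      have u := h2 n hn (θ e)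
      have v := h2 n hn (-θ e)
      linarith
    · rw [nsmul_eq_mul, hE]; rfl
  rw [← norm_eq_abs, ← Complex.norm_real, hInt, norm_mul]
  have hBn : ‖((∫ t in cube (d + 1), wprod κ t : ℝ) : ℂ)⁻¹ * (2 * π : ℂ)⁻¹‖ = B := by
    rw [show ((∫ t in cube (d + 1), wprod κ t : ℝ) : ℂ)⁻¹ * (2 * π : ℂ)⁻¹ = ((B : ℝ) : ℂ) by
      rw [hB]; push_cast; rfl, Complex.norm_real, norm_of_nonneg hB0.le]
  rw [hBn]
  calc _ ≤ B * (K * C₁ * (2 ^ κ j * 6 ^ (σ + 1)) * (E * (2 * C₂ * (n : ℝ) ^ σ))) := by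
        gcongr; exact hnorm.trans hgint
    _ = _ := by ring

lemma continuous_hP_single {d : ℕ} {κ : Fin (d + 1) → ℝ} (hκ : ∀ i, 0 < κ i) (hl : 0 < lamK d κ)
    (j : Fin (d + 1)) (k : ℕ) :
    Continuous fun y : EuclideanSpace ℝ (Fin (d + 1)) => hP d κ k (EuclideanSpace.single j 1) y := by
  simp only [hP_single hκ hl]
  fun_prop

/-- The pairing of the Cesàro kernel at `e_j` with the zonal expansion of coefficients `c`. -/
noncomputable def cesaroPairing {d : ℕ} {κ : Fin (d + 1) → ℝ} (hκ : ∀ i, 0 < κ i)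
    (j : Fin (d + 1)) (δ : ℝ) (n : ℕ) : Polynomial ℝ →ₗ[ℝ] ℝ :=
  ∑ k ∈ range (n + 1), (cesA δ (n - k) * axisNorm hκ j k) • Polynomial.lcoeff ℝ k

lemma cesaroPairing_apply {d : ℕ} {κ : Fin (d + 1) → ℝ} (hκ : ∀ i, 0 < κ i)
    (j : Fin (d + 1)) (δ : ℝ) (n : ℕ) (c : Polynomial ℝ) : cesaroPairing hκ j δ n c =
      ∑ k ∈ range (n + 1), cesA δ (n - k) * axisNorm hκ j k * c.coeff k := by
  simp [cesaroPairing]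

lemma integral_hK_mul_zonal {d : ℕ} (hd : 1 ≤ d) {κ : Fin (d + 1) → ℝ} (hκ : ∀ i, 0 < κ i)
    (j : Fin (d + 1)) (δ : ℝ) (n : ℕ) (c : Polynomial ℝ) :
    ∫ y, hK d κ δ n (EuclideanSpace.single j 1) y *
      (∑ l ∈ c.support, c.coeff l * hP d κ l (EuclideanSpace.single j 1) y) * hsq κ y
        ∂(sphereMeas d) = (cesA δ n)⁻¹ * cesaroPairing hκ j δ n c := by
  have hc := continuous_hP_single hκ (lamK_pos hd hκ) j
  have hs := continuous_hsq hκ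
  have hI : ∀ k l, Integrable (fun y : Metric.sphere (0 : EuclideanSpace ℝ (Fin (d + 1))) 1 =>
      cesA δ (n - k) * c.coeff l * (hP d κ k (EuclideanSpace.single j 1) y *
        hP d κ l (EuclideanSpace.single j 1) y * hsq κ y)) (sphereMeas d) := fun k l =>
    integrable_sphere (continuous_const.mul (((hc k).mul (hc l)).mul hs))
  have h1 : ∀ y : Metric.sphere (0 : EuclideanSpace ℝ (Fin (d + 1))) 1,
      hK d κ δ n (EuclideanSpace.single j 1) y *
      (∑ l ∈ c.support, c.coeff l * hP d κ l (EuclideanSpace.single j 1) y) * hsq κ y =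
      (cesA δ n)⁻¹ * ∑ k ∈ range (n + 1), ∑ l ∈ c.support, cesA δ (n - k) * c.coeff l *
        (hP d κ k (EuclideanSpace.single j 1) y * hP d κ l (EuclideanSpace.single j 1) y *
          hsq κ y) := fun y => by
    rw [hK, mul_assoc, mul_assoc, mul_comm (∑ l ∈ c.support, _) (hsq κ _), ← mul_assoc (∑ k ∈ _, _), sum_mul,
      sum_mul_sum]
    congr 1
    refine sum_congr rfl fun k _ => sum_congr rfl fun l _ => ?_
    ring
  simp only [h1]
  rw [integral_const_mul, integral_finsetSum _ fun k _ => integrable_finsetSum _ fun l _ => hI k l,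
    cesaroPairing_apply]
  congr 1
  refine sum_congr rfl fun k _ => ?_
  rw [integral_finsetSum _ fun l _ => hI k l]
  simp only [integral_const_mul, integral_hP_mul_hP hd hκ, mul_ite, mul_zero, sum_ite_eq]
  split_ifs with h
  · ring
  · rw [Polynomial.notMem_support_iff.1 h, mul_zero]

lemma bddAbove_cesaroNorm {d : ℕ} (hd : 1 ≤ d) {κ : Fin (d + 1) → ℝ} (hκ : ∀ i, 0 < κ i)
    {δ : ℝ} (hδ : -1 < δ) {n : ℕ} (hn : 2 ≤ n) :
    BddAbove (Set.range fun x : Metric.sphere (0 : EuclideanSpace ℝ (Fin (d + 1))) 1 =>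
      (∫ y, hsq κ y ∂(sphereMeas d))⁻¹ * ∫ y, |hK d κ δ n x y| * hsq κ y ∂(sphereMeas d)) := by
  obtain ⟨C, -, hC⟩ := exists_integral_abs_hK_le hd hκ hδ
  exact ⟨_, Set.forall_mem_range.2 (hC n hn)⟩

/-- Testing the Cesàro mean at `e_j` on a bounded zonal function bounds its norm from below. -/
lemma cesaroPairing_le {d : ℕ} (hd : 1 ≤ d) {κ : Fin (d + 1) → ℝ} (hκ : ∀ i, 0 < κ i)
    (j : Fin (d + 1)) {δ : ℝ} (hδ : -1 < δ) {n : ℕ} (hn : 2 ≤ n) (c : Polynomial ℝ) {B : ℝ}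
    (hB : ∀ y : EuclideanSpace ℝ (Fin (d + 1)), ‖y‖ = 1 →
      |∑ l ∈ c.support, c.coeff l * hP d κ l (EuclideanSpace.single j 1) y| ≤ B) :
    (∫ y, hsq κ y ∂(sphereMeas d))⁻¹ * ((cesA δ n)⁻¹ * cesaroPairing hκ j δ n c) ≤
      B * cesaroNormS d κ δ n := by
  have hc := continuous_hP_single hκ (lamK_pos hd hκ) j
  have hs := continuous_hsq hκ
  have hKc : Continuous fun y : EuclideanSpace ℝ (Fin (d + 1)) =>
      hK d κ δ n (EuclideanSpace.single j 1) y :=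
    continuous_const.mul (continuous_finsetSum _ fun k _ => continuous_const.mul (hc k))
  have hx : (EuclideanSpace.single j (1 : ℝ) : EuclideanSpace ℝ (Fin (d + 1))) ∈
      Metric.sphere (0 : EuclideanSpace ℝ (Fin (d + 1))) 1 := by simp
  have hB0 : 0 ≤ B := (abs_nonneg _).trans (hB (EuclideanSpace.single j 1) (by simp))
  have hH := inv_pos.2 (integral_hsq_pos hd hκ)
  have h2 : (cesA δ n)⁻¹ * cesaroPairing hκ j δ n c ≤
      B * ∫ y, |hK d κ δ n (EuclideanSpace.single j 1) y| * hsq κ y ∂(sphereMeas d) := by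
    rw [← integral_hK_mul_zonal hd, ← integral_const_mul]
    refine integral_mono (integrable_sphere ((hKc.mul (continuous_finsetSum _ fun k _ =>
      continuous_const.mul (hc k))).mul hs)) (integrable_sphere (continuous_const.mul
        (hKc.abs.mul hs))) fun y => ?_
    have hy := hB y (by simp)
    have hsy := hsq_nonneg κ (y : EuclideanSpace ℝ (Fin (d + 1)))
    calc _ ≤ |hK d κ δ n (EuclideanSpace.single j 1) y| *
          |∑ l ∈ c.support, c.coeff l * hP d κ l (EuclideanSpace.single j 1) y| * hsq κ y := by
          rw [← abs_mul]
          exact mul_le_mul_of_nonneg_right (le_abs_self _) hsy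
      _ ≤ |hK d κ δ n (EuclideanSpace.single j 1) y| * B * hsq κ y := by gcongr
      _ = _ := by ring
  calc _ ≤ (∫ y, hsq κ y ∂(sphereMeas d))⁻¹ *
        (B * ∫ y, |hK d κ δ n (EuclideanSpace.single j 1) y| * hsq κ y ∂(sphereMeas d)) := by
        gcongr
    _ = B * ((∫ y, hsq κ y ∂(sphereMeas d))⁻¹ *
        ∫ y, |hK d κ δ n (EuclideanSpace.single j 1) y| * hsq κ y ∂(sphereMeas d)) := by ring
    _ ≤ _ := mul_le_mul_of_nonneg_left
        (le_ciSup (bddAbove_cesaroNorm hd hκ hδ hn) ⟨_, hx⟩) hB0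

lemma one_le_cesaroNormS {d : ℕ} (hd : 1 ≤ d) {κ : Fin (d + 1) → ℝ} (hκ : ∀ i, 0 < κ i)
    {δ : ℝ} (hδ : -1 < δ) {n : ℕ} (hn : 2 ≤ n) : 1 ≤ cesaroNormS d κ δ n := by
  have hl := lamK_pos hd hκ
  have hw := integral_wprod_pos hκ
  have h0 : ∀ y, hP d κ 0 (EuclideanSpace.single 0 1) y = 1 := fun y => by
    have : ∀ t, gegenC 0 (lamK d κ) t = 1 := fun t => by simp [gegenC, jacobiP, poch, genBinom]
    simp only [hP, this, one_mul, Nat.cast_zero, zero_add]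
    field_simp
  have := cesaroPairing_le hd hκ 0 hδ hn (1 : Polynomial ℝ) (B := 1) fun y _ => by
    have : (1 : Polynomial ℝ).support = {0} := by
      simpa using Polynomial.support_C (one_ne_zero (α := ℝ))
    simp [this, h0]
  have hA := cesA_pos hδ n
  have hH := integral_hsq_pos hd hκ
  rw [cesaroPairing_apply, sum_eq_single_of_mem 0 (by simp) fun k _ hk => by
    rw [Polynomial.coeff_one, if_neg hk, mul_zero]] at this
  rw [axisNorm_zero hd hκ, Polynomial.coeff_one_zero, Nat.sub_zero, mul_one, one_mul] at this
  calc (1:ℝ) = _ := by field_simp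
    _ ≤ _ := this

open Polynomial in
lemma exists_cesaroPairing_le {d : ℕ} (hd : 1 ≤ d) {κ : Fin (d + 1) → ℝ} (hκ : ∀ i, 0 < κ i)
    (j : Fin (d + 1)) {δ : ℝ} (hδ : -1 < δ) : ∃ C > 0, ∀ n : ℕ, 2 ≤ n → ∀ (c : ℝ[X]) (K : ℝ),
      0 ≤ K → (∀ r : ℂ, ‖r‖ = exp (-(1 / n : ℝ)) →
        ‖aeval r⁻¹ c‖ ≤ K * (‖1 - r ^ 2‖ ^ (lamK d κ - κ j) * ‖1 + r ^ 2‖ ^ κ j)) →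
      cesaroPairing hκ j δ n c ≤
        C * K * (n : ℝ) ^ (lamK d κ - κ j + δ) * cesaroNormS d κ δ n := by
  obtain ⟨C, hC, h⟩ := exists_abs_sum_coeff_mul_hP_le hd hκ j
  obtain ⟨c₁, c₂, hc₁, hc₂, hA⟩ := growth_cesA hδ
  have hH := integral_hsq_pos hd hκ
  refine ⟨(∫ y, hsq κ y ∂(sphereMeas d)) * c₂ * C, by positivity, fun n hn c K hK hc => ?_⟩
  have hρ : 0 < exp (-(1 / n : ℝ)) := exp_pos _
  have h1 := cesaroPairing_le hd hκ j hδ hn c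
    (h n hn c K hK fun φ => hc _ (norm_circleMap_zero' hρ φ))
  have hn0 : (0 : ℝ) < n := by positivity
  have hA0 := cesA_pos hδ n
  have hΛ := one_le_cesaroNormS hd hκ hδ hn
  set H := ∫ y, hsq κ y ∂(sphereMeas d)
  calc cesaroPairing hκ j δ n c = H * cesA δ n * (H⁻¹ * ((cesA δ n)⁻¹ * cesaroPairing hκ j δ n c)) := by
        field_simp
    _ ≤ H * cesA δ n * (C * K * (n : ℝ) ^ (lamK d κ - κ j) * cesaroNormS d κ δ n) :=
        mul_le_mul_of_nonneg_left h1 (by positivity)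
    _ ≤ H * (c₂ * (n : ℝ) ^ δ) * (C * K * (n : ℝ) ^ (lamK d κ - κ j) * cesaroNormS d κ δ n) := by
        have := (hA n (by omega)).2
        gcongr
    _ = _ := by rw [rpow_add hn0]; ring

lemma pow_le_two_pow_mul_rpow {a s : ℝ} {N : ℕ} (ha : 0 ≤ a) (ha2 : a ≤ 2) (hs : 0 < s)
    (hsN : s ≤ N) : a ^ N ≤ 2 ^ N * a ^ s := by
  rcases ha.eq_or_lt with rfl | ha
  · have : N ≠ 0 := by rintro rfl; simp at hsN; linarith
    rw [zero_pow this, zero_rpow hs.ne', mul_zero]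
  · calc a ^ N = a ^ ((N : ℝ) - s) * a ^ s := by rw [← rpow_add ha, sub_add_cancel, rpow_natCast]
      _ ≤ 2 ^ ((N : ℝ) - s) * a ^ s := by gcongr
      _ ≤ 2 ^ (N : ℝ) * a ^ s := by gcongr <;> linarith
      _ = _ := by rw [rpow_natCast]

lemma norm_one_sub_inv {r : ℂ} (hr : r ≠ 0) : ‖1 - r⁻¹‖ = ‖r‖⁻¹ * ‖1 - r‖ := by
  rw [← norm_inv, ← norm_mul, mul_sub, mul_one, inv_mul_cancel₀ hr, norm_sub_rev]

lemma norm_one_add_inv {r : ℂ} (hr : r ≠ 0) : ‖1 + r⁻¹‖ = ‖r‖⁻¹ * ‖1 + r‖ := by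
  rw [← norm_inv, ← norm_mul, mul_add, mul_one, inv_mul_cancel₀ hr, add_comm]

lemma norm_inv_pow_le_exp {r : ℂ} {n m : ℕ} (hn : n ≠ 0) (hm : m ≤ n)
    (hr : ‖r‖ = exp (-(1 / n : ℝ))) : ‖r⁻¹‖ ^ m ≤ exp 1 := by
  rw [norm_inv, hr, ← exp_neg, ← exp_nat_mul]
  gcongr
  rw [neg_neg, mul_one_div]
  exact div_le_one_of_le₀ (by exact_mod_cast hm) (by positivity)

open Polynomial in
lemma cesaroPairing_X_pow_mul {d : ℕ} {κ : Fin (d + 1) → ℝ} (hκ : ∀ i, 0 < κ i)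
    (j : Fin (d + 1)) (δ : ℝ) (n : ℕ) (p : ℝ[X]) :
    cesaroPairing hκ j δ n (X ^ n * p) = axisNorm hκ j n * p.coeff 0 := by
  rw [cesaroPairing_apply, sum_eq_single_of_mem n (by simp) fun k hk hkn => by
    rw [coeff_X_pow_mul', if_neg (by have := mem_range.1 hk; omega), mul_zero]]
  rw [coeff_X_pow_mul', if_pos le_rfl, Nat.sub_self, cesA_zero, one_mul]

open Polynomial in
/-- Lower bound below the critical index. -/
lemma exists_le_cesaroNormS {d : ℕ} (hd : 1 ≤ d) {κ : Fin (d + 1) → ℝ} (hκ : ∀ i, 0 < κ i)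
    (j : Fin (d + 1)) {δ : ℝ} (hδ : -1 < δ) : ∃ C > 0, ∀ n : ℕ, 2 ≤ n →
      C * (n : ℝ) ^ (lamK d κ - κ j - δ) ≤ cesaroNormS d κ δ n := by
  have hσ : 0 < lamK d κ - κ j := by
    have h1 : (1 : ℝ) ≤ d := by exact_mod_cast hd
    have := sum_sub_pos hd hκ j
    rw [lamK]; linarith
  obtain ⟨C, hC, h⟩ := exists_cesaroPairing_le hd hκ j hδ
  obtain ⟨c₁, c₂, hc₁, hc₂, hN⟩ := growth_axisNorm hd hκ j
  set σ := lamK d κ - κ j with hσdef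
  obtain ⟨N, hNσ⟩ := exists_nat_ge (max σ (κ j))
  refine ⟨c₁ / (C * (exp 1 * (16 ^ N * (2 ^ N * 2 ^ N)))), by positivity, fun n hn => ?_⟩
  have hn0 : (0 : ℝ) < n := by positivity
  have h1 := h n hn (X ^ n * (1 - X ^ 4) ^ N) (exp 1 * (16 ^ N * (2 ^ N * 2 ^ N))) (by positivity)
    fun r hr => by
      have hb := (exp_neg_inv_bounds hn).1
      have hb1 := (exp_neg_inv_bounds hn).2.1
      rw [← hr] at hb hb1
      have hr0 : r ≠ 0 := norm_pos_iff.1 (by linarith)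
      have hi : ‖r ^ 4‖⁻¹ ≤ 16 := by
        rw [norm_pow]
        refine inv_le_of_inv_le₀ (by norm_num) ?_
        calc (16 : ℝ)⁻¹ = (1 / 2) ^ 4 := by norm_num
          _ ≤ _ := by gcongr
      have h2 : ‖r ^ 2‖ ≤ 1 := by rw [norm_pow]; exact pow_le_one₀ (norm_nonneg _) hb1.le
      have ha : ‖1 - r ^ 2‖ ≤ 2 := (norm_sub_le _ _).trans (by rw [norm_one]; linarith)
      have hb : ‖1 + r ^ 2‖ ≤ 2 := (norm_add_le _ _).trans (by rw [norm_one]; linarith)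
      have hf : 1 - r ^ 4 = (1 - r ^ 2) * (1 + r ^ 2) := by ring
      simp only [map_mul, map_pow, map_sub, map_one, aeval_X, norm_mul, norm_pow]
      rw [inv_pow, norm_one_sub_inv (pow_ne_zero 4 hr0), hf, norm_mul, mul_pow, mul_pow]
      calc _ ≤ exp 1 * (16 ^ N * ((2 ^ N * ‖1 - r ^ 2‖ ^ σ) * (2 ^ N * ‖1 + r ^ 2‖ ^ κ j))) := by
            gcongr
            · exact norm_inv_pow_le_exp (by omega) le_rfl hr
            · exact pow_le_two_pow_mul_rpow (norm_nonneg _) ha hσ ((le_max_left _ _).trans hNσ)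
            · exact pow_le_two_pow_mul_rpow (norm_nonneg _) hb (hκ j)
                ((le_max_right _ _).trans hNσ)
        _ = _ := by ring
  rw [cesaroPairing_X_pow_mul, coeff_zero_eq_eval_zero] at h1
  simp only [eval_pow, eval_sub, eval_one, eval_X] at h1
  norm_num at h1
  have h2 := (hN n (by omega)).1.trans h1
  have hp : (0 : ℝ) < (n : ℝ) ^ (σ + δ) := rpow_pos_of_pos hn0 _
  rw [div_mul_eq_mul_div, div_le_iff₀ (by positivity)]
  refine le_of_mul_le_mul_right ?_ hp
  rw [mul_assoc, ← rpow_add hn0, show σ - δ + (σ + δ) = 2 * σ by ring]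
  exact h2.trans_eq (by ring)

lemma min_one_sq_le {a v : ℝ} (ha : 1 < a) (hv : 0 < v) :
    min 1 (v ^ 2) ≤ 2 * (a + 1) / (a - 1) * (v * (a * v / (1 + a * v) - v / (1 + v))) := by
  have h : v * (a * v / (1 + a * v) - v / (1 + v)) =
      (a - 1) * (v ^ 2 / ((1 + a * v) * (1 + v))) := by
    field_simp
    ring
  rw [h, ← mul_assoc, div_mul_cancel₀ _ (by linarith), ← mul_div_assoc, le_div_iff₀ (by positivity)]
  rcases le_total v 1 with h1 | h1
  · calc _ ≤ v ^ 2 * ((1 + a * 1) * (1 + 1)) := by gcongr; exact min_le_right _ _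
      _ = _ := by ring
  · calc _ ≤ 1 * ((v + a * v) * (v + v)) := by gcongr; exact min_le_left _ _
      _ = _ := by ring

/-- Dyadic summation of quantities controlled by `min(2, 2 ^ i x)`. -/
lemma exists_dyadic_sum_le {σ : ℝ} {N : ℕ} (hσ : 0 < σ) (hN : 2 * σ ≤ N) : ∃ C > 0,
    ∀ (x : ℝ) (t : ℕ → ℝ) (L : ℕ), 0 < x → (∀ i, 0 ≤ t i) → (∀ i, t i ≤ 2) →
      (∀ i, t i ≤ 2 ^ i * x) →
      ∑ i ∈ range L, ((2 : ℝ) ^ i) ^ (-σ) * t i ^ N ≤ C * x ^ σ := by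
  set a : ℝ := 2 ^ σ with ha
  have ha1 : 1 < a := one_lt_rpow one_lt_two hσ
  set D := 2 * (a + 1) / (a - 1) with hD
  have hD0 : 0 < D := div_pos (by linarith) (by linarith)
  refine ⟨2 ^ N * D, by positivity, fun x t L hx h0 h2 ht => ?_⟩
  set v : ℕ → ℝ := fun i => (2 ^ i * x) ^ σ with hv
  have hv0 : ∀ i, 0 < v i := fun i => by positivity
  have hvs : ∀ i, v (i + 1) = a * v i := fun i => by
    rw [hv, ha, ← mul_rpow (by norm_num) (by positivity)]
    ring_nf
  have hterm : ∀ i, ((2 : ℝ) ^ i) ^ (-σ) * t i ^ N ≤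
      2 ^ N * D * x ^ σ * (v (i + 1) / (1 + v (i + 1)) - v i / (1 + v i)) := fun i => by
    have h3 : t i ^ N ≤ 2 ^ N * min 1 (v i ^ 2) := by
      rw [mul_min_of_nonneg _ _ (by positivity), mul_one]
      refine le_min (pow_le_pow_left₀ (h0 i) (h2 i) N) ?_
      refine (pow_le_two_pow_mul_rpow (h0 i) (h2 i) (by positivity) hN).trans ?_
      simp only [hv]
      rw [← rpow_natCast (_ ^ σ), ← rpow_mul (by positivity), mul_comm σ]
      push_cast
      have := h0 i
      have := ht i
      gcongr
    have h4 := min_one_sq_le ha1 (hv0 i)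
    have h5 : ((2 : ℝ) ^ i) ^ (-σ) * v i = x ^ σ := by
      simp only [hv]
      rw [mul_rpow (by positivity) hx.le, ← mul_assoc, ← rpow_add (by positivity),
        neg_add_cancel, rpow_zero, one_mul]
    rw [hvs]
    calc _ ≤ ((2 : ℝ) ^ i) ^ (-σ) * (2 ^ N *
          (D * (v i * (a * v i / (1 + a * v i) - v i / (1 + v i))))) := by
          gcongr
          exact h3.trans (by gcongr)
      _ = 2 ^ N * D * (((2 : ℝ) ^ i) ^ (-σ) * v i) *
          (a * v i / (1 + a * v i) - v i / (1 + v i)) := by ring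
      _ = _ := by rw [h5]
  refine (sum_le_sum fun i _ => hterm i).trans ?_
  rw [← mul_sum, sum_range_sub fun i => v i / (1 + v i)]
  have h6 : v L / (1 + v L) ≤ 1 := div_le_one_of_le₀ (by linarith) (by linarith [hv0 L])
  have h7 : 0 ≤ v 0 / (1 + v 0) := by have := hv0 0; positivity
  exact mul_le_of_le_one_right (by positivity) (by linarith)

lemma norm_one_sub_pow_le {r : ℂ} (hr : ‖r‖ ≤ 1) (m : ℕ) : ‖1 - r ^ m‖ ≤ m * ‖1 - r‖ := by
  induction m with
  | zero => simp
  | succ m ih =>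
    calc ‖1 - r ^ (m + 1)‖ = ‖(1 - r) + r * (1 - r ^ m)‖ := by ring_nf
      _ ≤ ‖1 - r‖ + 1 * (m * ‖1 - r‖) := by
        refine (norm_add_le _ _).trans ?_
        rw [norm_mul]
        gcongr
      _ = _ := by push_cast; ring

open Polynomial in
lemma coeff_one_add_mul_pow_nonneg (N k : ℕ) :
    0 ≤ (((1 + X) * (1 + X ^ 2) : ℝ[X]) ^ N).coeff k := by
  have : ((1 + X) * (1 + X ^ 2) : ℝ[X]) ^ N =
      ((((1 + X) * (1 + X ^ 2)) ^ N : ℕ[X])).map (Nat.castRingHom ℝ) := by simp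
  rw [this, coeff_map]
  exact Nat.cast_nonneg _

open Polynomial in
/-- Pairing with a difference of order `N` and step `m ≤ n` only sees the first two terms. -/
lemma le_cesaroPairing_difference {d : ℕ} {κ : Fin (d + 1) → ℝ} (hκ : ∀ i, 0 < κ i)
    (j : Fin (d + 1)) {δ : ℝ} (hδ : -1 < δ) {n m N : ℕ} (hmn : m < n) (hm0 : m ≠ 0) {E : ℝ[X]}
    (hN : ∀ k, 1 ≤ k → 0 ≤ axisNorm hκ j k)
    (hE : ∀ k, 0 ≤ E.coeff k) (hE0 : E.coeff 0 = 1) :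
    cesA δ m * axisNorm hκ j (n - m) - N * axisNorm hκ j n ≤
      cesaroPairing hκ j δ n (X ^ (n - m) * (E * (1 - X ^ m) ^ N)) := by
  have hm := hmn.le
  obtain ⟨k, hk⟩ := powAddExpansion (1 : ℝ[X]) (-X ^ m) N
  have hsplit : X ^ (n - m) * (E * (1 - X ^ m) ^ N) =
      X ^ (n - m) * E - (N : ℝ) • (X ^ n * E) + X ^ n * (X * (X ^ (m - 1) * (k * E))) := by
    obtain ⟨q, rfl⟩ := Nat.exists_eq_add_of_le hm
    obtain ⟨p, rfl⟩ := Nat.exists_eq_add_one_of_ne_zero hm0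
    rw [sub_eq_add_neg, hk, Nat.add_sub_cancel_left, Nat.add_sub_cancel, smul_eq_C_mul,
      map_natCast]
    ring
  have h1 : cesA δ m * axisNorm hκ j (n - m) ≤ cesaroPairing hκ j δ n (X ^ (n - m) * E) := by
    rw [cesaroPairing_apply]
    refine le_trans ?_ (single_le_sum (f := fun k => cesA δ (n - k) * axisNorm hκ j k *
      (X ^ (n - m) * E).coeff k) (fun k _ => ?_) (mem_range.2 (show n - m < n + 1 by omega)))
    · rw [coeff_X_pow_mul', if_pos le_rfl, Nat.sub_self, hE0, mul_one, Nat.sub_sub_self hm]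
    · rw [coeff_X_pow_mul']
      split_ifs with h
      · exact mul_nonneg (mul_nonneg (cesA_pos hδ _).le (hN k (by omega))) (hE _)
      · simp
  rw [hsplit, map_add, map_sub, map_smul, cesaroPairing_X_pow_mul, cesaroPairing_X_pow_mul, hE0,
    mul_one, smul_eq_mul, mul_coeff_zero, coeff_X_zero, zero_mul, mul_zero, add_zero]
  linarith

lemma log_le_two_mul_log_two {n : ℕ} (hn : 2 ≤ n) : log n ≤ 2 * Nat.log 2 n := by
  have h1 : n < 2 ^ (Nat.log 2 n + 1) := Nat.lt_pow_succ_log_self one_lt_two n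
  have h2 : 1 ≤ Nat.log 2 n := Nat.log_pos one_lt_two hn
  have h3 : (n : ℝ) ≤ 2 ^ (Nat.log 2 n + 1) := by exact_mod_cast h1.le
  have h4 : (1 : ℝ) ≤ Nat.log 2 n := by exact_mod_cast h2
  have h5 := log_le_log (by positivity) h3
  rw [log_pow] at h5
  push_cast at h5
  have h6 : log 2 ≤ 1 := by linarith [log_two_lt_d9]
  nlinarith

open Polynomial in
/-- The test polynomial at the critical index: a lacunary sum of differences. -/
noncomputable def dyadicTest (σ : ℝ) (N n : ℕ) : ℝ[X] :=
  ∑ i ∈ range (Nat.log 2 n), ((2 : ℝ) ^ i) ^ (-σ) •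
    (X ^ (n - 2 ^ i) * (((1 + X) * (1 + X ^ 2)) ^ N * (1 - X ^ 2 ^ i) ^ N))

open Polynomial in
lemma exists_norm_aeval_dyadicTest_le {σ κ : ℝ} {N : ℕ} (hσ : 0 < σ) (hκ : 0 < κ)
    (hN : 2 * σ ≤ N) (hNκ : κ ≤ N) : ∃ K ≥ 0, ∀ n : ℕ, 2 ≤ n → ∀ r : ℂ,
      ‖r‖ = exp (-(1 / n : ℝ)) →
      ‖aeval r⁻¹ (dyadicTest σ N n)‖ ≤ K * (‖1 - r ^ 2‖ ^ σ * ‖1 + r ^ 2‖ ^ κ) := by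
  obtain ⟨C, hC, hdy⟩ := exists_dyadic_sum_le hσ hN
  refine ⟨exp 1 * (8 ^ N * (2 ^ N * 2 ^ N)) * exp 1 ^ N * C, by positivity, fun n hn r hr => ?_⟩
  have hb := (exp_neg_inv_bounds hn).1
  have hb1 := (exp_neg_inv_bounds hn).2.1
  rw [← hr] at hb hb1
  have hr0 : r ≠ 0 := norm_pos_iff.1 (by linarith)
  have hi : ‖r‖⁻¹ ≤ 2 := inv_le_of_inv_le₀ (by norm_num) (by linarith)
  have hpow : ∀ m, ‖r ^ m‖ ≤ 1 := fun m => by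
    rw [norm_pow]; exact pow_le_one₀ (norm_nonneg _) hb1.le
  have hsub : ∀ m, ‖1 - r ^ m‖ ≤ 2 := fun m =>
    (norm_sub_le _ _).trans (by rw [norm_one]; linarith [hpow m])
  have hadd : ∀ m, ‖1 + r ^ m‖ ≤ 2 := fun m =>
    (norm_add_le _ _).trans (by rw [norm_one]; linarith [hpow m])
  have hx : 0 < ‖1 - r‖ := by
    rw [norm_pos_iff, sub_ne_zero]
    rintro rfl
    simp at hb1
  have hE : (‖1 + r⁻¹‖ * ‖1 + r⁻¹ ^ 2‖) ^ N ≤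
      8 ^ N * ((2 ^ N * ‖1 + r‖ ^ σ) * (2 ^ N * ‖1 + r ^ 2‖ ^ κ)) := by
    rw [inv_pow, norm_one_add_inv hr0, norm_one_add_inv (pow_ne_zero 2 hr0), norm_pow, ← inv_pow]
    calc _ ≤ (2 * ‖1 + r‖ * (2 ^ 2 * ‖1 + r ^ 2‖)) ^ N := by gcongr
      _ = 8 ^ N * (‖1 + r‖ ^ N * ‖1 + r ^ 2‖ ^ N) := by
        rw [← mul_pow, ← mul_pow]; ring_nf
      _ ≤ _ := by
        gcongr
        · refine pow_le_two_pow_mul_rpow (norm_nonneg _) ?_ hσ (by linarith)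
          simpa using hadd 1
        · exact pow_le_two_pow_mul_rpow (norm_nonneg _) (hadd 2) hκ hNκ
  have hterm : ∀ i ∈ range (Nat.log 2 n), ‖aeval r⁻¹ (((2 : ℝ) ^ i) ^ (-σ) •
      (X ^ (n - 2 ^ i) * (((1 + X) * (1 + X ^ 2)) ^ N * (1 - X ^ 2 ^ i) ^ N) : ℝ[X]))‖ ≤
      exp 1 * (8 ^ N * ((2 ^ N * ‖1 + r‖ ^ σ) * (2 ^ N * ‖1 + r ^ 2‖ ^ κ))) * exp 1 ^ N *
        (((2 : ℝ) ^ i) ^ (-σ) * ‖1 - r ^ 2 ^ i‖ ^ N) := fun i hi' => by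
    have hin : 2 ^ i ≤ n := (Nat.pow_le_pow_right two_pos (mem_range.1 hi').le).trans
      (Nat.pow_log_le_self 2 (by omega))
    rw [map_smul, norm_smul, norm_of_nonneg (by positivity)]
    simp only [map_mul, map_pow, map_sub, map_add, map_one, aeval_X, norm_mul, norm_pow]
    have h1 := norm_inv_pow_le_exp (m := n - 2 ^ i) (by omega) (Nat.sub_le _ _) hr
    have h2 := norm_inv_pow_le_exp (by omega) hin hr
    have h3 : ‖1 - r⁻¹ ^ 2 ^ i‖ ≤ exp 1 * ‖1 - r ^ 2 ^ i‖ := by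
      rw [inv_pow, norm_one_sub_inv (pow_ne_zero _ hr0), ← norm_inv, ← inv_pow, norm_pow]
      gcongr
    calc _ ≤ ((2 : ℝ) ^ i) ^ (-σ) * (exp 1 *
          (8 ^ N * ((2 ^ N * ‖1 + r‖ ^ σ) * (2 ^ N * ‖1 + r ^ 2‖ ^ κ)) *
            (exp 1 * ‖1 - r ^ 2 ^ i‖) ^ N)) := by gcongr
      _ = _ := by ring
  rw [dyadicTest, map_sum]
  refine (norm_sum_le_of_le _ hterm).trans ?_
  rw [← mul_sum]
  have hsum := hdy ‖1 - r‖ (fun i => ‖1 - r ^ 2 ^ i‖) (Nat.log 2 n) hx (fun i => norm_nonneg _)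
    (fun i => hsub _) fun i => by simpa using norm_one_sub_pow_le hb1.le (2 ^ i)
  have hf : ‖1 - r ^ 2‖ ^ σ = ‖1 - r‖ ^ σ * ‖1 + r‖ ^ σ := by
    rw [← mul_rpow (norm_nonneg _) (norm_nonneg _), ← norm_mul]
    ring_nf
  rw [hf]
  calc _ ≤ exp 1 * (8 ^ N * ((2 ^ N * ‖1 + r‖ ^ σ) * (2 ^ N * ‖1 + r ^ 2‖ ^ κ))) * exp 1 ^ N *
        (C * ‖1 - r‖ ^ σ) := by gcongr
    _ = _ := by ring

lemma exists_le_cesaroPairing_dyadicTest {d : ℕ} (hd : 1 ≤ d) {κ : Fin (d + 1) → ℝ}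
    (hκ : ∀ i, 0 < κ i) (j : Fin (d + 1)) {σ : ℝ} (hσ : 0 < σ) (hσj : σ = lamK d κ - κ j) (N : ℕ) :
    ∃ p > 0, ∃ q ≥ 0, ∀ n : ℕ, 2 ≤ n → (p * log n - q) * (n : ℝ) ^ (σ + σ) ≤
      cesaroPairing hκ j σ n (dyadicTest σ N n) := by
  have hσ1 : -1 < σ := by linarith
  obtain ⟨a₁, a₂, ha₁, ha₂, hA⟩ := growth_cesA hσ1
  obtain ⟨b₁, b₂, hb₁, hb₂, hN⟩ := growth_axisNorm hd hκ j
  rw [← hσj, two_mul] at hN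
  have hN0 : ∀ k, 1 ≤ k → 0 ≤ axisNorm hκ j k := fun k hk =>
    (by positivity : 0 ≤ b₁ * (k : ℝ) ^ (σ + σ)).trans (hN k hk).1
  set w : ℝ := 2 ^ (-σ) with hw
  have hw0 : 0 < w := by positivity
  have hw1 : w < 1 := rpow_lt_one_of_one_lt_of_neg one_lt_two (by linarith)
  refine ⟨a₁ * b₁ * 2⁻¹ ^ (σ + σ) / 2, by positivity, N * b₂ * (1 - w)⁻¹,
    mul_nonneg (by positivity) (inv_nonneg.2 (by linarith)), fun n hn => ?_⟩
  have hterm : ∀ i ∈ range (Nat.log 2 n),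
      (a₁ * b₁ * 2⁻¹ ^ (σ + σ) - N * b₂ * w ^ i) * (n : ℝ) ^ (σ + σ) ≤
      cesaroPairing hκ j σ n (((2 : ℝ) ^ i) ^ (-σ) • (Polynomial.X ^ (n - 2 ^ i) *
        (((1 + Polynomial.X) * (1 + Polynomial.X ^ 2)) ^ N * (1 - Polynomial.X ^ 2 ^ i) ^ N))) :=
      fun i hi => by
    have hin : 2 * 2 ^ i ≤ n := by
      rw [← pow_succ']
      exact (Nat.pow_le_pow_right two_pos (mem_range.1 hi)).trans
        (Nat.pow_log_le_self 2 (by omega))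
    have hi0 : 0 < 2 ^ i := by positivity
    have h1 := le_cesaroPairing_difference hκ j hσ1
      (show 2 ^ i < n by omega) hi0.ne' (N := N) hN0 (coeff_one_add_mul_pow_nonneg N) (by
        simp [Polynomial.coeff_zero_eq_eval_zero])
    have h2 := (hA (2 ^ i) hi0).1
    push_cast at h2
    have h3 : b₁ * (2⁻¹ * n : ℝ) ^ (σ + σ) ≤ axisNorm hκ j (n - 2 ^ i) := by
      refine le_trans ?_ (hN (n - 2 ^ i) (by omega)).1
      have : (2 * 2 ^ i : ℝ) ≤ n := by exact_mod_cast hin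
      rw [Nat.cast_sub (by omega)]
      push_cast
      gcongr
      linarith
    have h4 := (hN n (by omega)).2
    have h5 : ((2 : ℝ) ^ i) ^ (-σ) = w ^ i := by
      rw [hw, ← rpow_natCast, ← rpow_natCast, ← rpow_mul (by norm_num), ← rpow_mul (by norm_num),
        mul_comm]
    have h6 : w ^ i * ((2 : ℝ) ^ i) ^ σ = 1 := by
      rw [← h5, ← rpow_add (by positivity), neg_add_cancel, rpow_zero]
    rw [map_smul, smul_eq_mul, h5]
    refine le_trans ?_ (mul_le_mul_of_nonneg_left h1 (by positivity))
    have h7 : (a₁ * (2 ^ i) ^ σ) * (b₁ * (2⁻¹ * n : ℝ) ^ (σ + σ)) ≤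
        cesA σ (2 ^ i) * axisNorm hκ j (n - 2 ^ i) :=
      mul_le_mul h2 h3 (by positivity) (cesA_pos hσ1 _).le
    calc _ = w ^ i * ((a₁ * (2 ^ i) ^ σ) * (b₁ * (2⁻¹ * n : ℝ) ^ (σ + σ)) -
          N * (b₂ * (n : ℝ) ^ (σ + σ))) := by
          rw [mul_rpow (by norm_num) (by positivity)]
          linear_combination (-a₁ * b₁ * 2⁻¹ ^ (σ + σ) * (n : ℝ) ^ (σ + σ)) * h6
      _ ≤ _ := by gcongr
  rw [dyadicTest, map_sum]
  refine le_trans ?_ (sum_le_sum hterm)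
  rw [← sum_mul, sum_sub_distrib, sum_const, card_range, nsmul_eq_mul]
  have hg : ∑ i ∈ range (Nat.log 2 n), w ^ i ≤ (1 - w)⁻¹ := by
    rw [← tsum_geometric_of_lt_one hw0.le hw1]
    exact (summable_geometric_of_lt_one hw0.le hw1).sum_le_tsum _ fun i _ => by positivity
  have hL := log_le_two_mul_log_two hn
  have h8 : a₁ * b₁ * 2⁻¹ ^ (σ + σ) / 2 * log n ≤
      a₁ * b₁ * 2⁻¹ ^ (σ + σ) / 2 * (2 * Nat.log 2 n) := by gcongr
  have h9 : N * b₂ * ∑ i ∈ range (Nat.log 2 n), w ^ i ≤ N * b₂ * (1 - w)⁻¹ := by gcongr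
  rw [mul_sum] at h9
  exact mul_le_mul_of_nonneg_right (by linarith) (by positivity)

/-- Lower bound at the critical index. -/
lemma exists_log_le_cesaroNormS {d : ℕ} (hd : 1 ≤ d) {κ : Fin (d + 1) → ℝ} (hκ : ∀ i, 0 < κ i)
    (j : Fin (d + 1)) {σ : ℝ} (hσ : 0 < σ) (hσj : σ = lamK d κ - κ j) : ∃ C > 0, ∀ n : ℕ, 2 ≤ n →
      C * log n ≤ cesaroNormS d κ σ n := by
  have hσ1 : -1 < σ := by linarith
  obtain ⟨N, hN⟩ := exists_nat_ge (max (2 * σ) (κ j))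
  obtain ⟨K, hK, hsym⟩ := exists_norm_aeval_dyadicTest_le hσ (hκ j) ((le_max_left _ _).trans hN)
    ((le_max_right _ _).trans hN)
  obtain ⟨p, hp, q, hq, hlow⟩ := exists_le_cesaroPairing_dyadicTest hd hκ j hσ hσj N
  obtain ⟨C, hC, hup⟩ := exists_cesaroPairing_le hd hκ j hσ1
  rw [← hσj] at hup
  refine ⟨p / (C * K + q + 1), by positivity, fun n hn => ?_⟩
  have hn0 : (0 : ℝ) < n := by positivity
  have h1 := (hlow n hn).trans (hup n hn _ K hK (hsym n hn))
  have hΛ := one_le_cesaroNormS hd hκ hσ1 hn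
  have h2 : p * log n - q ≤ C * K * cesaroNormS d κ σ n := by
    refine le_of_mul_le_mul_right ?_ (rpow_pos_of_pos hn0 (σ + σ))
    exact h1.trans_eq (by ring)
  rw [div_mul_eq_mul_div, div_le_iff₀ (by positivity)]
  nlinarith

/-- Theorem 2.2: for `δ > -1` the Cesàro `(C,δ)` mean norms satisfy
`Λ_n^δ ∼ 1` if `δ > σ_κ`, `Λ_n^δ ∼ log n` if `δ = σ_κ`, and `Λ_n^δ ∼ n^{σ_κ-δ}`
if `-1 < δ < σ_κ`, for `n ≥ 2`. -/
theorem cesaro_norm_sphere (d : ℕ) (hd : 1 ≤ d) (κ : Fin (d + 1) → ℝ)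
    (hκ : ∀ i, 0 < κ i) (δ : ℝ) (hδ : -1 < δ) :
    ∃ c₁ c₂ : ℝ, 0 < c₁ ∧ 0 < c₂ ∧ ∀ n : ℕ, 2 ≤ n →
      (δ > sigmaK d κ →
        c₁ ≤ cesaroNormS d κ δ n ∧ cesaroNormS d κ δ n ≤ c₂) ∧
      (δ = sigmaK d κ →
        c₁ * Real.log n ≤ cesaroNormS d κ δ n ∧ cesaroNormS d κ δ n ≤ c₂ * Real.log n) ∧
      (δ < sigmaK d κ →
        c₁ * (n : ℝ) ^ (sigmaK d κ - δ) ≤ cesaroNormS d κ δ n ∧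
          cesaroNormS d κ δ n ≤ c₂ * (n : ℝ) ^ (sigmaK d κ - δ)) := by
  obtain ⟨j, -, hj⟩ := exists_eq_sigmaK κ
  have hσ := sigmaK_pos hd hκ
  have hσj : sigmaK d κ = lamK d κ - κ j := by rw [hj, lamK]; ring
  obtain ⟨C, hC, hup⟩ := exists_integral_abs_hK_le hd hκ hδ
  have hle : ∀ n : ℕ, 2 ≤ n → cesaroNormS d κ δ n ≤
      C * ((n : ℝ) ^ (sigmaK d κ - δ) * growthRate (sigmaK d κ - δ) n) := fun n hn =>
    have : Nonempty (Metric.sphere (0 : EuclideanSpace ℝ (Fin (d + 1))) 1) :=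
      ⟨⟨EuclideanSpace.single j 1, by simp⟩⟩
    ciSup_le (hup n hn)
  obtain ⟨p, hp, hpow⟩ := exists_le_cesaroNormS hd hκ j hδ
  obtain ⟨q, hq, hlog⟩ := exists_log_le_cesaroNormS hd hκ j hσ hσj
  rw [← hσj] at hpow
  refine ⟨min 1 (min p q), C, by positivity, hC, fun n hn => ?_⟩
  have hn0 : (0 : ℝ) < n := by positivity
  have hln : 0 ≤ log n := log_natCast_nonneg n
  refine ⟨fun h => ⟨(min_le_left _ _).trans (one_le_cesaroNormS hd hκ hδ hn), ?_⟩, fun h => ?_,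
    fun h => ⟨?_, ?_⟩⟩
  · have := hle n hn
    rwa [growthRate, if_neg (by linarith), if_neg (by linarith), ← rpow_add hn0, add_neg_cancel,
      rpow_zero, mul_one] at this
  · have := hle n hn
    rw [growthRate, if_neg (by linarith), if_pos (by linarith), h, sub_self, rpow_zero,
      one_mul] at this
    rw [h]
    refine ⟨(mul_le_mul_of_nonneg_right ?_ hln).trans (hlog n hn), this⟩
    exact (min_le_right _ _).trans (min_le_right _ _)
  · refine (mul_le_mul_of_nonneg_right ?_ (by positivity)).trans (hpow n hn)
    exact (min_le_right _ _).trans (min_le_left _ _)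
  · have := hle n hn
    rwa [growthRate, if_pos (by linarith), mul_one] at this
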